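/- Let H be a division ring of finite dimension over its center k, and suppose k contains an algebraically closed subfield (i.e., there is a ring homomorphism from an algebraically closed field into k). Let F be a division ring that is a classical right quotient ring of the ring H[X] of polynomial functions on H (via an injective ring homomorphism φ : H[X] → F). Then for every finite group G there exist a division ring M and an injective ring homomorphism ι : F → M such that the extension M/F is Galois with Galois group isomorphic to G. -/

import Mathlib

universe u v w x

/-- The subgroup of ring automorphisms of `M` fixing the image of `ι` pointwise
(the Galois group of the extension `M/F` given by `ι`). -/
def fixingAut {F M : Type*} [DivisionRing F] [DivisionRing M] (ι : F →+* M) :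
    Subgroup (RingAut M) where
  carrier := {σ | ∀ x : F, σ (ι x) = ι x}
  one_mem' := fun _ => rfl
  mul_mem' := by
    intro a b ha hb x
    show a (b (ι x)) = ι x
    rw [hb x, ha x]
  inv_mem' := by
    intro a ha x
    show a.symm (ι x) = ι x
    conv_lhs => rw [← ha x]
    exact a.symm_apply_apply _

/-- The extension `M/F` given by `ι : F →+* M` is Galois: every element of `M` fixed by all
ring automorphisms of `M` fixing `ι(F)` pointwise lies in `ι(F)`. -/
def IsGaloisExt {F M : Type*} [DivisionRing F] [DivisionRing M] (ι : F →+* M) : Prop :=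
  ∀ m : M, (∀ σ ∈ fixingAut ι, σ m = m) → m ∈ Set.range ι

/-- The ring `H[X]` of polynomial functions on a division ring `H`: the subring of `H → H`
(with pointwise operations) generated by the constant functions and the identity function. -/
def polyFunRing (H : Type*) [DivisionRing H] : Subring (H → H) :=
  Subring.closure ({f | ∃ c : H, f = Function.const H c} ∪ {id})

/-- `F` is a classical right quotient ring of `R` via the injective ring homomorphism `φ`:
every element of `F` is of the form `φ a * (φ b)⁻¹` with `b ≠ 0`. -/
def IsClassicalRightQuotient {R F : Type*} [Ring R] [DivisionRing F] (φ : R →+* F) : Prop :=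
  Function.Injective φ ∧ ∀ x : F, ∃ a b : R, b ≠ 0 ∧ x = φ a * (φ b)⁻¹

/-- Auxiliary construction for the iterated polynomial ring. -/
noncomputable def IterPolyAux (H : Type u) [Ring H] : ℕ → ((T : Type u) × Ring T)
  | 0 => ⟨H, inferInstance⟩
  | n + 1 =>
    letI := (IterPolyAux H n).2
    ⟨Polynomial (IterPolyAux H n).1, inferInstance⟩

/-- The iterated polynomial ring `H_c[t₁, …, t_n]` in `n` central variables over `H`:
`IterPoly H 0 = H` and `IterPoly H (n + 1) = Polynomial (IterPoly H n)`. -/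
def IterPoly (H : Type u) [Ring H] (n : ℕ) : Type u := (IterPolyAux H n).1

noncomputable instance (H : Type u) [Ring H] (n : ℕ) : Ring (IterPoly H n) :=
  (IterPolyAux H n).2

namespace Patching

section Induced

open scoped TensorProduct

variable {E Q : Type*} [Field E] [Field Q] [Algebra E Q] {G : Type*} [Group G]

/-- The algebra induced to `G` from the compositum of `P` and `F`: functions `G → P F`
which are equivariant for the embedding `g` of the Galois group of `F` into `G`. -/
def induced (P : Subalgebra E Q) (F : IntermediateField E Q) (g : (F ≃ₐ[E] F) →* G) :
    Subalgebra E (G → Q) where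
  carrier := {a | ∃ α : G → P ⊗[E] F,
    (∀ x τ, α (x * (g τ)⁻¹) = Algebra.TensorProduct.map (AlgHom.id E P) (τ : F →ₐ[E] F) (α x)) ∧
    ∀ x, a x = Algebra.TensorProduct.lift P.val F.val (fun _ _ => Commute.all _ _) (α x)}
  mul_mem' := by
    rintro a b ⟨α, h1, h2⟩ ⟨β, h3, h4⟩
    exact ⟨fun x => α x * β x, fun x τ => by simp [h1, h3], fun x => by simp [h2, h4]⟩
  add_mem' := by
    rintro a b ⟨α, h1, h2⟩ ⟨β, h3, h4⟩
    exact ⟨fun x => α x + β x, fun x τ => by simp [h1, h3], fun x => by simp [h2, h4]⟩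
  algebraMap_mem' := fun e =>
    ⟨fun _ => algebraMap _ _ e, fun x τ => (AlgHom.commutes _ _).symm,
      fun x => (AlgHom.commutes _ _).symm⟩

variable {P : Subalgebra E Q} {F : IntermediateField E Q} {g : (F ≃ₐ[E] F) →* G}

lemma mem_induced {a : G → Q} : a ∈ induced P F g ↔ ∃ α : G → P ⊗[E] F,
    (∀ x τ, α (x * (g τ)⁻¹) = Algebra.TensorProduct.map (AlgHom.id E P) (τ : F →ₐ[E] F) (α x)) ∧
    ∀ x, a x = Algebra.TensorProduct.lift P.val F.val (fun _ _ => Commute.all _ _) (α x) :=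
  Iff.rfl

lemma translate_mem_induced {a : G → Q} (ha : a ∈ induced P F g) (h : G) :
    (fun x => a (h * x)) ∈ induced P F g := by
  obtain ⟨α, h1, h2⟩ := mem_induced.1 ha
  exact ⟨fun x => α (h * x), fun x τ => by rw [← h1, mul_assoc], fun x => h2 _⟩

lemma induced_apply_eq_zero (hd : Function.Injective
      (Algebra.TensorProduct.lift P.val F.val (fun _ _ => Commute.all _ _)))
    {a : G → Q} (ha : a ∈ induced P F g) {x : G} (hx : a x = 0) (τ : F ≃ₐ[E] F) :
    a (x * g τ) = 0 := by
  obtain ⟨α, h1, h2⟩ := mem_induced.1 ha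
  rw [h2] at hx ⊢
  have h0 : α x = 0 := hd (by rw [hx, map_zero])
  have := h1 x τ⁻¹
  rw [map_inv, inv_inv] at this
  rw [this, h0, map_zero, map_zero]

lemma galois_matrix_injective [FiniteDimensional E F] [IsGalois E F]
    (b : Module.Basis (F ≃ₐ[E] F) E F) (q : (F ≃ₐ[E] F) → Q)
    (hq : ∀ τ : F ≃ₐ[E] F, ∑ σ, q σ * ((τ (b σ) : F) : Q) = 0) : q = 0 := by
  classical
  let A : Matrix (F ≃ₐ[E] F) (F ≃ₐ[E] F) Q := fun τ σ => ((τ (b σ) : F) : Q)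
  have hrows : LinearIndependent Q A.row := by
    have h := linearIndependent_monoidHom F Q
    rw [Fintype.linearIndependent_iff]
    intro c hc
    let f : (F ≃ₐ[E] F) → (F →* Q) := fun τ => ((F.val.comp (τ : F →ₐ[E] F) : F →ₐ[E] Q) : F →* Q)
    have hf : Function.Injective f := by
      intro τ τ' hh
      ext y
      exact DFunLike.congr_fun hh y
    have h' := h.comp f hf
    rw [Fintype.linearIndependent_iff] at h'
    apply h'
    let T : F →ₗ[E] Q := ∑ τ, c τ • ((F.val.comp (τ : F →ₐ[E] F)).toLinearMap)
    have hT : T = 0 := by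
      refine b.ext fun σ => ?_
      have := congrFun hc σ
      simpa [T, A, Matrix.row, Finset.sum_apply] using this
    funext y
    have := LinearMap.congr_fun hT y
    simpa [T, f, Finset.sum_apply] using this
  have hu : IsUnit A := by
    rwa [Matrix.linearIndependent_rows_iff_isUnit] at hrows
  have h0 : A.mulVec q = 0 := by
    funext τ
    simp only [Matrix.mulVec, dotProduct, A, Pi.zero_apply]
    rw [← hq τ]
    exact Finset.sum_congr rfl fun _ _ => mul_comm _ _
  exact (Matrix.mulVec_injective_iff_isUnit.2 hu) (by rw [h0, Matrix.mulVec_zero])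

lemma exists_coset_section {Γ : Type*} [Group Γ] (g : Γ →* G) :
    ∃ (r : G → G) (t : G → Γ), (∀ x, x = r x * (g (t x))⁻¹) ∧
      (∀ x σ, r (x * (g σ)⁻¹) = r x) := by
  have hr : ∀ x : G, ∃ σ : Γ, x⁻¹ * (QuotientGroup.mk x : G ⧸ g.range).out = g σ := by
    intro x
    have : (QuotientGroup.mk x : G ⧸ g.range) = QuotientGroup.mk
      ((QuotientGroup.mk x : G ⧸ g.range).out) := by simp
    obtain ⟨σ, hσ⟩ := QuotientGroup.eq.1 this
    exact ⟨σ, hσ.symm⟩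
  choose t ht using hr
  refine ⟨fun x => (QuotientGroup.mk x : G ⧸ g.range).out, t, fun x => ?_, fun x σ => ?_⟩
  · rw [← ht]; group
  · refine congrArg Quotient.out ?_
    rw [QuotientGroup.eq]
    exact ⟨σ, by group⟩

lemma exists_induced_coordinates [Finite G] [FiniteDimensional E F] [IsGalois E F]
    (hg : Function.Injective g) :
    ∃ e : (G → Q) ≃ₗ[Q] (G → Q), ∀ a, a ∈ induced P F g ↔ ∀ x, e a x ∈ P := by
  classical
  obtain ⟨r, t, hrt, hr⟩ := exists_coset_section g
  have hcard : Fintype.card (Fin (Module.finrank E F)) = Fintype.card (F ≃ₐ[E] F) := by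
    rw [← Nat.card_eq_fintype_card (α := F ≃ₐ[E] F), IsGalois.card_aut_eq_finrank]; simp
  let b : Module.Basis (F ≃ₐ[E] F) E F :=
    (Module.finBasis E F).reindex (Fintype.equivOfCardEq hcard)
  have hrr : ∀ x, r (r x) = r x := fun x => by
    conv_lhs => rw [show r x = x * (g (t x)⁻¹)⁻¹ by
      rw [map_inv, inv_inv]; exact (eq_mul_inv_iff_mul_eq.1 (hrt x)).symm]
    rw [hr]
  have ht : ∀ x σ, t (x * (g σ)⁻¹) = σ * t x := fun x σ => by
    apply hg
    have h1 := hrt (x * (g σ)⁻¹)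
    rw [hr, mul_inv_eq_iff_eq_mul] at h1
    have h2 := hrt x
    rw [h1] at h2
    rw [map_mul]
    have h3 : (g (t (x * (g σ)⁻¹)))⁻¹ * g σ = (g (t x))⁻¹ := by
      rw [mul_assoc] at h2
      have h4 := hrt x
      exact mul_left_cancel ((h1.symm.trans h4 |> fun h => by rw [← mul_assoc]; exact h))
    rw [← inv_inv (g (t x)), ← h3]; group
  have htr : ∀ x, t (r x) = 1 := fun x => by
    apply hg
    have := hrt (r x)
    rw [hrr] at this
    rw [map_one]; simpa using this
  let T : (G → Q) →ₗ[Q] (G → Q) :=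
    { toFun := fun q x => ∑ σ, q (r x * (g σ)⁻¹) * ((t x (b σ) : F) : Q)
      map_add' := fun q q' => by
        funext x; simp [add_mul, Finset.sum_add_distrib]
      map_smul' := fun c q => by
        funext x; simp [Finset.mul_sum, mul_assoc] }
  have hT : Function.Injective T := by
    rw [← LinearMap.ker_eq_bot, LinearMap.ker_eq_bot']
    intro q hq
    have key : ∀ x, (fun σ => q (r x * (g σ)⁻¹)) = 0 := fun x => by
      apply galois_matrix_injective b
      intro τ
      have := congrFun hq (r x * (g τ)⁻¹)
      simpa [T, hr, hrr, ht, htr] using this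
    funext x
    rw [hrt x]
    exact congrFun (key x) (t x)
  let e := LinearEquiv.ofInjectiveEndo T hT
  refine ⟨e.symm, fun a => ⟨?_, fun ha => ?_⟩⟩
  · intro ha
    obtain ⟨α, h1, h2⟩ := mem_induced.1 ha
    let B : Module.Basis (F ≃ₐ[E] F) P (P ⊗[E] F) := Algebra.TensorProduct.basis P b
    let q : G → Q := fun x => ((B.repr (α (r x)) (t x) : P) : Q)
    have : e q = a := by
      change T q = a
      funext x
      have hx := h1 (r x) (t x)
      rw [← hrt] at hx
      rw [h2, hx]
      conv_rhs => rw [← B.sum_repr (α (r x))]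
      simp only [T, LinearMap.coe_mk, AddHom.coe_mk, q, map_sum]
      refine Finset.sum_congr rfl fun σ _ => ?_
      rw [hr, hrr, ht, htr, mul_one]
      simp [B, TensorProduct.smul_tmul']
    rw [← this, LinearEquiv.symm_apply_apply]
    exact fun x => (B.repr (α (r x)) (t x)).2
  · obtain ⟨q, rfl⟩ := e.surjective a
    rw [LinearEquiv.symm_apply_apply] at ha
    refine mem_induced.2 ⟨fun x => ∑ σ, (⟨_, ha (r x * (g σ)⁻¹)⟩ : P) ⊗ₜ[E] (t x (b σ)), fun x τ => ?_, fun x => ?_⟩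
    · simp [map_sum, hr, ht]
    · change T q x = _
      simp [T, map_sum]

end Induced

section Main

open scoped TensorProduct

variable {E Q : Type*} [Field E] [Field Q] [Algebra E Q] {G : Type*}

lemma mulVec_mem_iff [Fintype G] [DecidableEq G] (P : Subalgebra E Q)
    (M : (Matrix G G Q)ˣ)
    (hM : ∀ x y, M.1 x y ∈ P ∧ M.2 x y ∈ P) (v : G → Q) :
    (∀ x, M.1.mulVec v x ∈ P) ↔ ∀ x, v x ∈ P := by
  have key : ∀ (N : Matrix G G Q), (∀ x y, N x y ∈ P) → ∀ w : G → Q, (∀ x, w x ∈ P) →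
      ∀ x, N.mulVec w x ∈ P := fun N hN w hw x =>
    Subalgebra.sum_mem _ fun y _ => Subalgebra.mul_mem _ (hN x y) (hw y)
  refine ⟨fun h x => ?_, key _ (fun x y => (hM x y).1) v⟩
  have := key _ (fun x y => (hM x y).2) _ h x
  rwa [Matrix.mulVec_mulVec, M.inv_val, Matrix.one_mulVec] at this

lemma exists_common_coordinates [Fintype G] [DecidableEq G] {ι : Type*} [DecidableEq ι]
    (P₀ : Subalgebra E Q) (P : ι → Subalgebra E Q) (N : ι → Set (G → Q))
    (hN : ∀ i, ∃ e : (G → Q) ≃ₗ[Q] (G → Q), ∀ a, a ∈ N i ↔ ∀ x, e a x ∈ P i)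
    (hfac : ∀ i, ∀ B : (Matrix G G Q)ˣ, ∃ M M' : (Matrix G G Q)ˣ, B = M * M' ∧
      (∀ x y, M.1 x y ∈ P i ∧ M.2 x y ∈ P i) ∧ (∀ x y, M'.1 x y ∈ P₀ ∧ M'.2 x y ∈ P₀) ∧
      ∀ j, j ≠ i → ∀ x y, M'.1 x y ∈ P j ∧ M'.2 x y ∈ P j) (s : Finset ι) :
    ∃ u : (G → Q) ≃ₗ[Q] (G → Q), (∀ a : G → Q, (∀ x, a x ∈ P₀) ↔ ∀ x, u a x ∈ P₀) ∧
      ∀ i ∈ s, ∀ a, a ∈ N i ↔ ∀ x, u a x ∈ P i := by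
  induction s using Finset.induction_on with
  | empty => exact ⟨LinearEquiv.refl _ _, fun a => Iff.rfl, by simp⟩
  | insert i s his ih =>
    obtain ⟨u, hu₀, hu⟩ := ih
    obtain ⟨v, hv⟩ := hN i
    let B : (Matrix G G Q)ˣ :=
      { val := LinearMap.toMatrix' (u.symm.trans v).toLinearMap
        inv := LinearMap.toMatrix' (v.symm.trans u).toLinearMap
        val_inv := by rw [← LinearMap.toMatrix'_comp]; simp [← LinearEquiv.comp_coe]; 
                      rw [← LinearMap.toMatrix'_id]; congr 1; ext; simp
        inv_val := by rw [← LinearMap.toMatrix'_comp]; simp [← LinearEquiv.comp_coe]; 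
                      rw [← LinearMap.toMatrix'_id]; congr 1; ext; simp }
    obtain ⟨M, M', hB, hM, hM'₀, hM'⟩ := hfac i B
    let w : (G → Q) ≃ₗ[Q] (G → Q) := u.trans (Matrix.toLin'OfInv M'.val_inv M'.inv_val).symm
    have hw : ∀ a, w a = M'.1.mulVec (u a) := fun a => by
      simp [w, Matrix.toLin'OfInv]
    have hvw : ∀ a, v a = M.1.mulVec (w a) := fun a => by
      rw [hw, Matrix.mulVec_mulVec, ← Units.val_mul, ← hB]
      change v a = (LinearMap.toMatrix' (u.symm.trans v).toLinearMap).mulVec (u a)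
      rw [LinearMap.toMatrix'_mulVec]; simp
    refine ⟨w, fun a => ?_, fun j hj a => ?_⟩
    · simp only [hw]
      rw [mulVec_mem_iff _ _ hM'₀]; exact hu₀ a
    · rcases Finset.mem_insert.1 hj with rfl | hj
      · rw [hv, hvw, mulVec_mem_iff _ _ hM]
      · rw [hu j hj, hw, mulVec_mem_iff _ _ (hM' j (fun h => his (h ▸ hj)))]

variable [Group G]

/-- The patching theorem: cyclic extensions `F i` whose groups generate `G` can be glued to a
Galois extension with group `G`. -/
theorem exists_galois [Finite G] {ι : Type*} [Finite ι]
    (P₀ : Subalgebra E Q) (P : ι → Subalgebra E Q) (F : ι → IntermediateField E Q)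
    [∀ i, FiniteDimensional E (F i)] [∀ i, IsGalois E (F i)]
    (g : ∀ i, (F i ≃ₐ[E] F i) →* G) (hg : ∀ i, Function.Injective (g i))
    (hgen : ⨆ i, (g i).range = ⊤)
    (hd : ∀ i, Function.Injective
      (Algebra.TensorProduct.lift (P i).val (F i).val (fun _ _ => Commute.all _ _)))
    (hinf : ∀ q : Q, q ∈ P₀ → (∀ i, q ∈ P i) → q ∈ (algebraMap E Q).range)
    (hfac : ∀ (n : ℕ) (i : ι) (B : (Matrix (Fin n) (Fin n) Q)ˣ),
      ∃ M M' : (Matrix (Fin n) (Fin n) Q)ˣ, B = M * M' ∧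
      (∀ x y, M.1 x y ∈ P i ∧ M.2 x y ∈ P i) ∧ (∀ x y, M'.1 x y ∈ P₀ ∧ M'.2 x y ∈ P₀) ∧
      ∀ j, j ≠ i → ∀ x y, M'.1 x y ∈ P j ∧ M'.2 x y ∈ P j) :
    ∃ L : IntermediateField E Q, FiniteDimensional E L ∧ IsGalois E L ∧
      Nonempty ((L ≃ₐ[E] L) ≃* G) := by
  classical
  have := Fintype.ofFinite G
  have := Fintype.ofFinite ι
  obtain ⟨u, hu₀, hu⟩ := exists_common_coordinates (G := G) P₀ P
    (fun i => (induced (P i) (F i) (g i) : Set (G → Q)))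
    (fun i => exists_induced_coordinates (hg i)) (fun i B => by
      let ε := Fintype.equivFin G
      let φ := (Matrix.reindexAlgEquiv Q Q ε).toRingEquiv.toRingHom.toMonoidHom
      let ψ := (Matrix.reindexAlgEquiv Q Q ε.symm).toRingEquiv.toRingHom.toMonoidHom
      obtain ⟨M, M', hB, h1, h2, h3⟩ := hfac _ i (Units.map φ B)
      refine ⟨Units.map ψ M, Units.map ψ M', ?_, fun x y => h1 _ _, fun x y => h2 _ _,
        fun j hj x y => h3 j hj _ _⟩
      rw [← map_mul, ← hB]
      ext x y
      simp [φ, ψ]) Finset.univ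
  let A : Subalgebra E (G → Q) := (Subalgebra.pi Set.univ fun _ => P₀) ⊓
    ⨅ i, induced (P i) (F i) (g i)
  have hA : ∀ a : G → Q, a ∈ A ↔ (∀ x, a x ∈ P₀) ∧ ∀ i, a ∈ induced (P i) (F i) (g i) := by
    intro a
    simp [A, Subalgebra.mem_pi, Algebra.mem_iInf]
  have hAu : ∀ a : G → Q, a ∈ A ↔ ∀ x, u a x ∈ (algebraMap E Q).range := by
    intro a
    rw [hA, hu₀]
    constructor
    · rintro ⟨h0, h1⟩ x
      exact hinf _ (h0 x) fun i => (hu i (Finset.mem_univ i) a).1 (h1 i) x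
    · intro h
      refine ⟨fun x => ?_, fun i => (hu i (Finset.mem_univ i) a).2 fun x => ?_⟩
      · obtain ⟨e, he⟩ := h x
        rw [← he]; exact P₀.algebraMap_mem e
      · obtain ⟨e, he⟩ := h x
        rw [← he]; exact (P i).algebraMap_mem e
  have hzero : ∀ a ∈ A, ∀ x, a x = 0 → a = 0 := by
    intro a ha x hx
    have key : ∀ h : G, ∀ y, a y = 0 → a (y * h) = 0 := by
      intro h
      have hh : h ∈ ⨆ i, (g i).range := by rw [hgen]; trivial
      refine Subgroup.iSup_induction (fun i => (g i).range)
        (C := fun h => ∀ y, a y = 0 → a (y * h) = 0) hh ?_ ?_ ?_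
      · rintro i h ⟨τ, rfl⟩ y hy
        exact induced_apply_eq_zero (hd i) (((hA a).1 ha).2 i) hy τ
      · simp
      · intro h h' ih ih' y hy
        rw [← mul_assoc]; exact ih' _ (ih _ hy)
    funext y
    have := key (x⁻¹ * y) x hx
    simpa using this
  have htrans : ∀ a ∈ A, ∀ h : G, (fun x => a (h * x)) ∈ A := by
    intro a ha h
    rw [hA] at ha ⊢
    exact ⟨fun x => ha.1 _, fun i => translate_mem_induced (ha.2 i) h⟩
  -- `A` has dimension `|G|`
  let c : (G → E) →ₗ[E] A :=
    { toFun := fun v => ⟨u.symm fun x => algebraMap E Q (v x), by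
        rw [hAu]; intro x; simp⟩
      map_add' := fun v w => by
        ext1; simp only [Subalgebra.coe_add, ← map_add]; congr 1; funext x; simp
      map_smul' := fun e v => by
        ext1
        simp only [RingHom.id_apply, Subalgebra.coe_smul]
        rw [← algebraMap_smul Q e (u.symm _), ← map_smul]; congr 1; funext x; simp }
  have hc : Function.Bijective c := by
    constructor
    · intro v w hvw
      have := u.symm.injective (congrArg Subtype.val hvw)
      funext x
      exact (algebraMap E Q).injective (congrFun this x)
    · rintro ⟨a, ha⟩
      choose v hv using (hAu a).1 ha
      refine ⟨v, Subtype.ext ?_⟩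
      change u.symm _ = a
      rw [LinearEquiv.symm_apply_eq]; funext x; exact hv x
  let c' := LinearEquiv.ofBijective c hc
  have hfin : Module.finrank E A = Fintype.card G := by
    rw [← c'.finrank_eq]; simp
  have hfd : FiniteDimensional E A := c'.finiteDimensional
  let ev : A →ₐ[E] Q := (Pi.evalAlgHom E (fun _ : G => Q) 1).comp A.val
  have hev : Function.Injective ev := by
    rw [injective_iff_map_eq_zero]
    rintro ⟨a, ha⟩ h
    exact Subtype.ext (hzero a ha 1 h)
  let eA : A ≃ₐ[E] ev.range := AlgEquiv.ofInjective ev hev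
  have hfd' : FiniteDimensional E ev.range := eA.toLinearEquiv.finiteDimensional
  let L : IntermediateField E Q := ev.range.toIntermediateField fun x hx => by
    have hx' : IsAlgebraic E x := by
      have := Algebra.IsAlgebraic.isAlgebraic (R := E) (⟨x, hx⟩ : ev.range)
      exact this.algebraMap (A := Q)
    exact ev.range.inv_mem_of_algebraic (x := ⟨x, hx⟩) hx'
  let eL : A ≃ₐ[E] L := eA
  have hfdL : FiniteDimensional E L := eL.toLinearEquiv.finiteDimensional
  let tr : G → (A ≃ₐ[E] A) := fun h =>
    { toFun := fun a => ⟨fun x => a.1 (h⁻¹ * x), htrans _ a.2 _⟩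
      invFun := fun a => ⟨fun x => a.1 (h * x), htrans _ a.2 _⟩
      left_inv := fun a => by ext; simp
      right_inv := fun a => by ext; simp
      map_mul' := fun a b => rfl
      map_add' := fun a b => rfl
      commutes' := fun e => rfl }
  let ρ : G →* (L ≃ₐ[E] L) :=
    { toFun := fun h => (eL.symm.trans (tr h)).trans eL
      map_one' := by ext; simp [tr]
      map_mul' := fun h h' => by
        ext x
        simp only [AlgEquiv.mul_apply, AlgEquiv.trans_apply, AlgEquiv.symm_apply_apply]
        congr 2
        ext y
        change (eL.symm x).1 ((h * h')⁻¹ * y) = (eL.symm x).1 (h'⁻¹ * (h⁻¹ * y))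
        rw [mul_inv_rev, mul_assoc] }
  have hρ : Function.Injective ρ := by
    rw [injective_iff_map_eq_one]
    intro h hh
    have h1 : ∀ a : A, ∀ x, a.1 (h⁻¹ * x) = a.1 x := by
      intro a x
      have := DFunLike.congr_fun hh (eL a)
      have h2 : tr h a = a := by simpa [ρ] using this
      exact congrFun (congrArg Subtype.val h2) x
    let D : (G → Q) →ₗ[Q] Q :=
      (LinearMap.proj h⁻¹ : (G → Q) →ₗ[Q] Q) - (LinearMap.proj 1 : (G → Q) →ₗ[Q] Q)
    have hD : D ∘ₗ u.symm.toLinearMap = 0 := by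
      ext x
      have := h1 (c (Pi.single x 1)) 1
      have h3 : (fun y => algebraMap E Q ((Pi.single x 1 : G → E) y)) = Pi.single x 1 := by
        funext y; by_cases hxy : y = x
        · subst hxy; simp
        · simp [hxy]
      simp only [c, LinearMap.coe_mk, AddHom.coe_mk, h3, mul_one] at this
      simp [D, this]
    have h4 := LinearMap.congr_fun hD (u (Pi.single 1 1))
    simp only [LinearMap.comp_apply, LinearEquiv.coe_coe, LinearEquiv.symm_apply_apply, D,
      LinearMap.sub_apply, LinearMap.proj_apply, Pi.single_eq_same, LinearMap.zero_apply] at h4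
    by_contra hne
    rw [Pi.single_eq_of_ne (by simpa using hne)] at h4
    simp at h4
  have hle : Nat.card G ≤ Nat.card (L ≃ₐ[E] L) := Nat.card_le_card_of_injective ρ hρ
  have hfinL : Module.finrank E L = Nat.card G := by
    rw [← eL.toLinearEquiv.finrank_eq, hfin, Nat.card_eq_fintype_card]
  have hcard : Nat.card (L ≃ₐ[E] L) = Module.finrank E L := by
    refine le_antisymm ?_ (hfinL ▸ hle)
    rw [Nat.card_eq_fintype_card]
    exact AlgEquiv.card_le
  refine ⟨L, hfdL, IsGalois.of_card_aut_eq_finrank E L hcard, ⟨(MulEquiv.ofBijective ρ ?_).symm⟩⟩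
  rw [Nat.bijective_iff_injective_and_card]
  exact ⟨hρ, by rw [hcard, hfinL]⟩

end Main

section Laurent

open Polynomial

/-- The ring homomorphism between Laurent series rings applying `f` to all coefficients. -/
noncomputable def laurentMap {R S : Type*} [CommRing R] [CommRing S] (f : R →+* S) :
    LaurentSeries R →+* LaurentSeries S where
  toFun q := q.map f
  map_one' := HahnSeries.map_one f.toMonoidWithZeroHom
  map_mul' x y := HahnSeries.map_mul f.toNonUnitalRingHom
  map_zero' := by ext; simp
  map_add' x y := by ext; simp

@[simp] lemma laurentMap_coeff {R S : Type*} [CommRing R] [CommRing S] (f : R →+* S)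
    (q : LaurentSeries R) (n : ℤ) : (laurentMap f q).coeff n = f (q.coeff n) := rfl

lemma laurentMap_C {R S : Type*} [CommRing R] [CommRing S] (f : R →+* S) (r : R) :
    laurentMap f (HahnSeries.C r) = HahnSeries.C (f r) := HahnSeries.map_C r f

lemma laurentMap_single {R S : Type*} [CommRing R] [CommRing S] (f : R →+* S) (n : ℤ) (r : R) :
    laurentMap f (HahnSeries.single n r) = HahnSeries.single n (f r) :=
  HahnSeries.map_single f.toMonoidWithZeroHom.toZeroHom

variable {L : Type*} [Field L]

/-- The Laurent series with all coefficients in the subring `O`. -/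
def coeffIn (O : Subring L) : Subring (LaurentSeries L) where
  carrier := {q | ∀ n, q.coeff n ∈ O}
  mul_mem' := fun {a b} ha hb n => by
    rw [HahnSeries.coeff_mul]
    exact O.sum_mem fun i _ => O.mul_mem (ha _) (hb _)
  one_mem' := fun n => by
    rw [HahnSeries.coeff_one]; split_ifs
    exacts [O.one_mem, O.zero_mem]
  add_mem' := fun {a b} ha hb n => by
    rw [HahnSeries.coeff_add]; exact O.add_mem (ha n) (hb n)
  zero_mem' := fun n => by simp
  neg_mem' := fun {a} ha n => by
    rw [HahnSeries.coeff_neg]; exact O.neg_mem (ha n)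

lemma coeffIn_mono {O O' : Subring L} (h : O ≤ O') : coeffIn O ≤ coeffIn O' :=
  fun _ hq n => h (hq n)

lemma single_mem_coeffIn {O : Subring L} {f : L} (hf : f ∈ O) (n : ℤ) :
    HahnSeries.single n f ∈ coeffIn O := fun m => by
  rw [HahnSeries.coeff_single]; split_ifs
  exacts [hf, O.zero_mem]

/-- Regard a Laurent series with coefficients in `O` as a Laurent series over `O`. -/
def coeffInLift {O : Subring L} (q : LaurentSeries L) (hq : q ∈ coeffIn O) : LaurentSeries O where
  coeff n := ⟨q.coeff n, hq n⟩
  isPWO_support' := q.isPWO_support.mono fun n hn => by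
    intro h; exact hn (Subtype.ext h)

lemma laurentMap_coeffInLift {O : Subring L} (q : LaurentSeries L) (hq : q ∈ coeffIn O) :
    laurentMap O.subtype (coeffInLift q hq) = q := by
  ext n; rfl

lemma laurentMap_subtype_mem {O : Subring L} (q : LaurentSeries O) :
    laurentMap O.subtype q ∈ coeffIn O := fun n => (q.coeff n).2

lemma laurentMap_injective {R S : Type*} [CommRing R] [CommRing S] {f : R →+* S}
    (hf : Function.Injective f) : Function.Injective (laurentMap f) := fun a b h => by
  ext n; exact hf (by simpa using congrArg (fun q => q.coeff n) h)

lemma inv_mem_coeffIn {O : Subring L} {q : LaurentSeries L} (hq : q ∈ coeffIn O)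
    (h0 : q ≠ 0) (hl : q.leadingCoeff⁻¹ ∈ O) : q⁻¹ ∈ coeffIn O := by
  set q' := coeffInLift q hq with hq'
  have hqq : laurentMap O.subtype q' = q := laurentMap_coeffInLift q hq
  have h0' : q' ≠ 0 := by rintro h; apply h0; rw [← hqq, h, map_zero]
  have hne : q.coeff q'.order ≠ 0 := by
    rw [← hqq, laurentMap_coeff]
    intro h
    exact HahnSeries.leadingCoeff_ne_zero.2 h0' (by
      rw [HahnSeries.leadingCoeff_eq]; exact Subtype.ext h)
  have hord : q'.order = q.order := by
    apply le_antisymm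
    · by_contra hlt
      push Not at hlt
      have := HahnSeries.coeff_eq_zero_of_lt_order hlt
      exact HahnSeries.leadingCoeff_ne_zero.2 h0 (by
        rw [HahnSeries.leadingCoeff_eq, ← hqq, laurentMap_coeff, hqq, this]; rfl)
    · exact HahnSeries.order_le_of_coeff_ne_zero hne
  have hlc : (q'.leadingCoeff : L) = q.leadingCoeff := by
    rw [HahnSeries.leadingCoeff_eq, HahnSeries.leadingCoeff_eq, hord]; rfl
  have hu : IsUnit q' := by
    apply HahnSeries.isUnit_of_isUnit_leadingCoeff_AddUnitOrder
    · refine IsUnit.of_mul_eq_one (⟨_, hl⟩ : O) (Subtype.ext ?_)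
      simp only [Subring.coe_mul, hlc, Subring.coe_one]
      exact mul_inv_cancel₀ (HahnSeries.leadingCoeff_ne_zero.2 h0)
    · exact AddGroup.isAddUnit _
  obtain ⟨v, hv⟩ := hu.exists_right_inv
  have : q⁻¹ = laurentMap O.subtype v := by
    apply inv_eq_of_mul_eq_one_right
    rw [← hqq, ← map_mul, hv, map_one]
  rw [this]; exact laurentMap_subtype_mem v

end Laurent

section RatFunc

open Polynomial

variable {C : Type*} [Field C]

/-- The ring of rational functions which are regular at `a`. -/
def regAt (a : C) : Subring (RatFunc C) where
  carrier := {f | f.denom.eval a ≠ 0}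
  mul_mem' := fun {f g} hf hg h => by
    have := eval_dvd (x := a) (RatFunc.denom_mul_dvd f g)
    rw [h, zero_dvd_iff, eval_mul] at this
    exact mul_ne_zero hf hg this
  one_mem' := by simp
  add_mem' := fun {f g} hf hg h => by
    have := eval_dvd (x := a) (RatFunc.denom_add_dvd f g)
    rw [h, zero_dvd_iff, eval_mul] at this
    exact mul_ne_zero hf hg this
  zero_mem' := by simp
  neg_mem' := fun {f} hf h => by
    have h1 := RatFunc.denom_mul_dvd (-1) f
    have h2 : (-1 : RatFunc C).denom = 1 := by
      have := RatFunc.denom_algebraMap (K := C) (-1)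
      simpa using this
    rw [neg_one_mul, h2, one_mul] at h1
    have := eval_dvd (x := a) h1
    rw [h, zero_dvd_iff] at this
    exact hf this

lemma mem_regAt {a : C} {f : RatFunc C} : f ∈ regAt a ↔ f.denom.eval a ≠ 0 := Iff.rfl

lemma mem_regAt_of_mul_eq {a : C} {f : RatFunc C} {p q : C[X]} (hq : q.eval a ≠ 0)
    (h : f * algebraMap C[X] (RatFunc C) q = algebraMap C[X] (RatFunc C) p) : f ∈ regAt a := by
  have hq0 : q ≠ 0 := by rintro rfl; simp at hq
  have hq0' : algebraMap C[X] (RatFunc C) q ≠ 0 := by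
    simpa using hq0
  have : f.denom ∣ q := (RatFunc.denom_dvd hq0).2 ⟨p, by rw [← h]; field_simp⟩
  intro h0
  have := eval_dvd (x := a) this
  rw [h0, zero_dvd_iff] at this
  exact hq this

lemma algebraMap_mem_regAt (a : C) (p : C[X]) : algebraMap C[X] (RatFunc C) p ∈ regAt a :=
  mem_regAt_of_mul_eq (q := 1) (p := p) (by simp) (by simp)

lemma C_mem_regAt (a b : C) : RatFunc.C b ∈ regAt a := by
  rw [← RatFunc.algebraMap_C]; exact algebraMap_mem_regAt a _

/-- Evaluation at `a` of rational functions regular at `a`. -/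
noncomputable def evalAt (a : C) : regAt a →+* C where
  toFun f := RatFunc.eval (RingHom.id C) a f
  map_one' := by simp
  map_mul' f g := RatFunc.eval_mul (RingHom.id C) a f.2 g.2
  map_zero' := by simp
  map_add' f g := RatFunc.eval_add (RingHom.id C) a f.2 g.2

lemma evalAt_algebraMap (a : C) (p : C[X]) (h : algebraMap C[X] (RatFunc C) p ∈ regAt a) :
    evalAt a ⟨_, h⟩ = p.eval a := by
  change RatFunc.eval (RingHom.id C) a (algebraMap C[X] (RatFunc C) p) = _
  rw [RatFunc.eval_algebraMap]; rfl

lemma num_div (f : RatFunc C) : f * algebraMap C[X] (RatFunc C) f.denom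
    = algebraMap C[X] (RatFunc C) f.num := by
  have hq0' : algebraMap C[X] (RatFunc C) f.denom ≠ 0 := by
    simpa using f.denom_ne_zero
  conv_lhs => rw [← RatFunc.num_div_denom f]
  field_simp
  simp

/-- The function `x - a`. -/
noncomputable def lin (a : C) : RatFunc C := algebraMap C[X] (RatFunc C) (X - Polynomial.C a)

lemma lin_ne_zero (a : C) : lin a ≠ 0 := by
  exact (map_ne_zero_iff _ (RatFunc.algebraMap_injective C)).2 (X_sub_C_ne_zero a)

lemma lin_mem_regAt (a b : C) : lin a ∈ regAt b := algebraMap_mem_regAt b _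

lemma inv_lin_mem_regAt {a b : C} (h : b ≠ a) : (lin a)⁻¹ ∈ regAt b :=
  mem_regAt_of_mul_eq (q := X - Polynomial.C a) (p := 1) (by simpa [sub_eq_zero] using h)
    (by simpa [lin] using inv_mul_cancel₀ (lin_ne_zero a))

lemma exists_eq_mul_lin_of_evalAt {a : C} (f : regAt a) (hf : evalAt a f = 0) :
    ∃ g ∈ regAt a, (f : RatFunc C) = lin a * g := by
  have h0 : f.1.num.eval a = 0 := by
    have : f.1.num.eval a / f.1.denom.eval a = 0 := hf
    rwa [div_eq_zero_iff, or_iff_left f.2] at this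
  obtain ⟨p, hp⟩ := dvd_iff_isRoot.2 h0
  refine ⟨(lin a)⁻¹ * f, ?_, by rw [mul_inv_cancel_left₀ (lin_ne_zero a)]⟩
  refine mem_regAt_of_mul_eq (q := f.1.denom) (p := p) f.2 ?_
  rw [mul_assoc, num_div, hp, map_mul]
  exact inv_mul_cancel_left₀ (lin_ne_zero a) _

/-- The polynomials in `1 / (x - c)`. -/
noncomputable def polar (c : C) : Subring (RatFunc C) :=
  ((aeval (lin c)⁻¹ : C[X] →ₐ[C] RatFunc C) : C[X] →+* RatFunc C).range

lemma polar_le {c : C} {O : Subring (RatFunc C)} (hC : ∀ b, RatFunc.C b ∈ O)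
    (h : (lin c)⁻¹ ∈ O) : polar c ≤ O := by
  rintro _ ⟨p, rfl⟩
  change aeval (lin c)⁻¹ p ∈ O
  rw [aeval_eq_sum_range]
  refine O.sum_mem fun i _ => ?_
  rw [Algebra.smul_def]
  exact O.mul_mem (hC _) (O.pow_mem h _)

lemma polar_le_regAt {a c : C} (h : a ≠ c) : polar c ≤ regAt a :=
  polar_le (C_mem_regAt a) (inv_lin_mem_regAt h)

lemma C_mul_inv_lin_pow_mem_polar (c b : C) (n : ℕ) : RatFunc.C b * (lin c)⁻¹ ^ n ∈ polar c :=
  ⟨Polynomial.C b * X ^ n, by simp⟩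

lemma exists_polar_part_of_pow (c : C) (m : ℕ) : ∀ f : RatFunc C, lin c ^ m * f ∈ regAt c →
    ∃ h ∈ polar c, f - h ∈ regAt c := by
  induction m with
  | zero => intro f hf; exact ⟨0, Subring.zero_mem _, by simpa using hf⟩
  | succ m ih =>
    intro f hf
    set v := evalAt c ⟨_, hf⟩ with hv
    obtain ⟨g, hg, hfg⟩ := exists_eq_mul_lin_of_evalAt
      (⟨_, hf⟩ - ⟨RatFunc.C v, C_mem_regAt c v⟩ : regAt c) (by
        rw [map_sub, ← hv, sub_eq_zero]
        have := evalAt_algebraMap c (Polynomial.C v) (algebraMap_mem_regAt c _)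
        simp only [RatFunc.algebraMap_C, eval_C] at this
        exact this.symm)
    obtain ⟨h, hh, hfh⟩ := ih (f - RatFunc.C v * (lin c)⁻¹ ^ (m + 1)) (by
      have : lin c ^ m * (f - RatFunc.C v * (lin c)⁻¹ ^ (m + 1)) = g := by
        apply mul_left_cancel₀ (lin_ne_zero c)
        rw [← hfg]
        change _ = lin c ^ (m + 1) * f - RatFunc.C v
        rw [← mul_assoc, ← pow_succ', mul_sub, inv_pow, mul_left_comm,
          mul_inv_cancel₀ (pow_ne_zero _ (lin_ne_zero c)), mul_one]
      rwa [this])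
    refine ⟨h + RatFunc.C v * (lin c)⁻¹ ^ (m + 1), Subring.add_mem _ hh
      (C_mul_inv_lin_pow_mem_polar c v _), ?_⟩
    rw [add_comm, ← sub_sub]; exact hfh

lemma exists_polar_part (c : C) (f : RatFunc C) : ∃ h ∈ polar c, f - h ∈ regAt c := by
  obtain ⟨q, hq, hq'⟩ := exists_eq_pow_rootMultiplicity_mul_and_not_dvd f.denom f.denom_ne_zero c
  refine exists_polar_part_of_pow c (rootMultiplicity c f.denom) f ?_
  refine mem_regAt_of_mul_eq (q := q) (p := f.num) (fun h => hq' (dvd_iff_isRoot.2 h)) ?_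
  rw [← num_div, mul_comm (lin c ^ _), mul_assoc]
  conv_rhs => rw [hq]
  simp [lin]

/-- The rational functions of nonpositive degree. -/
def regInfty (C : Type*) [Field C] : Subring (RatFunc C) where
  carrier := {f | f.intDegree ≤ 0}
  mul_mem' := fun {f g} hf hg => by
    rcases eq_or_ne f 0 with rfl | hf0
    · simp
    rcases eq_or_ne g 0 with rfl | hg0
    · simp
    simp only [Set.mem_ofPred_eq, RatFunc.intDegree_mul hf0 hg0] at *
    exact add_nonpos hf hg
  one_mem' := by simp
  add_mem' := fun {f g} hf hg => by
    rcases eq_or_ne g 0 with rfl | hg0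
    · simpa using hf
    rcases eq_or_ne (f + g) 0 with h | h
    · simp [h]
    exact (RatFunc.intDegree_add_le hg0 h).trans (max_le hf hg)
  zero_mem' := by simp
  neg_mem' := fun {f} hf => by simpa using hf

lemma mem_regInfty {f : RatFunc C} : f ∈ regInfty C ↔ f.intDegree ≤ 0 := Iff.rfl

lemma polar_le_regInfty (c : C) : polar c ≤ regInfty C :=
  polar_le (fun b => by simp [mem_regInfty]) (by
    rw [mem_regInfty, RatFunc.intDegree_inv, lin, RatFunc.intDegree_polynomial]
    simp)

lemma finite_not_mem_regAt (f : RatFunc C) : {a | f ∉ regAt a}.Finite := by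
  classical
  refine (f.denom.roots.toFinset.finite_toSet).subset fun a ha => ?_
  simpa [mem_regAt, f.denom_ne_zero] using ha

lemma mem_range_of_forall_regAt [IsAlgClosed C] {f : RatFunc C} (h : ∀ a, f ∈ regAt a) :
    ∃ p : C[X], algebraMap C[X] (RatFunc C) p = f := by
  have hd : f.denom.degree = 0 := by
    by_contra hne
    obtain ⟨a, ha⟩ := IsAlgClosed.exists_root f.denom hne
    exact h a ha
  have h1 : f.denom = 1 := f.monic_denom.natDegree_eq_zero.1 (natDegree_eq_of_degree_eq_some hd)
  exact ⟨f.num, by rw [← num_div, h1]; simp⟩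

end RatFunc

section Ambient

open Polynomial

variable (C : Type*) [Field C]

/-- The embedding of `C((t))[x]` into `C(x)((t))`. -/
noncomputable def polyEmb : (LaurentSeries C)[X] →+* LaurentSeries (RatFunc C) :=
  eval₂RingHom (laurentMap (RatFunc.C : C →+* RatFunc C)) (HahnSeries.C RatFunc.X)

variable {C}

lemma polyEmb_coeff (p : (LaurentSeries C)[X]) (n : ℤ) : ∃ r : C[X],
    (polyEmb C p).coeff n = algebraMap C[X] (RatFunc C) r ∧
      ∀ j, r.coeff j = (p.coeff j).coeff n := by
  induction p using Polynomial.induction_on' with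
  | add p q hp hq =>
    obtain ⟨r, h1, h2⟩ := hp
    obtain ⟨s, h3, h4⟩ := hq
    exact ⟨r + s, by rw [map_add, HahnSeries.coeff_add, h1, h3, map_add], fun j => by
      simp [h2, h4]⟩
  | monomial i k =>
    refine ⟨monomial i (k.coeff n), ?_, fun j => ?_⟩
    · rw [polyEmb, coe_eval₂RingHom, eval₂_monomial, ← map_pow, mul_comm, HahnSeries.C_mul_eq_smul,
        HahnSeries.coeff_smul, laurentMap_coeff, ← C_mul_X_pow_eq_monomial]
      rw [smul_eq_mul, map_mul, map_pow, RatFunc.algebraMap_C, RatFunc.algebraMap_X, mul_comm]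
    · rw [coeff_monomial, coeff_monomial]; split_ifs <;> simp

lemma polyEmb_injective : Function.Injective (polyEmb C) := by
  rw [injective_iff_map_eq_zero]
  intro p hp
  ext j n
  obtain ⟨r, h1, h2⟩ := polyEmb_coeff p n
  rw [hp, HahnSeries.coeff_zero] at h1
  have : r = 0 := RatFunc.algebraMap_injective C (by rw [← h1, map_zero])
  rw [← h2, this]; simp

lemma mem_range_polyEmb {q : LaurentSeries (RatFunc C)} (m : ℕ)
    (h : ∀ n, ∃ r : C[X], q.coeff n = algebraMap C[X] (RatFunc C) r ∧ r.natDegree ≤ m) :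
    q ∈ (polyEmb C).range := by
  choose r hr hm using h
  let k : ℕ → LaurentSeries C := fun j =>
    { coeff := fun n => (r n).coeff j
      isPWO_support' := q.isPWO_support.mono fun n hn hq => hn (by
        have : r n = 0 := RatFunc.algebraMap_injective C (by rw [← hr, hq, map_zero])
        simp [this]) }
  refine ⟨∑ j ∈ Finset.range (m + 1), monomial j (k j), ?_⟩
  ext n
  obtain ⟨s, h1, h2⟩ := polyEmb_coeff (∑ j ∈ Finset.range (m + 1), monomial j (k j)) n
  rw [h1, hr]
  congr 1
  ext j
  rw [h2, finsetSum_coeff]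
  simp only [coeff_monomial]
  rw [Finset.sum_ite_eq']
  split_ifs with hj
  · rfl
  · rw [coeff_eq_zero_of_natDegree_lt]
    · simp
    · have := hm n
      simp at hj; omega

lemma polyEmb_mem_coeffIn_regAt (a : C) (p : (LaurentSeries C)[X]) :
    polyEmb C p ∈ coeffIn (regAt a) := fun n => by
  obtain ⟨r, h1, -⟩ := polyEmb_coeff p n
  rw [h1]; exact algebraMap_mem_regAt a r

variable (C) in
/-- The Laurent series in `C(x)((t))` all of whose coefficients are regular at `a`, for almost
all `a`. -/
def good : Subfield (LaurentSeries (RatFunc C)) where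
  carrier := {q | {a : C | q ∉ coeffIn (regAt a)}.Finite}
  mul_mem' := fun {f g} hf hg => (hf.union hg).subset fun a ha => by
    by_contra h
    simp only [Set.mem_union, Set.mem_ofPred_eq, not_or, not_not] at h
    exact ha (Subring.mul_mem _ h.1 h.2)
  one_mem' := by simp
  add_mem' := fun {f g} hf hg => (hf.union hg).subset fun a ha => by
    by_contra h
    simp only [Set.mem_union, Set.mem_ofPred_eq, not_or, not_not] at h
    exact ha (Subring.add_mem _ h.1 h.2)
  zero_mem' := by simp
  neg_mem' := fun {f} hf => hf.subset fun a ha h => ha (Subring.neg_mem _ h)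
  inv_mem' := fun f hf => by
    rcases eq_or_ne f 0 with rfl | h0
    · simp
    refine (hf.union (finite_not_mem_regAt f.leadingCoeff⁻¹)).subset fun a ha => ?_
    by_contra h
    simp only [Set.mem_union, Set.mem_ofPred_eq, not_or, not_not] at h
    exact ha (inv_mem_coeffIn h.1 h0 h.2)

lemma mem_good {q : LaurentSeries (RatFunc C)} :
    q ∈ good C ↔ {a : C | q ∉ coeffIn (regAt a)}.Finite := Iff.rfl

lemma polyEmb_mem_good (p : (LaurentSeries C)[X]) : polyEmb C p ∈ good C := by
  simp [mem_good, polyEmb_mem_coeffIn_regAt]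

variable (C) in
/-- The embedding of `C((t))[x]` into the field `good C`. -/
noncomputable def polyEmbGood : (LaurentSeries C)[X] →+* good C :=
  (polyEmb C).codRestrict (good C).toSubring polyEmb_mem_good

lemma coe_polyEmbGood (p : (LaurentSeries C)[X]) :
    (polyEmbGood C p : LaurentSeries (RatFunc C)) = polyEmb C p := rfl

lemma polyEmbGood_injective : Function.Injective (polyEmbGood C) := fun _ _ h =>
  polyEmb_injective (congrArg Subtype.val h)

noncomputable instance : Algebra (RatFunc (LaurentSeries C)) (good C) :=
  (IsFractionRing.lift (K := RatFunc (LaurentSeries C)) (polyEmbGood_injective (C := C))).toAlgebra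

lemma algebraMap_good (p : (LaurentSeries C)[X]) :
    algebraMap (RatFunc (LaurentSeries C)) (good C) (algebraMap _ _ p) = polyEmbGood C p :=
  IsFractionRing.lift_algebraMap _ _

lemma polyEmbGood_ne_zero {p : (LaurentSeries C)[X]} (hp : p ≠ 0) : polyEmbGood C p ≠ 0 :=
  (map_ne_zero_iff _ polyEmbGood_injective).2 hp

/-- The fractions with numerators in `R` and denominators in `C((t))[x]`. -/
noncomputable def fracs (R : Subring (LaurentSeries (RatFunc C))) (hR : ∀ p, polyEmb C p ∈ R) :
    Subalgebra (RatFunc (LaurentSeries C)) (good C) where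
  carrier := {q | ∃ p : (LaurentSeries C)[X], p ≠ 0 ∧ polyEmb C p * q ∈ R}
  mul_mem' := by
    rintro q q' ⟨p, hp, h⟩ ⟨p', hp', h'⟩
    refine ⟨p * p', mul_ne_zero hp hp', ?_⟩
    rw [map_mul, Subfield.coe_mul, mul_mul_mul_comm]
    exact R.mul_mem h h'
  add_mem' := by
    rintro q q' ⟨p, hp, h⟩ ⟨p', hp', h'⟩
    refine ⟨p * p', mul_ne_zero hp hp', ?_⟩
    have : polyEmb C (p * p') * ((q + q' : good C) : LaurentSeries (RatFunc C))
      = polyEmb C p' * (polyEmb C p * q) + polyEmb C p * (polyEmb C p' * q') := by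
      rw [map_mul, Subfield.coe_add]; ring
    rw [this]
    exact R.add_mem (R.mul_mem (hR _) h) (R.mul_mem (hR _) h')
  algebraMap_mem' := fun e => by
    obtain ⟨a, b, hb, rfl⟩ := IsFractionRing.div_surjective (A := (LaurentSeries C)[X]) e
    have hb0 := nonZeroDivisors.ne_zero hb
    refine ⟨b, hb0, ?_⟩
    rw [map_div₀, algebraMap_good, algebraMap_good, ← coe_polyEmbGood, ← Subfield.coe_mul,
      mul_div_cancel₀ _ (polyEmbGood_ne_zero hb0)]
    exact hR _

lemma mem_fracs_of_mem {R : Subring (LaurentSeries (RatFunc C))} {hR : ∀ p, polyEmb C p ∈ R}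
    {q : good C} (h : (q : LaurentSeries (RatFunc C)) ∈ R) : q ∈ fracs R hR :=
  ⟨1, one_ne_zero, by simpa using h⟩

/-- The Laurent series whose coefficients are regular outside `T` and of bounded degree. -/
def farRing (T : Set C) : Subring (LaurentSeries (RatFunc C)) where
  carrier := {q | (∀ a ∉ T, q ∈ coeffIn (regAt a)) ∧
    ∃ m : ℕ, HahnSeries.C (RatFunc.X ^ m)⁻¹ * q ∈ coeffIn (regInfty C)}
  mul_mem' := by
    rintro f g ⟨h1, m, h2⟩ ⟨h3, n, h4⟩
    refine ⟨fun a ha => Subring.mul_mem _ (h1 a ha) (h3 a ha), m + n, ?_⟩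
    rw [pow_add, mul_inv, map_mul, mul_mul_mul_comm]
    exact Subring.mul_mem _ h2 h4
  one_mem' := ⟨fun a _ => Subring.one_mem _, 0, by simp⟩
  add_mem' := by
    rintro f g ⟨h1, m, h2⟩ ⟨h3, n, h4⟩
    refine ⟨fun a ha => Subring.add_mem _ (h1 a ha) (h3 a ha), m + n, ?_⟩
    have key : ∀ k : ℕ, HahnSeries.C (RatFunc.X ^ k)⁻¹ ∈ coeffIn (regInfty C) := fun k =>
      single_mem_coeffIn (by
        rw [mem_regInfty, RatFunc.intDegree_inv, ← RatFunc.algebraMap_X, ← map_pow,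
          RatFunc.intDegree_polynomial]; simp) 0
    have : HahnSeries.C (RatFunc.X ^ (m + n))⁻¹ * (f + g) =
        HahnSeries.C (RatFunc.X ^ n)⁻¹ * (HahnSeries.C (RatFunc.X ^ m)⁻¹ * f) +
        HahnSeries.C (RatFunc.X ^ m)⁻¹ * (HahnSeries.C (RatFunc.X ^ n)⁻¹ * g) := by
      rw [pow_add, mul_inv, map_mul]; ring
    rw [this]
    exact Subring.add_mem _ (Subring.mul_mem _ (key n) h2) (Subring.mul_mem _ (key m) h4)
  zero_mem' := ⟨fun a _ => Subring.zero_mem _, 0, by simp⟩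
  neg_mem' := by
    rintro f ⟨h1, m, h2⟩
    refine ⟨fun a ha => Subring.neg_mem _ (h1 a ha), m, ?_⟩
    rw [mul_neg]; exact Subring.neg_mem _ h2

lemma farRing_mono {T T' : Set C} (h : T ⊆ T') : farRing T ≤ farRing T' :=
  fun _ hq => ⟨fun a ha => hq.1 a fun h' => ha (h h'), hq.2⟩

lemma coeff_C_mul {L : Type*} [Field L] (f : L) (q : LaurentSeries L) (n : ℤ) :
    (HahnSeries.C f * q).coeff n = f * q.coeff n := by
  rw [HahnSeries.C_mul_eq_smul, HahnSeries.coeff_smul, smul_eq_mul]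

lemma intDegree_inv_X_pow_mul (m : ℕ) (p : C[X]) :
    (RatFunc.X ^ m : RatFunc C)⁻¹ * algebraMap C[X] (RatFunc C) p ∈ regInfty C ↔
      p.natDegree ≤ m := by
  rcases eq_or_ne p 0 with rfl | hp
  · simp
  rw [mem_regInfty, RatFunc.intDegree_mul (by simp [RatFunc.X_ne_zero]) (by simpa using hp),
    RatFunc.intDegree_inv, ← RatFunc.algebraMap_X, ← map_pow, RatFunc.intDegree_polynomial,
    RatFunc.intDegree_polynomial]
  simp

lemma polyEmb_mem_farRing (T : Set C) (p : (LaurentSeries C)[X]) : polyEmb C p ∈ farRing T := by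
  refine ⟨fun a _ => polyEmb_mem_coeffIn_regAt a p, p.natDegree, fun n => ?_⟩
  obtain ⟨r, h1, h2⟩ := polyEmb_coeff p n
  rw [coeff_C_mul, h1, intDegree_inv_X_pow_mul, natDegree_le_iff_coeff_eq_zero]
  intro N hN
  rw [h2, coeff_eq_zero_of_natDegree_lt hN, HahnSeries.coeff_zero]

lemma coeffIn_polar_le_farRing (c : C) : coeffIn (polar c) ≤ farRing {c} := fun q hq =>
  ⟨fun _ ha n => polar_le_regAt ha (hq n), 0, by
    simpa using coeffIn_mono (polar_le_regInfty c) hq⟩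

lemma farRing_le_coeffIn {T : Set C} {a : C} (ha : a ∉ T) : farRing T ≤ coeffIn (regAt a) :=
  fun _ hq => hq.1 a ha

lemma fracs_mono {R R' : Subring (LaurentSeries (RatFunc C))} {hR : ∀ p, polyEmb C p ∈ R}
    {hR' : ∀ p, polyEmb C p ∈ R'} (h : R ≤ R') : fracs R hR ≤ fracs R' hR' := by
  rintro q ⟨p, hp, hq⟩
  exact ⟨p, hp, h hq⟩

/-- The fractions with numerators regular at `c`. -/
noncomputable abbrev nearAlg (c : C) : Subalgebra (RatFunc (LaurentSeries C)) (good C) :=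
  fracs (coeffIn (regAt c)) (polyEmb_mem_coeffIn_regAt c)

/-- The fractions with numerators regular outside `T`. -/
noncomputable abbrev farAlg (T : Set C) : Subalgebra (RatFunc (LaurentSeries C)) (good C) :=
  fracs (farRing T) (polyEmb_mem_farRing T)

lemma mem_range_of_mem_near_far [IsAlgClosed C] {ι : Type*} [Finite ι] (c : ι → C) (q : good C)
    (h₀ : q ∈ farAlg (Set.range c)) (h : ∀ i, q ∈ nearAlg (c i)) :
    q ∈ (algebraMap (RatFunc (LaurentSeries C)) (good C)).range := by
  have := Fintype.ofFinite ι
  obtain ⟨p₀, hp₀, h₀⟩ := h₀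
  choose p hp h using h
  set P := p₀ * ∏ i, p i with hP
  have hP0 : P ≠ 0 := mul_ne_zero hp₀ (Finset.prod_ne_zero_iff.2 fun i _ => hp i)
  have hfar : polyEmb C P * q ∈ farRing (Set.range c) := by
    rw [hP, map_mul, mul_comm (polyEmb C p₀), mul_assoc]
    exact Subring.mul_mem _ (polyEmb_mem_farRing _ _) h₀
  have hreg : ∀ a, polyEmb C P * q ∈ coeffIn (regAt a) := by
    intro a
    by_cases ha : a ∈ Set.range c
    · obtain ⟨i, rfl⟩ := ha
      obtain ⟨r, hr⟩ : p i ∣ P := (Finset.dvd_prod_of_mem p (Finset.mem_univ i)).mul_left _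
      rw [hr, mul_comm (p i), map_mul, mul_assoc]
      exact Subring.mul_mem _ (polyEmb_mem_coeffIn_regAt _ _) (h i)
    · exact hfar.1 a ha
  obtain ⟨m, hm⟩ := hfar.2
  obtain ⟨g, hg⟩ := mem_range_polyEmb (q := polyEmb C P * (q : LaurentSeries (RatFunc C))) m fun n => by
    obtain ⟨r, hr⟩ := mem_range_of_forall_regAt (fun a => hreg a n)
    refine ⟨r, hr.symm, ?_⟩
    have := hm n
    rwa [coeff_C_mul, ← hr, intDegree_inv_X_pow_mul] at this
  refine ⟨algebraMap _ _ g / algebraMap _ _ P, ?_⟩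
  rw [map_div₀, algebraMap_good, algebraMap_good, div_eq_iff (polyEmbGood_ne_zero hP0), mul_comm]
  exact Subtype.ext hg

end Ambient

section Factorization

open Polynomial

variable {C : Type*} [Field C] {N : Type*}

lemma matrix_mul_mem [Fintype N] {L : Type*} [Field L] (O : Subring L) {M M' : Matrix N N L}
    (h : ∀ i j, M i j ∈ O) (h' : ∀ i j, M' i j ∈ O) (i j : N) : (M * M') i j ∈ O :=
  O.sum_mem fun k _ => O.mul_mem (h i k) (h' k j)

lemma one_mem_subring [DecidableEq N] {L : Type*} [Field L] (O : Subring L) (i j : N) :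
    (1 : Matrix N N L) i j ∈ O := by
  rw [Matrix.one_apply]; split_ifs
  exacts [O.one_mem, O.zero_mem]

variable [Fintype N] [DecidableEq N]

/-- Recursive factorization of a sequence of matrices, viewed as the coefficients of a power series,
along a decomposition of entries. -/
noncomputable def factorSeq {L : Type*} [Field L] (π : L → L) (A : ℕ → Matrix N N L) :
    ℕ → Matrix N N L × Matrix N N L
  | 0 => (1, 1)
  | n + 1 =>
    let R := A (n + 1) - ∑ i : Fin n, (factorSeq π A (i + 1)).1 * (factorSeq π A (n - i)).2
    (R - R.map π, R.map π)
  decreasing_by all_goals omega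

lemma factorSeq_succ {L : Type*} [Field L] (π : L → L) (A : ℕ → Matrix N N L) (n : ℕ) :
    factorSeq π A (n + 1) =
      ((A (n + 1) - ∑ i : Fin n, (factorSeq π A (i + 1)).1 * (factorSeq π A (n - i)).2) -
        (A (n + 1) - ∑ i : Fin n, (factorSeq π A (i + 1)).1 * (factorSeq π A (n - i)).2).map π,
        (A (n + 1) - ∑ i : Fin n, (factorSeq π A (i + 1)).1 * (factorSeq π A (n - i)).2).map π) := by
  rw [factorSeq]

lemma sum_factorSeq {L : Type*} [Field L] (π : L → L) (A : ℕ → Matrix N N L) (hA : A 0 = 1)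
    (n : ℕ) : ∑ p ∈ Finset.HasAntidiagonal.antidiagonal n, (factorSeq π A p.1).1 * (factorSeq π A p.2).2 = A n := by
  cases n with
  | zero => simp [factorSeq, hA]
  | succ n =>
    rw [Finset.Nat.sum_antidiagonal_eq_sum_range_succ
      (fun i j => (factorSeq π A i).1 * (factorSeq π A j).2), Finset.sum_range_succ,
      Finset.sum_range_succ']
    simp only [Nat.sub_self, Nat.sub_zero, Nat.add_sub_add_right]
    have h0 : factorSeq π A 0 = (1, 1) := by rw [factorSeq]
    rw [h0, factorSeq_succ, Finset.sum_range]
    simp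

lemma factorSeq_mem {L : Type*} [Field L] {π : L → L} {O O' : Subring L}
    (h1 : ∀ f, f - π f ∈ O) (h2 : ∀ f, π f ∈ O') (A : ℕ → Matrix N N L) (n : ℕ) (i j : N) :
    (factorSeq π A n).1 i j ∈ O ∧ (factorSeq π A n).2 i j ∈ O' := by
  cases n with
  | zero => rw [factorSeq]; exact ⟨one_mem_subring _ _ _, one_mem_subring _ _ _⟩
  | succ n => rw [factorSeq_succ]; exact ⟨h1 _, h2 _⟩

lemma factorSeq_fst_mem {L : Type*} [Field L] {π : L → L} {O : Subring L}
    (h2 : ∀ f, π f ∈ O) (A : ℕ → Matrix N N L) (hA : ∀ n i j, A n i j ∈ O) (n : ℕ) :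
    ∀ i j, (factorSeq π A n).1 i j ∈ O := by
  induction n using Nat.strong_induction_on with
  | _ n ih =>
    cases n with
    | zero => rw [factorSeq]; exact one_mem_subring _
    | succ n =>
      intro i j
      rw [factorSeq_succ]
      have h : ∀ i j, (A (n + 1) -
          ∑ k : Fin n, (factorSeq π A (k + 1)).1 * (factorSeq π A (n - k)).2) i j ∈ O := by
        intro i j
        rw [Matrix.sub_apply, Matrix.sum_apply]
        refine O.sub_mem (hA _ _ _) (O.sum_mem fun k _ => matrix_mul_mem O (ih _ (by omega)) ?_ i j)
        intro i j
        rcases hk : n - (k : ℕ) with _ | m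
        · rw [factorSeq]; exact one_mem_subring _ _ _
        · rw [factorSeq_succ]; exact h2 _
      exact O.sub_mem (h i j) (h2 _)

/-- A matrix of power series, as a matrix of Laurent series. -/
noncomputable def serMatrix {L : Type*} [Field L] (A : ℕ → Matrix N N L) :
    Matrix N N (LaurentSeries L) :=
  (HahnSeries.ofPowerSeries ℤ L).mapMatrix (Matrix.of fun i j => PowerSeries.mk fun n => A n i j)

lemma serMatrix_coeff {L : Type*} [Field L] (A : ℕ → Matrix N N L) (i j : N) (n : ℤ) :
    (serMatrix A i j).coeff n = if n < 0 then 0 else A n.natAbs i j := by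
  change ((PowerSeries.mk fun n => A n i j : PowerSeries L) : LaurentSeries L).coeff n = _
  rw [PowerSeries.coeff_coe]; simp

lemma serMatrix_mul {L : Type*} [Field L] (A B D : ℕ → Matrix N N L)
    (h : ∀ n, ∑ p ∈ Finset.HasAntidiagonal.antidiagonal n, A p.1 * B p.2 = D n) :
    serMatrix A * serMatrix B = serMatrix D := by
  rw [serMatrix, serMatrix, serMatrix, ← map_mul]
  congr 1
  ext i j n
  rw [Matrix.mul_apply, map_sum]
  simp only [Matrix.of_apply, PowerSeries.coeff_mul, PowerSeries.coeff_mk]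
  rw [← h, Matrix.sum_apply, Finset.sum_comm]
  rfl

lemma isUnit_of_constantCoeff_eq_one {O : Type*} [CommRing O] (M : Matrix N N (PowerSeries O))
    (h : (PowerSeries.constantCoeff (R := O)).mapMatrix M = 1) : IsUnit M := by
  rw [Matrix.isUnit_iff_isUnit_det, PowerSeries.isUnit_iff_constantCoeff, RingHom.map_det, h]
  simp

lemma exists_inverse_serMatrix {L : Type*} [Field L] {O : Subring L} (A : ℕ → Matrix N N L)
    (h0 : A 0 = 1) (hA : ∀ n i j, A n i j ∈ O) :
    ∃ M', serMatrix A * M' = 1 ∧ ∀ i j, M' i j ∈ coeffIn O := by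
  let M : Matrix N N (PowerSeries O) := Matrix.of fun i j => PowerSeries.mk fun n => ⟨_, hA n i j⟩
  let j : PowerSeries O →+* LaurentSeries L :=
    (HahnSeries.ofPowerSeries ℤ L).comp (PowerSeries.map O.subtype)
  have hM : serMatrix A = j.mapMatrix M := by
    ext x y n
    simp only [serMatrix, RingHom.mapMatrix_apply, Matrix.map_apply, j, RingHom.comp_apply, M,
      Matrix.of_apply]
    congr 2
  obtain ⟨M', h'⟩ := (isUnit_of_constantCoeff_eq_one M (by
    ext x y
    simp only [RingHom.mapMatrix_apply, Matrix.map_apply, M, Matrix.of_apply,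
      PowerSeries.constantCoeff_mk, h0]
    rw [Matrix.one_apply, Matrix.one_apply]; split_ifs <;> rfl)).exists_right_inv
  refine ⟨j.mapMatrix M', by rw [hM, ← map_mul, h', map_one], fun x y n => ?_⟩
  change (((PowerSeries.map O.subtype (M' x y) : PowerSeries L) : LaurentSeries L)).coeff n ∈ O
  rw [PowerSeries.coeff_coe]
  split_ifs
  · exact O.zero_mem
  · rw [PowerSeries.coeff_map]; exact Subtype.property _

lemma exists_unit_of_inverse (M : Matrix N N (good C)) {M' : Matrix N N (LaurentSeries (RatFunc C))}
    (h : (good C).subtype.mapMatrix M * M' = 1) :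
    ∃ U : (Matrix N N (good C))ˣ, U.1 = M ∧ ∀ i j, ((U.2 i j : good C) :
      LaurentSeries (RatFunc C)) = M' i j := by
  have hdet : IsUnit M.det := by
    rw [isUnit_iff_ne_zero]
    intro h0
    have := congrArg Matrix.det h
    rw [Matrix.det_mul, ← RingHom.map_det, h0, map_zero, zero_mul, Matrix.det_one] at this
    exact zero_ne_one this
  obtain ⟨U, hU⟩ := (Matrix.isUnit_iff_isUnit_det M).2 hdet
  refine ⟨U, hU, fun i j => ?_⟩
  have h2 : (good C).subtype.mapMatrix U.2 * (good C).subtype.mapMatrix M = 1 := by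
    rw [← hU, ← map_mul, U.inv_val, map_one]
  have h3 : (good C).subtype.mapMatrix U.2 = M' := by
    rw [← mul_one ((good C).subtype.mapMatrix U.2), ← h, ← mul_assoc, h2, one_mul]
  exact congrFun (congrFun h3 i) j

lemma single_mem_range (n : ℤ) (f : RatFunc C) : ∃ e : RatFunc (LaurentSeries C),
    (algebraMap (RatFunc (LaurentSeries C)) (good C) e : LaurentSeries (RatFunc C))
      = HahnSeries.single n f := by
  have key : ∀ p : C[X], (polyEmb C (p.map (HahnSeries.C (Γ := ℤ)))) =
      HahnSeries.C (algebraMap C[X] (RatFunc C) p) := fun p => by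
    rw [polyEmb, coe_eval₂RingHom, eval₂_map]
    have : (laurentMap (RatFunc.C : C →+* RatFunc C)).comp HahnSeries.C =
        (HahnSeries.C).comp RatFunc.C := by
      ext1 x; exact laurentMap_C _ _
    rw [this, ← hom_eval₂]
    congr 1
    conv_rhs => rw [← eval₂_C_X (p := p)]
    rw [hom_eval₂]
    simp
  have hd : f.denom.map (HahnSeries.C (Γ := ℤ)) ≠ 0 :=
    (Polynomial.map_ne_zero_iff HahnSeries.C_injective).2 f.denom_ne_zero
  refine ⟨algebraMap _ _ (Polynomial.C (HahnSeries.single n 1) * f.num.map (HahnSeries.C (Γ := ℤ))) /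
    algebraMap _ _ (f.denom.map (HahnSeries.C (Γ := ℤ))), ?_⟩
  rw [map_div₀, algebraMap_good, algebraMap_good, Subfield.coe_div, coe_polyEmbGood,
    coe_polyEmbGood, div_eq_iff (by
      rw [← map_zero (polyEmb C)]; exact fun h => hd (polyEmb_injective h)), map_mul, key, key,
    ← num_div, map_mul, ← mul_assoc]
  congr 1
  have : polyEmb C (Polynomial.C (HahnSeries.single n 1)) = HahnSeries.single n 1 := by
    rw [polyEmb, coe_eval₂RingHom, eval₂_C, laurentMap_single, map_one]
  rw [this, HahnSeries.C_apply, HahnSeries.single_mul_single]; simp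

lemma exists_truncation (q : LaurentSeries (RatFunc C)) (r : ℤ) :
    ∃ e : RatFunc (LaurentSeries C), ∀ k ≤ r,
      (q - (algebraMap (RatFunc (LaurentSeries C)) (good C) e :
        LaurentSeries (RatFunc C))).coeff k = 0 := by
  choose e he using fun n : ℤ => single_mem_range n (q.coeff n)
  refine ⟨∑ k ∈ Finset.Icc q.order r, e k, fun k hk => ?_⟩
  rw [map_sum, AddSubmonoidClass.coe_finsetSum]
  simp only [he, HahnSeries.coeff_sub, HahnSeries.coeff_sum, HahnSeries.coeff_single]
  rw [sub_eq_zero]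
  by_cases h : k ∈ Finset.Icc q.order r
  · refine ((Finset.sum_eq_single_of_mem k h fun j _ hj => ?_).trans ?_).symm
    · exact if_neg hj.symm
    · exact if_pos rfl
  · refine Eq.trans ?_ (Finset.sum_eq_zero fun j hj => ?_).symm
    swap
    · refine if_neg ?_
      rintro rfl
      exact h hj
    apply HahnSeries.coeff_eq_zero_of_lt_order
    simp only [Finset.mem_Icc, not_and] at h
    by_contra h'
    push Not at h'
    exact absurd (h h') (by omega)

lemma coeff_mul_eq_zero {L : Type*} [Field L] {f g : LaurentSeries L} {r s : ℤ}
    (hf : ∀ k < r, f.coeff k = 0) (hg : ∀ k < s, g.coeff k = 0) {k : ℤ} (hk : k < r + s) :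
    (f * g).coeff k = 0 := by
  rw [HahnSeries.coeff_mul]
  refine Finset.sum_eq_zero fun p hp => ?_
  have := (Finset.mem_antidiagonal.1 hp).2.2
  by_cases h : p.1 < r
  · rw [hf _ h, zero_mul]
  · rw [hg _ (by omega), mul_zero]

lemma exists_near_one (B : (Matrix N N (good C))ˣ) : ∃ D : Matrix N N (RatFunc (LaurentSeries C)),
    ∃ A : ℕ → Matrix N N (RatFunc C), A 0 = 1 ∧ (good C).subtype.mapMatrix
      (B.1 * (algebraMap (RatFunc (LaurentSeries C)) (good C)).mapMatrix D) = serMatrix A := by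
  obtain ⟨r, hr⟩ : ∃ r : ℤ, ∀ i j, ∀ k < r,
      ((B.1 i j : good C) : LaurentSeries (RatFunc C)).coeff k = 0 := by
    obtain ⟨r, hr⟩ := (Set.finite_range fun p : N × N =>
      ((B.1 p.1 p.2 : good C) : LaurentSeries (RatFunc C)).order).bddBelow
    exact ⟨r, fun i j k hk => HahnSeries.coeff_eq_zero_of_lt_order
      (hk.trans_le (hr ⟨(i, j), rfl⟩))⟩
  choose D hD using fun i j => exists_truncation ((B.2 i j : good C) : LaurentSeries (RatFunc C))
    (-r)
  set T := (good C).subtype.mapMatrix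
      (B.1 * (algebraMap (RatFunc (LaurentSeries C)) (good C)).mapMatrix (Matrix.of D)) with hT
  have key : ∀ i j, ∀ k ≤ 0, (T i j).coeff k =
      (if k = 0 then (1 : Matrix N N (RatFunc C)) i j else 0) := by
    intro i j k hk
    have h1 : T = 1 - (good C).subtype.mapMatrix (B.1 * (B.2 -
        (algebraMap (RatFunc (LaurentSeries C)) (good C)).mapMatrix (Matrix.of D))) := by
      rw [mul_sub, map_sub, ← hT]
      have := B.val_inv
      change B.1 * B.2 = 1 at this
      rw [this, map_one, sub_sub_cancel]
    rw [h1, Matrix.sub_apply, HahnSeries.coeff_sub]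
    have h2 : ((good C).subtype.mapMatrix (B.1 * (B.2 -
        (algebraMap (RatFunc (LaurentSeries C)) (good C)).mapMatrix (Matrix.of D))) i j).coeff k
        = 0 := by
      rw [map_mul, Matrix.mul_apply, HahnSeries.coeff_sum]
      refine Finset.sum_eq_zero fun l _ => ?_
      refine coeff_mul_eq_zero (r := r) (s := -r + 1) (hr i l) (fun m hm => ?_) (by omega)
      exact hD l j m (by omega)
    rw [h2, sub_zero, Matrix.one_apply, Matrix.one_apply]
    by_cases hij : i = j
    · simp [hij, HahnSeries.coeff_one]
    · simp [hij]
  refine ⟨Matrix.of D, fun n => Matrix.of fun i j => (T i j).coeff n, ?_, ?_⟩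
  · ext i j
    simpa using key i j 0 le_rfl
  · rw [← hT]
    ext i j k
    rw [serMatrix_coeff]
    split_ifs with hk
    · rw [key i j k hk.le, if_neg hk.ne]
    · simp only [Matrix.of_apply]
      congr 1; omega

lemma serMatrix_mem_good (A : ℕ → Matrix N N (RatFunc C))
    (S : Set C) (hS : S.Finite) (hA : ∀ a ∉ S, ∀ n i j, A n i j ∈ regAt a) (i j : N) :
    serMatrix A i j ∈ good C := by
  refine hS.subset fun a ha => ?_
  by_contra h
  apply ha
  intro n
  rw [serMatrix_coeff]
  split_ifs
  exacts [Subring.zero_mem _, hA a h _ _ _]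

lemma serMatrix_mem_coeffIn {L : Type*} [Field L] {O : Subring L} {A : ℕ → Matrix N N L}
    (hA : ∀ n i j, A n i j ∈ O) (i j : N) : serMatrix A i j ∈ coeffIn O := fun n => by
  rw [serMatrix_coeff]
  split_ifs
  exacts [O.zero_mem, hA _ _ _]

/-- Factorization of invertible matrices over `good C` into a factor over `nearAlg c` and a factor
over `farAlg {c}`. -/
theorem exists_factorization (c : C) (B : (Matrix N N (good C))ˣ) :
    ∃ M M' : (Matrix N N (good C))ˣ, B = M * M' ∧
      (∀ i j, M.1 i j ∈ nearAlg c ∧ M.2 i j ∈ nearAlg c) ∧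
      ∀ i j, M'.1 i j ∈ farAlg {c} ∧ M'.2 i j ∈ farAlg {c} := by
  obtain ⟨D, A, hA0, hA⟩ := exists_near_one B
  choose π hπ hπ' using exists_polar_part c
  set Xs : ℕ → Matrix N N (RatFunc C) := fun n => (factorSeq π A n).1 with hXs
  set Ys : ℕ → Matrix N N (RatFunc C) := fun n => (factorSeq π A n).2 with hYs
  have hXY : serMatrix Xs * serMatrix Ys = serMatrix A := serMatrix_mul _ _ _ (sum_factorSeq π A hA0)
  have hX0 : Xs 0 = 1 := by simp only [hXs]; rw [factorSeq]
  have hY0 : Ys 0 = 1 := by simp only [hYs]; rw [factorSeq]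
  have hXc : ∀ n i j, Xs n i j ∈ regAt c := fun n i j => (factorSeq_mem hπ' hπ A n i j).1
  have hYc : ∀ n i j, Ys n i j ∈ polar c := fun n i j => (factorSeq_mem hπ' hπ A n i j).2
  have hgood : ∀ i j, serMatrix A i j ∈ good C := fun i j => by
    rw [← hA]; exact Subtype.property _
  set S : Set C := {c} ∪ ⋃ p : N × N, {a | serMatrix A p.1 p.2 ∉ coeffIn (regAt a)} with hS
  have hSfin : S.Finite := (Set.finite_singleton c).union
    (Set.finite_iUnion fun p => hgood p.1 p.2)
  have hAS : ∀ a ∉ S, ∀ n i j, A n i j ∈ regAt a := fun a ha n i j => by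
    simp only [hS, Set.mem_union, Set.mem_iUnion, not_or, not_exists, Set.mem_ofPred_eq,
      not_not] at ha
    have := ha.2 (i, j) n
    rwa [serMatrix_coeff, if_neg (by simp), Int.natAbs_natCast] at this
  have hne : ∀ a ∉ S, a ≠ c := fun a ha h => ha (Or.inl h)
  have hXS : ∀ a ∉ S, ∀ n i j, Xs n i j ∈ regAt a := fun a ha n =>
    factorSeq_fst_mem (fun f => polar_le_regAt (hne a ha) (hπ f)) A (hAS a ha) n
  have hYS : ∀ a ∉ S, ∀ n i j, Ys n i j ∈ regAt a := fun a ha n i j =>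
    polar_le_regAt (hne a ha) (hYc n i j)
  let Xg : Matrix N N (good C) := Matrix.of fun i j => ⟨_, serMatrix_mem_good Xs S hSfin hXS i j⟩
  let Yg : Matrix N N (good C) := Matrix.of fun i j => ⟨_, serMatrix_mem_good Ys S hSfin hYS i j⟩
  have hXg : (good C).subtype.mapMatrix Xg = serMatrix Xs := rfl
  have hYg : (good C).subtype.mapMatrix Yg = serMatrix Ys := rfl
  obtain ⟨X', hX', hX'm⟩ := exists_inverse_serMatrix Xs hX0 hXc
  obtain ⟨Y', hY', hY'm⟩ := exists_inverse_serMatrix Ys hY0 hYc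
  obtain ⟨U, hU, hU'⟩ := exists_unit_of_inverse Xg (hXg ▸ hX')
  obtain ⟨V, hV, hV'⟩ := exists_unit_of_inverse Yg (hYg ▸ hY')
  have hBD : B.1 * (algebraMap (RatFunc (LaurentSeries C)) (good C)).mapMatrix D = U.1 * V.1 := by
    apply Matrix.map_injective (f := (good C).subtype) Subtype.val_injective
    change (good C).subtype.mapMatrix _ = (good C).subtype.mapMatrix _
    rw [hA, map_mul, hU, hV, hXg, hYg, hXY]
  have hDdet : D.det ≠ 0 := fun h0 => by
    have := congrArg Matrix.det hBD
    rw [Matrix.det_mul, ← RingHom.map_det, h0, map_zero, mul_zero] at this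
    have h2 : IsUnit (U.1 * V.1).det := (Matrix.isUnit_iff_isUnit_det _).1 (U * V).isUnit
    rw [← this] at h2
    exact not_isUnit_zero h2
  obtain ⟨Du, hDu⟩ := (Matrix.isUnit_iff_isUnit_det D).2 (isUnit_iff_ne_zero.2 hDdet)
  let Dg : (Matrix N N (good C))ˣ := Units.map
    ((algebraMap (RatFunc (LaurentSeries C)) (good C)).mapMatrix : Matrix N N _ →+* _).toMonoidHom Du
  have hDg : B * Dg = U * V := by
    apply Units.ext
    rw [Units.val_mul, Units.val_mul, ← hBD, ← hDu]
    rfl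
  have hDm : ∀ i j, Dg.1 i j ∈ farAlg {c} ∧ Dg.2 i j ∈ farAlg {c} := fun i j =>
    ⟨Subalgebra.algebraMap_mem _ _, Subalgebra.algebraMap_mem _ _⟩
  have hpf := coeffIn_polar_le_farRing c
  have hVm : ∀ i j, V.1 i j ∈ farAlg {c} ∧ V.2 i j ∈ farAlg {c} := fun i j =>
    ⟨mem_fracs_of_mem (by rw [hV]; exact hpf (serMatrix_mem_coeffIn hYc i j)),
      mem_fracs_of_mem (by rw [hV']; exact hpf (hY'm i j))⟩
  refine ⟨U, V * Dg⁻¹, by rw [← mul_assoc, ← hDg, mul_inv_cancel_right], fun i j =>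
    ⟨mem_fracs_of_mem (by rw [hU]; exact serMatrix_mem_coeffIn hXc i j),
      mem_fracs_of_mem (by rw [hU']; exact hX'm i j)⟩, fun i j => ⟨?_, ?_⟩⟩
  · exact Subalgebra.sum_mem _ fun k _ => Subalgebra.mul_mem _ (hVm i k).1 (hDm k j).2
  · exact Subalgebra.sum_mem _ fun k _ => Subalgebra.mul_mem _ (hDm i k).1 (hVm k j).2

end Factorization

section Residue

open Polynomial

variable {C : Type*} [Field C]

/-- Evaluation of the coefficients of a Laurent series at `c`. -/
noncomputable def resAt (c : C) : coeffIn (regAt c) →+* LaurentSeries C where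
  toFun q := laurentMap (evalAt c) (coeffInLift q.1 q.2)
  map_one' := by
    have : coeffInLift (1 : coeffIn (regAt c)).1 (1 : coeffIn (regAt c)).2 = 1 :=
      laurentMap_injective (f := (regAt c).subtype) Subtype.val_injective (by
        rw [map_one, laurentMap_coeffInLift]; rfl)
    rw [this, map_one]
  map_mul' q q' := by
    have : coeffInLift (q * q').1 (q * q').2 = coeffInLift q.1 q.2 * coeffInLift q'.1 q'.2 :=
      laurentMap_injective (f := (regAt c).subtype) Subtype.val_injective (by
        rw [map_mul (laurentMap (regAt c).subtype), laurentMap_coeffInLift, laurentMap_coeffInLift, laurentMap_coeffInLift]; rfl)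
    rw [this, map_mul]
  map_zero' := by
    ext n
    rw [laurentMap_coeff, HahnSeries.coeff_zero, ← map_zero (evalAt c)]; rfl
  map_add' q q' := by
    ext n
    rw [HahnSeries.coeff_add, laurentMap_coeff, laurentMap_coeff, laurentMap_coeff, ← map_add]
    rfl

lemma resAt_coeff (c : C) (q : coeffIn (regAt c)) (n : ℤ) :
    (resAt c q).coeff n = evalAt c ⟨q.1.coeff n, q.2 n⟩ := rfl

lemma exists_eq_lin_mul {c : C} (q : coeffIn (regAt c)) (hq : resAt c q = 0) :
    ∃ q' : coeffIn (regAt c), (q : LaurentSeries (RatFunc C)) =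
      (HahnSeries.C (lin c) : LaurentSeries (RatFunc C)) *
        (q' : LaurentSeries (RatFunc C)) := by
  have key : ∀ n, ∃ g ∈ regAt c, q.1.coeff n = lin c * g := fun n =>
    exists_eq_mul_lin_of_evalAt ⟨_, q.2 n⟩ (by rw [← resAt_coeff, hq, HahnSeries.coeff_zero])
  refine ⟨⟨(HahnSeries.C (lin c)⁻¹ : LaurentSeries (RatFunc C)) * (q : LaurentSeries (RatFunc C)), fun n => ?_⟩, ?_⟩
  · obtain ⟨g, hg, h⟩ := key n
    rw [coeff_C_mul, h, inv_mul_cancel_left₀ (lin_ne_zero c)]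
    exact hg
  · rw [← mul_assoc, ← map_mul, mul_inv_cancel₀ (lin_ne_zero c), map_one, one_mul]

lemma C_lin_mem (c : C) : HahnSeries.C (lin c) ∈ coeffIn (regAt c) :=
  single_mem_coeffIn (lin_mem_regAt c c) 0

lemma resAt_lin (c : C) : resAt c ⟨_, C_lin_mem c⟩ = 0 := by
  ext n
  rw [resAt_coeff, HahnSeries.coeff_zero, ← map_zero (evalAt c)]
  by_cases hn : n = 0
  · subst hn
    have := evalAt_algebraMap c (X - Polynomial.C c) (algebraMap_mem_regAt c _)
    rw [eval_sub, eval_X, eval_C, sub_self] at this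
    rw [map_zero, ← this]
    congr 1
    exact Subtype.ext (by simp [lin])
  · congr 1
    exact Subtype.ext (by simp [HahnSeries.C_apply, HahnSeries.coeff_single_of_ne hn])

lemma T_mem (c : C) : (HahnSeries.single (1 : ℤ) (1 : RatFunc C)) ∈ coeffIn (regAt c) :=
  single_mem_coeffIn (Subring.one_mem _) 1

lemma resAt_T_ne_zero (c : C) : resAt c ⟨_, T_mem c⟩ ≠ 0 := by
  intro h
  have := congrArg (fun q => HahnSeries.coeff q 1) h
  simp only [resAt_coeff, HahnSeries.coeff_zero, HahnSeries.coeff_single_same] at this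
  exact one_ne_zero ((map_one (evalAt c)).symm.trans this)

lemma resAt_polyEmb (c : C) (p : (LaurentSeries C)[X]) :
    resAt c ⟨_, polyEmb_mem_coeffIn_regAt c p⟩ = p.eval (HahnSeries.C c) := by
  ext n
  rw [resAt_coeff]
  obtain ⟨r, h1, h2⟩ := polyEmb_coeff p n
  have h3 : (⟨(polyEmb C p).coeff n, polyEmb_mem_coeffIn_regAt c p n⟩ : regAt c) =
    ⟨algebraMap C[X] (RatFunc C) r, algebraMap_mem_regAt c r⟩ := Subtype.ext h1
  rw [h3, evalAt_algebraMap, eval_eq_sum_range' (n := p.natDegree + 1), eval_eq_sum_range,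
    HahnSeries.coeff_sum]
  · refine Finset.sum_congr rfl fun i _ => ?_
    rw [h2, ← map_pow, mul_comm (p.coeff i), coeff_C_mul, mul_comm]
  · refine Nat.lt_succ_of_le (natDegree_le_iff_coeff_eq_zero.2 fun j hj => ?_)
    rw [h2, coeff_eq_zero_of_natDegree_lt hj, HahnSeries.coeff_zero]

lemma eq_zero_of_forall_lin_pow_dvd {c : C} {f : RatFunc C}
    (h : ∀ N : ℕ, ∃ g ∈ regAt c, f = lin c ^ N * g) : f = 0 := by
  by_contra hf
  have hnum : f.num ≠ 0 := RatFunc.num_ne_zero hf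
  obtain ⟨g, hg, hfg⟩ := h (f.num.natDegree + 1)
  have hdvd : (X - Polynomial.C c) ^ (f.num.natDegree + 1) ∣ f.num * g.denom := by
    refine ⟨g.num * f.denom, RatFunc.algebraMap_injective C ?_⟩
    have h1 := num_div f
    have h2 := num_div g
    have h3 : algebraMap C[X] (RatFunc C) ((X - Polynomial.C c) ^ (f.num.natDegree + 1)) =
      lin c ^ (f.num.natDegree + 1) := by rw [map_pow, lin]
    rw [map_mul, map_mul, map_mul, h3]
    generalize lin c ^ (f.num.natDegree + 1) = l at *
    linear_combination (-algebraMap C[X] (RatFunc C) g.denom) * h1 +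
      l * algebraMap C[X] (RatFunc C) f.denom * h2 +
      algebraMap C[X] (RatFunc C) g.denom * algebraMap C[X] (RatFunc C) f.denom * hfg
  have hcop : IsCoprime ((X - Polynomial.C c) ^ (f.num.natDegree + 1)) g.denom := by
    refine IsCoprime.pow_left ?_
    rw [(irreducible_X_sub_C c).coprime_iff_not_dvd, dvd_iff_isRoot]
    exact hg
  have h1 := natDegree_le_of_dvd (hcop.dvd_of_dvd_mul_right hdvd) hnum
  rw [natDegree_pow, natDegree_X_sub_C] at h1
  omega

/-- The fractions of Laurent series with coefficients regular at `c`. -/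
noncomputable def nearField (c : C) : IntermediateField (RatFunc (LaurentSeries C)) (good C) where
  carrier := {q | ∃ b ∈ coeffIn (regAt c), b ≠ 0 ∧ b * q ∈ coeffIn (regAt c)}
  mul_mem' := by
    rintro q q' ⟨p, hp, h0, h⟩ ⟨p', hp', h0', h'⟩
    refine ⟨p * p', Subring.mul_mem _ hp hp', mul_ne_zero h0 h0', ?_⟩
    rw [Subfield.coe_mul, mul_mul_mul_comm]
    exact Subring.mul_mem _ h h'
  add_mem' := by
    rintro q q' ⟨p, hp, h0, h⟩ ⟨p', hp', h0', h'⟩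
    refine ⟨p * p', Subring.mul_mem _ hp hp', mul_ne_zero h0 h0', ?_⟩
    have : (p * p') * ((q + q' : good C) : LaurentSeries (RatFunc C))
      = p' * (p * q) + p * (p' * q') := by
      rw [Subfield.coe_add]; ring
    rw [this]
    exact Subring.add_mem _ (Subring.mul_mem _ hp' h) (Subring.mul_mem _ hp h')
  algebraMap_mem' := fun e => by
    obtain ⟨p, hp, h⟩ := (nearAlg c).algebraMap_mem e
    exact ⟨_, polyEmb_mem_coeffIn_regAt c p, fun h => hp (polyEmb_injective (by rw [h, map_zero])),
      h⟩
  inv_mem' := by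
    rintro q ⟨p, hp, h0, h⟩
    rcases eq_or_ne q 0 with rfl | hq
    · exact ⟨p, hp, h0, by simp⟩
    · have hq' : (q : LaurentSeries (RatFunc C)) ≠ 0 := fun h => hq (Subtype.ext h)
      refine ⟨p * q, h, mul_ne_zero h0 hq', ?_⟩
      rw [Subfield.coe_inv, mul_inv_cancel_right₀ hq']
      exact hp

lemma nearAlg_le_nearField (c : C) : nearAlg c ≤ (nearField c).toSubalgebra := by
  rintro q ⟨p, hp, h⟩
  exact ⟨_, polyEmb_mem_coeffIn_regAt c p, fun h => hp (polyEmb_injective (by rw [h, map_zero])), h⟩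

lemma not_mem_nearField {c : C} {y : good C}
    (h : ∀ a b : coeffIn (regAt c),
      (b : LaurentSeries (RatFunc C)) * (y : LaurentSeries (RatFunc C)) = a →
      resAt c b = 0 ∧ (∀ b' : coeffIn (regAt c), (b : LaurentSeries (RatFunc C)) =
        (HahnSeries.C (lin c) : LaurentSeries (RatFunc C)) * (b' : LaurentSeries (RatFunc C)) →
        resAt c a = 0)) : y ∉ nearField c := by
  rintro ⟨b, hb, hb0, ha⟩
  have hs : HahnSeries.C (Γ := ℤ) (lin c) ≠ 0 := by simpa using lin_ne_zero c
  have key : ∀ N : ℕ, ∃ a' b' : coeffIn (regAt c),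
      (b' : LaurentSeries (RatFunc C)) * (y : LaurentSeries (RatFunc C)) = a' ∧
      b = (HahnSeries.C (lin c) : LaurentSeries (RatFunc C)) ^ N *
        (b' : LaurentSeries (RatFunc C)) := by
    intro N
    induction N with
    | zero => exact ⟨⟨_, ha⟩, ⟨b, hb⟩, rfl, by simp⟩
    | succ N ih =>
      obtain ⟨a, b₁, h1, h2⟩ := ih
      obtain ⟨h3, h4⟩ := h a b₁ h1
      obtain ⟨b', hb'⟩ := exists_eq_lin_mul b₁ h3
      obtain ⟨a', ha'⟩ := exists_eq_lin_mul a (h4 b' hb')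
      refine ⟨a', b', ?_, by rw [h2, hb', pow_succ, mul_assoc]⟩
      apply mul_left_cancel₀ hs
      rw [← ha', ← h1, hb', mul_assoc]
  apply hb0
  ext n
  rw [HahnSeries.coeff_zero]
  refine eq_zero_of_forall_lin_pow_dvd (c := c) fun N => ?_
  obtain ⟨-, b', -, hb'⟩ := key N
  exact ⟨b'.1.coeff n, b'.2 n, by rw [hb', ← map_pow, coeff_C_mul]⟩

lemma single_eq_T_div (c : C) : HahnSeries.C (lin c) * HahnSeries.single (1 : ℤ) (lin c)⁻¹ =
    HahnSeries.single 1 1 := by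
  rw [HahnSeries.C_apply, HahnSeries.single_mul_single, mul_inv_cancel₀ (lin_ne_zero c), zero_add]

lemma not_mem_nearField_of_pow {c : C} {y : good C} {l : ℕ} (hl : 2 ≤ l)
    (hy : (y : LaurentSeries (RatFunc C)) ^ l = 1 + HahnSeries.single 1 (lin c)⁻¹) :
    y ∉ nearField c := by
  have hs : HahnSeries.C (Γ := ℤ) (lin c) ≠ 0 := by simpa using lin_ne_zero c
  set s : coeffIn (regAt c) := ⟨_, C_lin_mem c⟩ with hsdef
  set t : coeffIn (regAt c) := ⟨_, T_mem c⟩ with htdef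
  refine not_mem_nearField fun a b hab => ?_
  have h1 : s * a ^ l = (s + t) * b ^ l := by
    apply Subtype.ext
    change HahnSeries.C (lin c) * (a : LaurentSeries (RatFunc C)) ^ l =
      (HahnSeries.C (lin c) + HahnSeries.single 1 1) * (b : LaurentSeries (RatFunc C)) ^ l
    rw [← hab, mul_pow, hy, ← single_eq_T_div c]; ring
  refine ⟨?_, fun b' hb' => ?_⟩
  · have := congrArg (resAt c) h1
    rw [map_mul, resAt_lin, zero_mul, map_mul, map_add, resAt_lin, zero_add, map_pow] at this
    have h2 := (mul_eq_zero.1 this.symm).resolve_left (resAt_T_ne_zero c)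
    exact pow_eq_zero_iff (by omega) |>.1 h2
  · obtain ⟨m, rfl⟩ : ∃ m, l = m + 2 := ⟨l - 2, by omega⟩
    have hb : b = s * b' := Subtype.ext hb'
    have h2 : a ^ (m + 2) = s * ((s + t) * s ^ m * b' ^ (m + 2)) := by
      have h3 : s * a ^ (m + 2) = s * (s * ((s + t) * s ^ m * b' ^ (m + 2))) := by
        rw [h1, hb]; ring
      exact mul_left_cancel₀ (fun h => hs (congrArg Subtype.val h)) h3
    have := congrArg (resAt c) h2
    rw [map_mul _ s, resAt_lin, zero_mul, map_pow] at this
    exact pow_eq_zero_iff (by omega) |>.1 this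

lemma not_mem_nearField_of_artinSchreier {c : C} {y : good C} {l : ℕ} (hl : 2 ≤ l)
    (hy : (y : LaurentSeries (RatFunc C)) ^ l - (y : LaurentSeries (RatFunc C)) =
      HahnSeries.single 1 (lin c)⁻¹) :
    y ∉ nearField c := by
  have hs : HahnSeries.C (Γ := ℤ) (lin c) ≠ 0 := by simpa using lin_ne_zero c
  set s : coeffIn (regAt c) := ⟨_, C_lin_mem c⟩ with hsdef
  set t : coeffIn (regAt c) := ⟨_, T_mem c⟩ with htdef
  refine not_mem_nearField fun a b hab => ?_
  obtain ⟨m, rfl⟩ : ∃ m, l = m + 2 := ⟨l - 2, by omega⟩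
  have h1 : s * a ^ (m + 2) - s * a * b ^ (m + 1) = t * b ^ (m + 2) := by
    apply Subtype.ext
    change HahnSeries.C (lin c) * (a : LaurentSeries (RatFunc C)) ^ (m + 2) -
      (HahnSeries.C (lin c) : LaurentSeries (RatFunc C)) * (a : LaurentSeries (RatFunc C)) *
        (b : LaurentSeries (RatFunc C)) ^ (m + 1) =
      (HahnSeries.single 1 1) * (b : LaurentSeries (RatFunc C)) ^ (m + 2)
    rw [← hab, ← single_eq_T_div c, ← hy]; ring
  refine ⟨?_, fun b' hb' => ?_⟩
  · have := congrArg (resAt c) h1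
    rw [map_sub, mul_assoc, map_mul, map_mul, resAt_lin, zero_mul, zero_mul, sub_zero, map_mul,
      map_pow] at this
    have h2 := (mul_eq_zero.1 this.symm).resolve_left (resAt_T_ne_zero c)
    exact pow_eq_zero_iff (by omega) |>.1 h2
  · have hb : b = s * b' := Subtype.ext hb'
    have h2 : a ^ (m + 2) = s * (t * s ^ m * b' ^ (m + 2) + a * s ^ m * b' ^ (m + 1)) := by
      have h3 : s * a ^ (m + 2) =
          s * (s * (t * s ^ m * b' ^ (m + 2) + a * s ^ m * b' ^ (m + 1))) := by
        rw [sub_eq_iff_eq_add] at h1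
        rw [h1, hb]; ring
      exact mul_left_cancel₀ (fun h => hs (congrArg Subtype.val h)) h3
    have := congrArg (resAt c) h2
    rw [map_mul _ s, resAt_lin, zero_mul, map_pow] at this
    exact pow_eq_zero_iff (by omega) |>.1 this

end Residue

section Disjoint

open Polynomial IntermediateField

variable {E Q : Type*} [Field E] [Field Q] [Algebra E Q]

lemma natDegree_minpoly_eq_of_inf_eq_bot {P F : IntermediateField E Q} [Normal E F]
    (h : F ⊓ P = ⊥) (θ : F) :
    (minpoly P (θ : Q)).natDegree = (minpoly E (θ : Q)).natDegree := by
  have hθE : minpoly E (θ : Q) = minpoly E θ := minpoly.algebraMap_eq F.val.injective θ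
  have hinteg : IsIntegral E (θ : Q) := (Normal.isIntegral ‹_› θ).map F.val
  have hintegP : IsIntegral P (θ : Q) := hinteg.tower_top
  have hdvd := minpoly.dvd_map_of_isScalarTower E P (θ : Q)
  have hdvd' : (minpoly P (θ : Q)).map (algebraMap P Q) ∣
      ((minpoly E θ).map (algebraMap E F)).map (algebraMap F Q) := by
    rw [← hθE, Polynomial.map_map, ← IsScalarTower.algebraMap_eq E F Q,
      IsScalarTower.algebraMap_eq E P Q, ← Polynomial.map_map]
    exact Polynomial.map_dvd _ hdvd
  have hsplF : ((minpoly E θ).map (algebraMap E F)).Splits := Normal.splits ‹_› θ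
  have hne : ((minpoly E θ).map (algebraMap E F)).map (algebraMap F Q) ≠ 0 := by
    rw [Polynomial.map_map]
    exact Polynomial.map_ne_zero (minpoly.ne_zero (Normal.isIntegral ‹_› θ))
  have hspl := (hsplF.map (algebraMap F Q)).of_dvd hne hdvd'
  have hlift : (minpoly P (θ : Q)).map (algebraMap P Q) ∈ lifts (algebraMap F Q) := by
    refine hspl.mem_lift_of_roots_mem_range ((minpoly.monic hintegP).map _) _ fun a ha => ?_
    have ha' := Multiset.mem_of_le (roots.le_of_dvd hne hdvd') ha
    rw [hsplF.roots_map] at ha'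
    obtain ⟨b, -, rfl⟩ := Multiset.mem_map.1 ha'
    exact ⟨b, rfl⟩
  have hcoeff : minpoly P (θ : Q) ∈ lifts (algebraMap E P) := by
    rw [lifts_iff_coeff_lifts]
    intro n
    obtain ⟨b, hb⟩ := (lifts_iff_coeff_lifts _).1 hlift n
    rw [coeff_map] at hb
    have : (((minpoly P (θ : Q)).coeff n : P) : Q) ∈ F ⊓ P :=
      ⟨(show (b : Q) = (((minpoly P (θ : Q)).coeff n : P) : Q) from hb) ▸ b.2, ((minpoly P (θ : Q)).coeff n).2⟩
    rw [h, mem_bot] at this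
    obtain ⟨e, he⟩ := this
    exact ⟨e, Subtype.ext he⟩
  obtain ⟨g, hg, hdeg, hmon⟩ := lifts_and_natDegree_eq_and_monic hcoeff (minpoly.monic hintegP)
  refine le_antisymm ?_ ?_
  · calc _ ≤ ((minpoly E (θ : Q)).map (algebraMap E P)).natDegree :=
        natDegree_le_of_dvd hdvd (Polynomial.map_ne_zero (minpoly.ne_zero hinteg))
      _ = _ := natDegree_map _
  · rw [← hdeg]
    refine natDegree_le_of_dvd (minpoly.dvd _ _ ?_) hmon.ne_zero
    rw [← aeval_map_algebraMap P, hg, minpoly.aeval]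

lemma linearDisjoint_of_inf_eq_bot {P F : IntermediateField E Q} [FiniteDimensional E F]
    [IsGalois E F] (h : F ⊓ P = ⊥) : P.LinearDisjoint F := by
  let pb := Field.powerBasisOfFiniteOfSeparable E F
  refine LinearDisjoint.of_basis_right pb.basis ?_
  have hli : LinearIndependent P
      fun i : Fin (minpoly P (pb.gen : Q)).natDegree => (pb.gen : Q) ^ (i : ℕ) :=
    linearIndependent_pow _
  have hd : pb.dim = (minpoly P (pb.gen : Q)).natDegree := by
    rw [natDegree_minpoly_eq_of_inf_eq_bot h, ← pb.natDegree_minpoly]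
    exact congrArg _ (minpoly.algebraMap_eq F.val.injective _).symm
  have hfun : (F.val ∘ pb.basis) = (fun i : Fin (minpoly P (pb.gen : Q)).natDegree =>
      (pb.gen : Q) ^ (i : ℕ)) ∘ Fin.cast hd := by
    funext i
    simp
  rw [hfun]
  exact hli.comp _ (Fin.cast_injective hd)

lemma lift_injective_of_linearDisjoint {P F : IntermediateField E Q} (h : P.LinearDisjoint F)
    {R : Subalgebra E Q} (hR : R ≤ P.toSubalgebra) :
    Function.Injective
      (Algebra.TensorProduct.lift R.val F.val (fun _ _ => Commute.all _ _)) := by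
  have h1 : R.LinearDisjoint F.toSubalgebra :=
    Submodule.LinearDisjoint.of_le_left_of_flat (linearDisjoint_iff'.1 h) hR
  have h2 : ((Algebra.TensorProduct.lift R.val F.val (fun _ _ => Commute.all _ _)).toLinearMap) =
      (Subalgebra.toSubmodule R).mulMap (Subalgebra.toSubmodule F.toSubalgebra) :=
    TensorProduct.ext' fun a b => rfl
  intro a b hab
  exact h1.injective (by rw [← h2]; exact hab)

/-- If the automorphism group of `F` embeds into a group of order `l ^ (k + 1)` in such a way that
an element outside `P` is fixed by the automorphisms mapped into the `l ^ k`-torsion, then `F` is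
cyclic of degree `l ^ (k + 1)` and meets `P` trivially. -/
lemma inf_eq_bot_of_primePow {P F : IntermediateField E Q} [FiniteDimensional E F] [IsGalois E F]
    {l k : ℕ} [Fact l.Prime] {Z : Type*} [Group Z] (hZ : Nat.card Z = l ^ (k + 1))
    (χ : (F ≃ₐ[E] F) →* Z) (hχ : Function.Injective χ) (y : F) (hy : (y : Q) ∉ P)
    (hfix : ∀ τ : F ≃ₐ[E] F, χ τ ^ l ^ k = 1 → τ y = y) :
    F ⊓ P = ⊥ ∧ IsCyclic (F ≃ₐ[E] F) ∧ Nat.card (F ≃ₐ[E] F) = l ^ (k + 1) := by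
  have hl : l ^ (k + 1) ≠ 0 := pow_ne_zero _ (Fact.out : l.Prime).ne_zero
  have : Finite Z := Nat.finite_of_card_ne_zero (hZ ▸ hl)
  let K : IntermediateField E F := P.comap F.val
  have hyK : y ∉ fixedField K.fixingSubgroup := by
    rw [IsGalois.fixedField_fixingSubgroup]; exact hy
  obtain ⟨τ, hτ, hτy⟩ : ∃ τ ∈ K.fixingSubgroup, τ y ≠ y := by
    by_contra! hcon
    exact hyK fun τ => hcon τ.1 τ.2
  have hord : orderOf (χ τ) = l ^ (k + 1) :=
    orderOf_eq_prime_pow (fun h => hτy (hfix τ h)) (hZ ▸ pow_card_eq_one')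
  have hord' : orderOf τ = l ^ (k + 1) := by rw [← hord, orderOf_injective χ hχ]
  have hcard : Nat.card (F ≃ₐ[E] F) = l ^ (k + 1) := by
    refine le_antisymm (hZ ▸ Nat.card_le_card_of_injective χ hχ) ?_
    rw [← hord']
    exact Nat.le_of_dvd Nat.card_pos (orderOf_dvd_natCard τ)
  refine ⟨?_, isCyclic_of_orderOf_eq_card τ (hord'.trans hcard.symm), hcard⟩
  have htop : K.fixingSubgroup = ⊤ := by
    rw [← Subgroup.card_eq_iff_eq_top]
    refine le_antisymm (Subgroup.card_le_card_group _) ?_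
    rw [hcard, ← hord', ← Nat.card_zpowers]
    exact Subgroup.card_le_of_le (Subgroup.zpowers_le.2 hτ)
  have hKbot : K = ⊥ := by
    rw [← IsGalois.fixedField_fixingSubgroup K, htop, IsGalois.fixedField_top]
  rw [eq_bot_iff]
  rintro q ⟨hqF, hqP⟩
  have : (⟨q, hqF⟩ : F) ∈ K := hqP
  rw [hKbot, mem_bot] at this
  obtain ⟨e, he⟩ := this
  exact ⟨e, congrArg Subtype.val he⟩

end Disjoint

section Kummer

open Polynomial IntermediateField

variable {E Q : Type*} [Field E] [Field Q] [Algebra E Q]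

/-- There is a cyclic extension of `E` of degree `n` in `Q` which meets `P` trivially. -/
def HasCyclicDisjoint (P : IntermediateField E Q) (n : ℕ) : Prop :=
  ∃ F : IntermediateField E Q, FiniteDimensional E F ∧ IsGalois E F ∧
    IsCyclic (F ≃ₐ[E] F) ∧ Nat.card (F ≃ₐ[E] F) = n ∧ F ⊓ P = ⊥

lemma hasCyclicDisjoint_of_pow {P : IntermediateField E Q} {l k : ℕ} [hl : Fact l.Prime] {ζ : E}
    (hζ : IsPrimitiveRoot ζ (l ^ (k + 1))) {y : Q} {a : E} (ha : a ≠ 0)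
    (hy : y ^ l ^ (k + 1) = algebraMap E Q a) (hyP : y ^ l ^ k ∉ P) :
    HasCyclicDisjoint P (l ^ (k + 1)) := by
  set n := l ^ (k + 1) with hn
  have hn0 : NeZero n := ⟨pow_ne_zero _ hl.out.ne_zero⟩
  have hy0 : y ≠ 0 := by
    rintro rfl
    rw [zero_pow hn0.ne, eq_comm, map_eq_zero] at hy
    exact ha hy
  let F : IntermediateField E Q := E⟮y⟯
  let yF : F := ⟨y, mem_adjoin_simple_self E y⟩
  have hyF : yF ^ n = algebraMap E F a := Subtype.ext hy
  have hyF0 : yF ≠ 0 := fun h => hy0 (congrArg Subtype.val h)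
  have hζF : IsPrimitiveRoot (algebraMap E F ζ) n := hζ.map_of_injective (algebraMap E F).injective
  have hζQ : IsPrimitiveRoot (algebraMap E Q ζ) n := hζ.map_of_injective (algebraMap E Q).injective
  have hspl : IsSplittingField E F (X ^ n - C a) := by
    rw [IntermediateField.isSplittingField_iff]
    constructor
    · rw [Polynomial.map_sub, Polynomial.map_pow, map_X, map_C]
      exact X_pow_sub_C_splits_of_isPrimitiveRoot hζF hyF
    · refine le_antisymm (adjoin_le_iff.2 ?_) (adjoin_le_iff.2 fun z hz => ?_)
      · rw [Set.singleton_subset_iff]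
        refine subset_adjoin _ _ ((mem_rootSet_of_ne (X_pow_sub_C_ne_zero hn0.pos a)).2 ?_)
        simp [hy]
      · have hz' : z ^ n = algebraMap E Q a := by
          have := aeval_eq_zero_of_mem_rootSet hz
          simpa [sub_eq_zero] using this
        obtain ⟨i, -, hi⟩ := hζQ.eq_pow_of_pow_eq_one (ξ := z / y) (by
          rw [div_pow, hz', hy, div_self (by simpa using ha)])
        rw [eq_div_iff hy0] at hi
        rw [SetLike.mem_coe, ← hi]
        exact mul_mem (pow_mem (F.algebraMap_mem ζ) i) yF.2
  have hsep : (X ^ n - C a).Separable := separable_X_pow_sub_C a hζ.neZero'.ne ha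
  have hgal : IsGalois E F := IsGalois.of_separable_splitting_field hsep
  have hfin : FiniteDimensional E F := IsSplittingField.finiteDimensional F (X ^ n - C a)
  have hpow : ∀ τ : F ≃ₐ[E] F, (τ yF / yF) ^ n = 1 := fun τ => by
    rw [div_pow, ← map_pow, hyF, τ.commutes, div_self (by simpa using ha)]
  have hfixed : ∀ (τ : F ≃ₐ[E] F) (z : F), z ^ n = 1 → τ z = z := fun τ z hz => by
    obtain ⟨i, -, rfl⟩ := hζF.eq_pow_of_pow_eq_one hz
    rw [map_pow, τ.commutes]
  let χ : (F ≃ₐ[E] F) →* rootsOfUnity n F :=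
    { toFun := fun τ => rootsOfUnity.mkOfPowEq (τ yF / yF) (hpow τ)
      map_one' := by
        apply Subtype.ext; apply Units.ext
        simp [hyF0]
      map_mul' := fun τ σ => by
        apply Subtype.ext; apply Units.ext
        simp only [rootsOfUnity.val_mkOfPowEq_coe, Subgroup.coe_mul, Units.val_mul,
          AlgEquiv.mul_apply]
        have h1 := hfixed τ _ (hpow σ)
        rw [map_div₀] at h1
        have h2 : τ yF ≠ 0 := by simpa using hyF0
        rw [← h1]
        field_simp }
  have hχ : ∀ τ, ((χ τ : Fˣ) : F) = τ yF / yF := fun τ => rfl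
  obtain ⟨h1, h2, h3⟩ := inf_eq_bot_of_primePow (P := P) (F := F) (l := l) (k := k)
    (hζF.card_rootsOfUnity) χ (fun τ σ h => by
      have h' : τ yF / yF = σ yF / yF := by rw [← hχ, h, hχ]
      rw [div_left_inj' hyF0] at h'
      apply AlgEquiv.coe_toAlgHom_injective
      refine adjoin_algHom_ext E fun x hx => ?_
      obtain rfl : x = y := hx
      exact h') (yF ^ l ^ k) hyP (fun τ h => by
      have h' := congrArg (fun u : rootsOfUnity n F => ((u : Fˣ) : F)) h
      simp only [Subgroup.coe_pow, Units.val_pow_eq_pow_val, hχ, Subgroup.coe_one,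
        Units.val_one, div_pow] at h'
      rw [map_pow]
      exact (div_eq_one_iff_eq (pow_ne_zero _ hyF0)).1 h')
  exact ⟨F, hfin, hgal, h2, h3, h1⟩

end Kummer

section Witt

open WittVector

variable {p : ℕ} [hp : Fact p.Prime] {R S : Type*} [CommRing R] [CommRing S]

lemma truncate_eq_iff {n : ℕ} {x y : WittVector p R} :
    truncate n x = truncate n y ↔ ∀ i < n, x.coeff i = y.coeff i := by
  rw [TruncatedWittVector.ext_iff, Fin.forall_iff]
  simp only [coeff_truncate]

lemma truncate_map_eq (f : R →+* S) {n : ℕ} {x y : WittVector p R}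
    (h : truncate n x = truncate n y) : truncate n (map f x) = truncate n (map f y) := by
  rw [truncate_eq_iff] at h ⊢
  intro i hi
  rw [map_coeff, map_coeff, h i hi]

lemma truncate_frobenius_eq [CharP R p] {n : ℕ} {x y : WittVector p R}
    (h : truncate n x = truncate n y) :
    truncate n (frobenius x) = truncate n (frobenius y) := by
  rw [frobenius_eq_map_frobenius]
  exact truncate_map_eq _ h

lemma truncate_verschiebung_eq {n : ℕ} {x y : WittVector p R} :
    truncate (n + 1) (verschiebung x) = truncate (n + 1) (verschiebung y) ↔
      truncate n x = truncate n y := by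
  rw [truncate_eq_iff, truncate_eq_iff]
  refine ⟨fun h i hi => ?_, fun h i hi => ?_⟩
  · simpa using h (i + 1) (by omega)
  · rcases i with _ | i
    · simp
    · simpa using h i (by omega)

lemma exists_verschiebung_eq {x : WittVector p R} (h : x.coeff 0 = 0) :
    ∃ y, verschiebung y = x :=
  ⟨x.shift 1, by
    ext i
    rcases i with _ | i
    · simp [h]
    · rw [verschiebung_coeff_succ, shift_coeff, add_comm]⟩

lemma exists_teichmuller_add_verschiebung (x : WittVector p R) :
    ∃ y, x = teichmuller p (x.coeff 0) + verschiebung y := by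
  obtain ⟨y, hy⟩ := exists_verschiebung_eq (x := x - teichmuller p (x.coeff 0)) (by
    change constantCoeff (x - _) = 0
    rw [map_sub, sub_eq_zero]
    exact (teichmuller_coeff_zero p _).symm)
  exact ⟨y, by rw [hy]; ring⟩

lemma frobenius_teichmuller [CharP R p] (r : R) :
    frobenius (teichmuller p r) = teichmuller p (r ^ p) := by
  rw [frobenius_eq_map_frobenius, map_teichmuller, frobenius_def]

lemma frobenius_sub_teichmuller_add_verschiebung [CharP R p] (r : R) (y : WittVector p R) :
    frobenius (teichmuller p r + verschiebung y) - (teichmuller p r + verschiebung y) =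
      teichmuller p (r ^ p) - teichmuller p r + verschiebung (frobenius y - y) := by
  rw [map_add, frobenius_teichmuller, map_sub, ← verschiebung_frobenius_comm y]
  ring

lemma exists_verschiebung_eq_sub [CharP R p] {a : WittVector p R} {r : R}
    (h : r ^ p - r = a.coeff 0) :
    ∃ b, a = teichmuller p (r ^ p) - teichmuller p r + verschiebung b := by
  obtain ⟨b, hb⟩ := exists_verschiebung_eq
    (x := a - (teichmuller p (r ^ p) - teichmuller p r)) (by
      change constantCoeff (a - _) = 0
      rw [map_sub, map_sub]
      change a.coeff 0 - ((teichmuller p (r ^ p)).coeff 0 - (teichmuller p r).coeff 0) = 0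
      rw [teichmuller_coeff_zero, teichmuller_coeff_zero, h, sub_self])
  exact ⟨b, by rw [hb]; ring⟩

lemma exists_frobenius_sub_eq [CharP R p] (hR : ∀ a : R, ∃ r, r ^ p - r = a) (n : ℕ)
    (a : WittVector p R) : ∃ y, truncate n (frobenius y - y) = truncate n a := by
  induction n generalizing a with
  | zero => exact ⟨0, truncate_eq_iff.2 (by simp)⟩
  | succ n ih =>
    obtain ⟨r, hr⟩ := hR (a.coeff 0)
    obtain ⟨b, hb⟩ := exists_verschiebung_eq_sub hr
    obtain ⟨y, hy⟩ := ih b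
    refine ⟨teichmuller p r + verschiebung y, ?_⟩
    rw [frobenius_sub_teichmuller_add_verschiebung, hb, map_add, map_add (truncate (n + 1)),
      truncate_verschiebung_eq.2 hy]

lemma coeff_mem_range_of_frobenius_sub_eq [CharP R p] [CharP S p] {f : R →+* S}
    (hf : Function.Injective f) (hR : ∀ s : S, s ^ p - s ∈ f.range → s ∈ f.range) (n : ℕ)
    (a : WittVector p R) (y : WittVector p S)
    (h : truncate n (frobenius y - y) = truncate n (map f a)) :
    ∀ i < n, y.coeff i ∈ f.range := by
  induction n generalizing a y with
  | zero => simp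
  | succ n ih =>
    obtain ⟨y', hy'⟩ := exists_teichmuller_add_verschiebung y
    have h0 : y.coeff 0 ^ p - y.coeff 0 = f (a.coeff 0) := by
      have := truncate_eq_iff.1 h 0 (by omega)
      rw [map_coeff] at this
      rw [← this]
      change _ = constantCoeff (frobenius y - y)
      rw [map_sub]
      change _ = (frobenius y).coeff 0 - _
      rw [coeff_frobenius_charP]; rfl
    obtain ⟨r, hr⟩ := hR _ ⟨_, h0.symm⟩
    rw [← hr] at h0 hy'
    obtain ⟨b, hb⟩ := exists_verschiebung_eq_sub (a := a) (r := r) (hf (by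
      rw [map_sub, map_pow, h0]))
    have hyb : truncate n (frobenius y' - y') = truncate n (map f b) := by
      rw [hy', frobenius_sub_teichmuller_add_verschiebung, hb] at h
      rw [map_add (map f), map_sub (map f), map_teichmuller, map_teichmuller, map_verschiebung,
        map_pow f, map_add, map_add] at h
      exact truncate_verschiebung_eq.1 (add_left_cancel h)
    have hmem := ih b y' hyb
    choose! z hz using hmem
    have hz' : truncate n y' = truncate n (map f (mk p z)) := truncate_eq_iff.2 fun i hi => by
      rw [map_coeff]; exact (hz i hi).symm
    have hfin : truncate (n + 1) y =
        truncate (n + 1) (map f (teichmuller p r + verschiebung (mk p z))) := by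
      rw [hy', map_add (map f), map_teichmuller, map_verschiebung, map_add, map_add (truncate _),
        truncate_verschiebung_eq.2 hz']
    intro i hi
    exact ⟨_, by rw [truncate_eq_iff.1 hfin i hi, map_coeff]⟩

lemma exists_truncate_eq_intCast {K : Type*} [Field K] [CharP K p] {n : ℕ} {x : WittVector p K}
    (h : ∀ i < n, x.coeff i ^ p = x.coeff i) : ∃ m : ℤ, truncate n x = m := by
  have hmem : ∀ i < n, ∃ z : ZMod p, ZMod.castHom dvd_rfl K z = x.coeff i := fun i hi => by
    have := (Subfield.mem_bot_iff_pow_eq_self K p).2 (h i hi)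
    rw [← ZMod.fieldRange_castHom_eq_bot p] at this
    exact this
  choose! z hz using hmem
  have h1 : truncate n x = truncate n (map (ZMod.castHom dvd_rfl K) (mk p z)) :=
    truncate_eq_iff.2 fun i hi => by
      rw [map_coeff]; exact (hz i hi).symm
  obtain ⟨c, hc⟩ := (TruncatedWittVector.zmodEquivTrunc p n).surjective (truncate n (mk p z))
  obtain ⟨m, rfl⟩ := ZMod.intCast_surjective c
  refine ⟨m, ?_⟩
  rw [map_intCast, ← map_intCast (truncate n : WittVector p (ZMod p) →+* _)] at hc
  rw [h1, ← truncate_map_eq _ hc, map_intCast, map_intCast]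

lemma natCast_truncated_ne_zero {K : Type*} [Field K] [CharP K p] (n : ℕ) :
    ((p : TruncatedWittVector p (n + 1) K) ^ n) ≠ 0 := by
  intro h
  rw [← map_natCast (truncate (n + 1)), ← map_pow, ← map_zero (truncate (n + 1)),
    truncate_eq_iff] at h
  have := h n (by omega)
  rw [coeff_p_pow, zero_coeff] at this
  exact one_ne_zero this

lemma natCast_truncated_eq_zero {K : Type*} [Field K] [CharP K p] (n : ℕ) :
    ((p : TruncatedWittVector p n K) ^ n) = 0 := by
  rw [← map_natCast (truncate n), ← map_pow, ← map_zero (truncate n), truncate_eq_iff]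
  intro i hi
  rw [coeff_p_pow_eq_zero p K hi.ne, zero_coeff]

lemma addOrderOf_one_truncated {K : Type*} [Field K] [CharP K p] (n : ℕ) :
    addOrderOf (1 : TruncatedWittVector p (n + 1) K) = p ^ (n + 1) := by
  apply addOrderOf_eq_prime_pow
  · rw [nsmul_one, Nat.cast_pow]; exact natCast_truncated_ne_zero n
  · rw [nsmul_one, Nat.cast_pow]; exact natCast_truncated_eq_zero (n + 1)

end Witt

section ArtinSchreierWitt

open WittVector
open IntermediateField (adjoin adjoin_le_iff mem_top subset_adjoin)

lemma normal_of_forall_mem_range {E F : Type*} [Field E] [Field F] [Algebra E F]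
    [Algebra.IsAlgebraic E F]
    (h : ∀ (σ : F →ₐ[E] AlgebraicClosure F) (x : F),
      σ x ∈ (algebraMap F (AlgebraicClosure F)).range) : Normal E F := by
  have : Algebra.IsAlgebraic E (AlgebraicClosure F) := Algebra.IsAlgebraic.trans E F _
  have : IsAlgClosure E (AlgebraicClosure F) := ⟨inferInstance, inferInstance⟩
  have : Normal E (AlgebraicClosure F) := IsAlgClosure.normal E _
  let j : F →ₐ[E] AlgebraicClosure F := IsScalarTower.toAlgHom E F _
  have hK : Normal E j.fieldRange := by
    rw [IntermediateField.normal_iff_forall_fieldRange_le]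
    rintro σ _ ⟨x, rfl⟩
    obtain ⟨x, rfl⟩ := (AlgEquiv.ofInjectiveField j).surjective x
    obtain ⟨y, hy⟩ := h (σ.comp (AlgEquiv.ofInjectiveField j).toAlgHom) x
    exact ⟨y, hy⟩
  exact Normal.of_algEquiv j.equivFieldRange.symm

variable {p : ℕ} [hp : Fact p.Prime] {E F Ω : Type*} [Field E] [Field F] [Field Ω] [Algebra E F]
  [CharP E p] [CharP F p]

lemma exists_truncate_map_eq_add_intCast [CharP Ω p] {n : ℕ} {a : WittVector p E}
    {y : WittVector p F}
    (h : truncate n (frobenius y - y) = truncate n (map (algebraMap E F) a))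
    (σ τ : F →+* Ω) (hστ : σ.comp (algebraMap E F) = τ.comp (algebraMap E F)) :
    ∃ m : ℤ, truncate n (map σ y) = truncate n (map τ y + (m : WittVector p Ω)) := by
  have key : ∀ σ : F →+* Ω, truncate n (frobenius (map σ y) - map σ y) =
      truncate n (map (σ.comp (algebraMap E F)) a) := fun σ => by
    have h1 := truncate_map_eq σ h
    have h2 : map σ (map (algebraMap E F) a) = map (σ.comp (algebraMap E F)) a := by
      ext i; simp
    have h3 : map σ (frobenius y) = frobenius (map σ y) := by
      ext i; simp [map_coeff, coeff_frobenius_charP]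
    rw [h2, map_sub, h3] at h1
    exact h1
  obtain ⟨m, hm⟩ := exists_truncate_eq_intCast (n := n) (x := map σ y - map τ y) (fun i hi => by
    rw [← coeff_frobenius_charP]
    refine truncate_eq_iff.1 ?_ i hi
    have h1 := key σ
    rw [hστ, ← key τ, map_sub, map_sub] at h1
    rw [map_sub, map_sub, map_sub]
    linear_combination h1)
  refine ⟨m, ?_⟩
  rw [map_add, map_intCast, ← hm, map_sub]
  ring

lemma normal_of_frobenius_sub_eq {n : ℕ} {a : WittVector p E} {y : WittVector p F}
    [Algebra.IsAlgebraic E F]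
    (h : truncate n (frobenius y - y) = truncate n (map (algebraMap E F) a))
    (hgen : adjoin E {x | ∃ i < n, y.coeff i = x} = ⊤) : Normal E F := by
  refine normal_of_forall_mem_range fun σ x => ?_
  have : CharP (AlgebraicClosure F) p := charP_of_injective_algebraMap
    (algebraMap F (AlgebraicClosure F)).injective p
  suffices h : (⊤ : IntermediateField E F) ≤
      (IsScalarTower.toAlgHom E F (AlgebraicClosure F)).fieldRange.comap σ from
    h (mem_top (x := x))
  rw [← hgen, adjoin_le_iff]
  rintro _ ⟨i, hi, rfl⟩
  obtain ⟨m, hm⟩ := exists_truncate_map_eq_add_intCast h σ.toRingHom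
    (algebraMap F (AlgebraicClosure F)) (by
      ext e
      change σ (algebraMap E F e) = _
      rw [σ.commutes]
      exact IsScalarTower.algebraMap_apply E F _ e)
  rw [← map_intCast (map (p := p) (algebraMap F (AlgebraicClosure F))), ← map_add] at hm
  have := truncate_eq_iff.1 hm i hi
  rw [map_coeff, map_coeff] at this
  exact ⟨_, this.symm⟩

lemma exists_monoidHom_of_map_mul {Γ A : Type*} [Group Γ] [AddGroup A] (f : Γ → A)
    (hf : ∀ σ τ, f (σ * τ) = f σ + f τ) (S : AddSubgroup A) (hS : ∀ σ, f σ ∈ S) :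
    ∃ χ : Γ →* Multiplicative S, ∀ σ, ((χ σ).toAdd : A) = f σ :=
  ⟨MonoidHom.mk' (fun σ => Multiplicative.ofAdd ⟨f σ, hS σ⟩) fun σ τ =>
    congrArg Multiplicative.ofAdd (Subtype.ext (hf σ τ)), fun _ => rfl⟩

/-- The character of the automorphism group attached to a solution of an Artin--Schreier--Witt
equation. -/
lemma exists_character_of_frobenius_sub_eq {k : ℕ} {a : WittVector p E} {y : WittVector p F}
    (h : truncate (k + 1) (frobenius y - y) = truncate (k + 1) (map (algebraMap E F) a))
    (hgen : adjoin E {x | ∃ i < k + 1, y.coeff i = x} = ⊤) :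
    ∃ χ : (F ≃ₐ[E] F) →*
        Multiplicative (AddSubgroup.zmultiples (1 : TruncatedWittVector p (k + 1) F)),
      Function.Injective χ ∧ ∀ τ, χ τ ^ p ^ k = 1 → τ (y.coeff 0) = y.coeff 0 := by
  have hmap : ∀ τ : F ≃ₐ[E] F, ∃ m : ℤ,
      truncate (k + 1) (map (τ : F →+* F) y - y) = (m : TruncatedWittVector p (k + 1) F) :=
      fun τ => by
    obtain ⟨m, hm⟩ := exists_truncate_map_eq_add_intCast h (τ : F →+* F) (RingHom.id F) (by
      ext e; simp)
    refine ⟨m, ?_⟩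
    have : map (RingHom.id F) y = y := by ext i; simp
    rw [map_sub, hm, this, map_add, map_intCast]
    ring
  have hmem : ∀ τ : F ≃ₐ[E] F, truncate (k + 1) (map (τ : F →+* F) y - y) ∈
      AddSubgroup.zmultiples (1 : TruncatedWittVector p (k + 1) F) := fun τ => by
    obtain ⟨m, hm⟩ := hmap τ
    rw [hm, AddSubgroup.mem_zmultiples_iff]
    exact ⟨m, by simp⟩
  have hadd : ∀ σ τ : F ≃ₐ[E] F,
      truncate (k + 1) (map ((σ * τ : F ≃ₐ[E] F) : F →+* F) y - y) =
        truncate (k + 1) (map (σ : F →+* F) y - y) +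
          truncate (k + 1) (map (τ : F →+* F) y - y) := fun σ τ => by
    obtain ⟨m, hm⟩ := hmap τ
    have h1 : truncate (k + 1) (map (σ : F →+* F) (map (τ : F →+* F) y - y)) =
        truncate (k + 1) (map (τ : F →+* F) y - y) := by
      rw [hm, ← map_intCast (truncate (k + 1) : WittVector p F →+* _)]
      rw [← map_intCast (truncate (k + 1) : WittVector p F →+* _)] at hm
      rw [truncate_map_eq (σ : F →+* F) hm, map_intCast]
    have h2 : map ((σ * τ : F ≃ₐ[E] F) : F →+* F) y =
        map (σ : F →+* F) (map (τ : F →+* F) y) := by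
      ext i; simp only [map_coeff]; rfl
    rw [h2, ← h1, ← map_add, map_sub (map (σ : F →+* F))]
    exact congrArg _ (by ring)
  obtain ⟨χ, hχ⟩ := exists_monoidHom_of_map_mul _ hadd _ hmem
  refine ⟨χ, ?_, fun τ hτ => ?_⟩
  · rw [injective_iff_map_eq_one]
    intro τ hτ
    have h0 : truncate (k + 1) (map (τ : F →+* F) y - y) = 0 :=
      (hχ τ).symm.trans (by rw [hτ]; rfl)
    rw [map_sub, sub_eq_zero, truncate_eq_iff] at h0
    apply AlgEquiv.coe_toAlgHom_injective
    have h2 : (⊤ : IntermediateField E F) ≤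
        (AlgHom.equalizer (τ : F →ₐ[E] F) (1 : F ≃ₐ[E] F)).toIntermediateField
          (fun x hx => by
            change τ _ = _ at hx ⊢
            rw [map_inv₀, hx]; rfl) := by
      rw [← hgen, adjoin_le_iff]
      rintro _ ⟨i, hi, rfl⟩
      have := h0 i hi
      rw [map_coeff] at this
      exact this
    ext x
    exact h2 (mem_top (x := x))
  · obtain ⟨m, hm⟩ := hmap τ
    have h0 : p ^ k • truncate (k + 1) (map (τ : F →+* F) y - y) = 0 :=
      by rw [← hχ τ, ← AddSubgroup.coe_nsmul, ← toAdd_pow, hτ]; rfl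
    rw [hm, ← zsmul_one, ← natCast_zsmul, smul_smul, ← addOrderOf_dvd_iff_zsmul_eq_zero,
      addOrderOf_one_truncated, pow_succ, Nat.cast_mul] at h0
    have hpm : (p : ℤ) ∣ m := Int.dvd_of_mul_dvd_mul_left
      (by exact_mod_cast pow_ne_zero k hp.out.ne_zero) h0
    rw [← map_intCast (truncate (k + 1) : WittVector p F →+* _), truncate_eq_iff] at hm
    have h1 := hm 0 (by omega)
    change constantCoeff (map (τ : F →+* F) y - y) = constantCoeff (m : WittVector p F) at h1
    rw [map_intCast, (CharP.intCast_eq_zero_iff F p m).2 hpm, map_sub, sub_eq_zero] at h1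
    change (map (τ : F →+* F) y).coeff 0 = y.coeff 0 at h1
    rwa [map_coeff] at h1

lemma isSeparable_of_pow_sub_eq {s : F} {b : E} (hs : s ^ p - s = algebraMap E F b) :
    IsSeparable E s := by
  have hsep : (Polynomial.X ^ p - Polynomial.X - Polynomial.C b).Separable := by
    rw [Polynomial.separable_def']
    exact ⟨0, -1, by simp [Polynomial.derivative_X_pow]⟩
  refine hsep.of_dvd (minpoly.dvd _ s ?_)
  rw [map_sub, map_sub, map_pow, Polynomial.aeval_X, Polynomial.aeval_C, hs, sub_self]

lemma mem_separableClosure_of_pow_sub_mem {s : F}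
    (hs : s ^ p - s ∈ separableClosure E F) : s ∈ separableClosure E F := by
  have : CharP (separableClosure E F) p :=
    charP_of_injective_algebraMap (algebraMap E _).injective p
  have h1 : IsSeparable (separableClosure E F) s :=
    isSeparable_of_pow_sub_eq (p := p) (b := ⟨s ^ p - s, hs⟩) rfl
  exact mem_separableClosure_iff.2 (IsSeparable.of_algebra_isSeparable_of_isSeparable E h1)

lemma hasCyclicDisjoint_of_frobenius_sub_eq {Q : Type*} [Field Q] [Algebra E Q] [CharP Q p]
    {P : IntermediateField E Q} {k : ℕ} {a : WittVector p E} {y : WittVector p Q}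
    (h : truncate (k + 1) (frobenius y - y) = truncate (k + 1) (map (algebraMap E Q) a))
    (hP : y.coeff 0 ∉ P) : HasCyclicDisjoint P (p ^ (k + 1)) := by
  have hsep : ∀ i < k + 1, IsSeparable E (y.coeff i) := by
    let S := separableClosure E Q
    have hS : CharP S p := charP_of_injective_algebraMap (algebraMap E S).injective p
    have := coeff_mem_range_of_frobenius_sub_eq (f := algebraMap S Q)
      (algebraMap S Q).injective (fun s hs => by
        obtain ⟨b, hb⟩ := hs
        exact ⟨⟨s, mem_separableClosure_of_pow_sub_mem (by rw [← hb]; exact b.2)⟩, rfl⟩)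
      (k + 1) (map (algebraMap E S) a) y (by
        rw [h]
        congr 1)
    intro i hi
    obtain ⟨z, hz⟩ := this i hi
    rw [← hz]
    exact z.2
  let T : Set Q := {x | ∃ i < k + 1, y.coeff i = x}
  let F : IntermediateField E Q := adjoin E T
  have hT : Finite T := (Set.finite_lt_nat (k + 1)).image y.coeff
  have hyF : ∀ i < k + 1, y.coeff i ∈ F := fun i hi => subset_adjoin _ _ ⟨i, hi, rfl⟩
  have hFfin : FiniteDimensional E F := IntermediateField.finiteDimensional_adjoin (fun x hx => by
    obtain ⟨i, hi, rfl⟩ := hx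
    exact (hsep i hi).isIntegral)
  have hFsep : Algebra.IsSeparable E F := by
    rw [IntermediateField.isSeparable_adjoin_iff_isSeparable]
    rintro _ ⟨i, hi, rfl⟩
    exact hsep i hi
  have hFp : CharP F p := charP_of_injective_algebraMap (algebraMap E F).injective p
  let z : WittVector p F := WittVector.mk p fun i => if hi : i < k + 1 then ⟨_, hyF i hi⟩ else 0
  have hz : ∀ i < k + 1, (z.coeff i : Q) = y.coeff i := fun i hi => by
    change ((if hi : i < k + 1 then ⟨_, hyF i hi⟩ else 0 : F) : Q) = _
    rw [dif_pos hi]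
  have hzeq : truncate (k + 1) (frobenius z - z) = truncate (k + 1) (map (algebraMap E F) a) := by
    have h1 : truncate (k + 1) (map (algebraMap F Q) z) = truncate (k + 1) y :=
      truncate_eq_iff.2 fun i hi => by rw [map_coeff]; exact hz i hi
    have h2 : map (algebraMap F Q) (frobenius z) = frobenius (map (algebraMap F Q) z) := by
      ext i; simp [map_coeff, coeff_frobenius_charP]
    have h3 : truncate (k + 1) (map (algebraMap F Q) (frobenius z - z)) =
        truncate (k + 1) (map (algebraMap F Q) (map (algebraMap E F) a)) := by
      rw [map_sub, h2, map_sub, truncate_frobenius_eq h1, h1, ← map_sub, h]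
      congr 1
    refine truncate_eq_iff.2 fun i hi => (algebraMap F Q).injective ?_
    have := truncate_eq_iff.1 h3 i hi
    rwa [map_coeff, map_coeff] at this
  have hgen : adjoin E {x : F | ∃ i < k + 1, z.coeff i = x} = ⊤ := by
    apply IntermediateField.lift_injective F
    rw [IntermediateField.lift_adjoin, IntermediateField.lift_top]
    congr 1
    ext x
    refine ⟨?_, ?_⟩
    · rintro ⟨_, ⟨i, hi, rfl⟩, rfl⟩
      exact ⟨i, hi, (hz i hi).symm⟩
    · rintro ⟨i, hi, rfl⟩
      exact ⟨_, ⟨i, hi, rfl⟩, hz i hi⟩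
  have hnor : Normal E F := normal_of_frobenius_sub_eq hzeq hgen
  have hgal : IsGalois E F := ⟨⟩
  obtain ⟨χ, hχ, hfix⟩ := exists_character_of_frobenius_sub_eq hzeq hgen
  obtain ⟨h1, h2, h3⟩ := inf_eq_bot_of_primePow (P := P) (F := F) (l := p) (k := k)
    (by
      rw [Nat.card_congr Multiplicative.toAdd, Nat.card_zmultiples, addOrderOf_one_truncated])
    χ hχ (z.coeff 0) (by rwa [hz 0 (by omega)]) hfix
  exact ⟨F, hFfin, hgal, h2, h3, h1⟩

end ArtinSchreierWitt

section Hensel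

open Polynomial

lemma exists_powerSeries_root {R : Type*} [CommRing R] {f : (PowerSeries R)[X]} (hf : f.Monic)
    (r : R) (h0 : (f.map PowerSeries.constantCoeff).eval r = 0)
    (hu : IsUnit ((f.map PowerSeries.constantCoeff).derivative.eval r)) :
    ∃ y : PowerSeries R, f.eval y = 0 ∧ PowerSeries.constantCoeff y = r := by
  have hmem : ∀ g : PowerSeries R, g ∈ Ideal.span {(PowerSeries.X : PowerSeries R)} ↔
      PowerSeries.constantCoeff g = 0 := fun g => by
    rw [Ideal.mem_span_singleton, PowerSeries.X_dvd_iff]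
  have hev : ∀ g : (PowerSeries R)[X], PowerSeries.constantCoeff (g.eval (PowerSeries.C r)) =
      (g.map PowerSeries.constantCoeff).eval r := fun g => by
    rw [eval_map, ← eval₂_at_apply, PowerSeries.constantCoeff_C]
  obtain ⟨y, hy, hyr⟩ := HenselianRing.is_henselian
    (I := Ideal.span {(PowerSeries.X : PowerSeries R)}) f hf (PowerSeries.C r)
    ((hmem _).2 (by rw [hev, h0])) (by
      refine IsUnit.map _ (PowerSeries.isUnit_iff_constantCoeff.2 ?_)
      rw [hev, ← derivative_map]
      exact hu)
  refine ⟨y, hy, ?_⟩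
  rw [hmem, map_sub, sub_eq_zero, PowerSeries.constantCoeff_C] at hyr
  exact hyr

end Hensel

section Transport

variable {C : Type*} [Field C]

/-- The ring homomorphism from formal power series over `C` to Laurent series over `C(x)` which
substitutes `t / (x - c)` for the variable. -/
noncomputable def substLin (c : C) : PowerSeries C →+* LaurentSeries (RatFunc C) :=
  (HahnSeries.ofPowerSeries ℤ (RatFunc C)).comp
    ((PowerSeries.rescale (lin c)⁻¹).comp (PowerSeries.map RatFunc.C))

lemma substLin_X (c : C) : substLin c PowerSeries.X = HahnSeries.single 1 (lin c)⁻¹ := by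
  simp only [substLin, RingHom.comp_apply, PowerSeries.map_X, PowerSeries.rescale_X, map_mul,
    HahnSeries.ofPowerSeries_C, HahnSeries.ofPowerSeries_X, HahnSeries.C_apply,
    HahnSeries.single_mul_single]
  simp

lemma substLin_mem_coeffIn {a c : C} (h : a ≠ c) (f : PowerSeries C) :
    substLin c f ∈ coeffIn (regAt a) := fun n => by
  rcases lt_or_ge n 0 with hn | hn
  · have : (substLin c f).coeff n = 0 := by
      simp only [substLin, RingHom.comp_apply, HahnSeries.ofPowerSeries_apply]
      apply HahnSeries.embDomain_of_notMem_range
      rintro ⟨m, rfl⟩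
      exact absurd hn (by simp)
    rw [this]
    exact zero_mem _
  · lift n to ℕ using hn
    simp only [substLin, RingHom.comp_apply, HahnSeries.ofPowerSeries_apply_coeff,
      PowerSeries.coeff_rescale, PowerSeries.coeff_map]
    exact mul_mem (pow_mem (inv_lin_mem_regAt h) n) (C_mem_regAt a _)

lemma substLin_mem_good (c : C) (f : PowerSeries C) : substLin c f ∈ good C :=
  mem_good.2 ((Set.finite_singleton c).subset fun _ ha =>
    by_contra fun hac => ha (substLin_mem_coeffIn hac f))

/-- The corestriction of `substLin c` to `good C`. -/
noncomputable def substLinGood (c : C) : PowerSeries C →+* good C :=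
  (substLin c).codRestrict (good C).toSubring (substLin_mem_good c)

lemma exists_algebraMap_eq_single (c : C) : ∃ e : RatFunc (LaurentSeries C),
    algebraMap _ (good C) e = substLinGood c PowerSeries.X := by
  obtain ⟨e, he⟩ := single_mem_range (C := C) 1 (lin c)⁻¹
  exact ⟨e, Subtype.ext (he.trans (substLin_X c).symm)⟩

end Transport

section CyclicExtensions

open Polynomial WittVector

variable {C : Type*} [Field C] [IsAlgClosed C]

lemma hasCyclicDisjoint_nearField_of_ne_zero (c : C) (l k : ℕ) [hl : Fact l.Prime]
    (hlC : (l : C) ≠ 0) : HasCyclicDisjoint (nearField c) (l ^ (k + 1)) := by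
  have hn : l ^ (k + 1) ≠ 0 := pow_ne_zero _ hl.out.ne_zero
  have hnC : NeZero ((l ^ (k + 1) : ℕ) : C) := ⟨by push_cast; exact pow_ne_zero _ hlC⟩
  obtain ⟨ζ, hζ⟩ := HasEnoughRootsOfUnity.exists_primitiveRoot C (l ^ (k + 1))
  obtain ⟨z, hz, -⟩ := exists_powerSeries_root
    (monic_X_pow_sub_C (1 + PowerSeries.X : PowerSeries C) hn) 1 (by simp) (by
      rw [Polynomial.map_sub, Polynomial.map_pow, map_X, map_C]
      simpa [derivative_X_pow] using hlC)
  rw [eval_sub, eval_pow, eval_X, eval_C, sub_eq_zero] at hz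
  obtain ⟨e, he⟩ := exists_algebraMap_eq_single c
  have hz' : substLinGood c z ^ l ^ (k + 1) = 1 + substLinGood c PowerSeries.X := by
    rw [← map_pow, hz, map_add, map_one]
  refine hasCyclicDisjoint_of_pow (a := 1 + e) (y := substLinGood c z)
    (hζ.map_of_injective
      (((RatFunc.C : LaurentSeries C →+* _).comp (HahnSeries.C (Γ := ℤ))).injective)) ?_ ?_ ?_
  · intro h0
    have hu : IsUnit (1 + PowerSeries.X : PowerSeries C) :=
      PowerSeries.isUnit_iff_constantCoeff.2 (by simp)
    refine (hu.map (substLinGood c)).ne_zero ?_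
    rw [map_add, map_one, ← he, ← map_one (algebraMap (RatFunc (LaurentSeries C)) (good C)),
      ← map_add, h0, map_zero]
  · rw [hz', map_add, map_one, he]
  · refine not_mem_nearField_of_pow hl.out.two_le ?_
    rw [← SubmonoidClass.coe_pow, ← pow_mul, ← pow_succ, hz', ← substLin_X]
    rfl

lemma degree_X_add_C_lt {R : Type*} [CommRing R] [Nontrivial R] {p : ℕ} (hp : 1 < p) (a : R) :
    (X + Polynomial.C a : R[X]).degree < p := by
  rw [degree_X_add_C]
  exact_mod_cast hp

lemma monic_X_pow_sub_X_sub_C {R : Type*} [CommRing R] [Nontrivial R] {p : ℕ} (hp : 1 < p)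
    (a : R) : (X ^ p - X - Polynomial.C a : R[X]).Monic := by
  rw [sub_sub, sub_eq_add_neg]
  exact monic_X_pow_add (by rw [degree_neg]; exact degree_X_add_C_lt hp a)

lemma degree_X_pow_sub_X_sub_C {R : Type*} [CommRing R] [Nontrivial R] {p : ℕ} (hp : 1 < p)
    (a : R) : (X ^ p - X - Polynomial.C a : R[X]).degree = p := by
  rw [sub_sub, degree_sub_eq_left_of_degree_lt, degree_X_pow]
  rw [degree_X_pow]
  exact degree_X_add_C_lt hp a

lemma hasCyclicDisjoint_nearField_of_charP (c : C) (p k : ℕ) [hp : Fact p.Prime] [CharP C p] :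
    HasCyclicDisjoint (nearField c) (p ^ (k + 1)) := by
  have : CharP (PowerSeries C) p := charP_of_injective_ringHom
    (PowerSeries.C_injective (R := C)) p
  have : CharP (RatFunc (LaurentSeries C)) p := charP_of_injective_ringHom
    (((RatFunc.C : LaurentSeries C →+* _).comp (HahnSeries.C (Γ := ℤ))).injective) p
  have : CharP (good C) p := charP_of_injective_algebraMap
    (algebraMap (RatFunc (LaurentSeries C)) (good C)).injective p
  obtain ⟨y, hy⟩ := exists_frobenius_sub_eq (R := PowerSeries C) (p := p) (fun a => by
    obtain ⟨r, hr⟩ := IsAlgClosed.exists_root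
      (X ^ p - X - Polynomial.C (PowerSeries.constantCoeff a)) (by
        rw [degree_X_pow_sub_X_sub_C hp.out.one_lt]
        exact_mod_cast hp.out.ne_zero)
    obtain ⟨z, hz, -⟩ := exists_powerSeries_root (f := X ^ p - X - Polynomial.C a) 
      (monic_X_pow_sub_X_sub_C hp.out.one_lt a) r (by simpa using hr)
      (by simp [derivative_X_pow])
    exact ⟨z, by simpa [sub_eq_zero] using hz⟩) (k + 1) (teichmuller p PowerSeries.X)
  obtain ⟨e, he⟩ := exists_algebraMap_eq_single c
  refine hasCyclicDisjoint_of_frobenius_sub_eq (a := teichmuller p e)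
    (y := map (substLinGood c) y) ?_ ?_
  · have h1 : map (substLinGood c) (WittVector.frobenius y) =
        WittVector.frobenius (map (substLinGood c) y) := by
      ext i; simp [map_coeff, coeff_frobenius_charP]
    have h2 := truncate_map_eq (substLinGood c) hy
    rwa [map_sub, h1, map_teichmuller, ← he, ← map_teichmuller] at h2
  · have h1 := truncate_eq_iff.1 hy 0 (by omega)
    change constantCoeff (WittVector.frobenius y - y) = _ at h1
    rw [map_sub, teichmuller_coeff_zero] at h1
    change (WittVector.frobenius y).coeff 0 - y.coeff 0 = _ at h1
    rw [coeff_frobenius_charP] at h1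
    refine not_mem_nearField_of_artinSchreier hp.out.two_le ?_
    rw [map_coeff, ← substLin_X, ← h1, map_sub, map_pow]
    rfl

lemma hasCyclicDisjoint_nearField (c : C) (l k : ℕ) [hl : Fact l.Prime] :
    HasCyclicDisjoint (nearField c) (l ^ (k + 1)) := by
  by_cases h : (l : C) = 0
  · have : CharP C l := (CharP.charP_iff_prime_eq_zero hl.out).2 h
    exact hasCyclicDisjoint_nearField_of_charP c l k
  · exact hasCyclicDisjoint_nearField_of_ne_zero c l k h

end CyclicExtensions

section Realization

variable {C : Type*} [Field C]

lemma subgroup_eq_top_of_primePow {G : Type*} [Group G] [Finite G] (H : Subgroup G)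
    (h : ∀ (g : G) (l k : ℕ), l.Prime → orderOf g = l ^ (k + 1) → g ∈ H) : H = ⊤ := by
  rw [← Subgroup.card_eq_iff_eq_top]
  refine Nat.dvd_antisymm H.card_subgroup_dvd_card ?_
  rw [Nat.dvd_iff_prime_pow_dvd_dvd]
  intro l k hl hk
  have : Fact l.Prime := ⟨hl⟩
  obtain ⟨K, hK⟩ := Sylow.exists_subgroup_card_pow_prime l hk
  rw [← hK]
  refine Subgroup.card_dvd_of_le fun g hg => ?_
  have hdvd : orderOf g ∣ l ^ k := by
    rw [← hK, ← Subgroup.orderOf_mk g hg]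
    exact orderOf_dvd_natCard _
  obtain ⟨j, -, hj⟩ := (Nat.dvd_prime_pow hl).1 hdvd
  rcases j with _ | j
  · rw [pow_zero, orderOf_eq_one_iff] at hj
    rw [hj]
    exact H.one_mem
  · exact h g l j hl hj

lemma exists_factorization_near_far {ι : Type*} {c : ι → C} (hc : Function.Injective c) (n : ℕ)
    (i : ι) (B : (Matrix (Fin n) (Fin n) (good C))ˣ) :
    ∃ M M' : (Matrix (Fin n) (Fin n) (good C))ˣ, B = M * M' ∧
      (∀ x y, M.1 x y ∈ nearAlg (c i) ∧ M.2 x y ∈ nearAlg (c i)) ∧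
      (∀ x y, M'.1 x y ∈ farAlg (Set.range c) ∧ M'.2 x y ∈ farAlg (Set.range c)) ∧
      ∀ j, j ≠ i → ∀ x y, M'.1 x y ∈ nearAlg (c j) ∧ M'.2 x y ∈ nearAlg (c j) := by
  obtain ⟨M, M', h, h1, h2⟩ := exists_factorization (c i) B
  have hfar : farAlg {c i} ≤ farAlg (Set.range c) :=
    fracs_mono (farRing_mono (Set.singleton_subset_iff.2 ⟨i, rfl⟩))
  have hnear : ∀ j, j ≠ i → farAlg {c i} ≤ nearAlg (c j) := fun j hj =>
    fracs_mono (farRing_le_coeffIn fun h => hj (hc h))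
  exact ⟨M, M', h, h1, fun x y => ⟨hfar (h2 x y).1, hfar (h2 x y).2⟩,
    fun j hj x y => ⟨hnear j hj (h2 x y).1, hnear j hj (h2 x y).2⟩⟩

/-- Every finite group is the Galois group of an extension of `C((t))(x)` inside `good C`. -/
theorem exists_galois_good [IsAlgClosed C] (G : Type*) [Group G] [Finite G] :
    ∃ L : IntermediateField (RatFunc (LaurentSeries C)) (good C),
      FiniteDimensional (RatFunc (LaurentSeries C)) L ∧ IsGalois (RatFunc (LaurentSeries C)) L ∧
        Nonempty ((L ≃ₐ[RatFunc (LaurentSeries C)] L) ≃* G) := by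
  let ι := {g : G // ∃ l k : ℕ, l.Prime ∧ orderOf g = l ^ (k + 1)}
  let c : ι ↪ C := ((Finite.equivFin ι).toEmbedding.trans Fin.valEmbedding).trans
    (Infinite.natEmbedding C)
  have hF : ∀ i : ι, HasCyclicDisjoint (nearField (c i)) (orderOf i.1) := fun i => by
    obtain ⟨l, k, hl, hk⟩ := i.2
    have : Fact l.Prime := ⟨hl⟩
    rw [hk]
    exact hasCyclicDisjoint_nearField (c i) l k
  choose F hfin hgal hcyc hcard hinf using hF
  let e : ∀ i, (F i ≃ₐ[RatFunc (LaurentSeries C)] F i) ≃* Subgroup.zpowers i.1 := fun i =>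
    mulEquivOfCyclicCardEq ((hcard i).trans (Nat.card_zpowers i.1).symm)
  refine exists_galois (farAlg (Set.range c)) (fun i => nearAlg (c i)) F
    (fun i => (Subgroup.zpowers i.1).subtype.comp (e i).toMonoidHom)
    (fun i => (Subtype.val_injective).comp (e i).injective) ?_
    (fun i => lift_injective_of_linearDisjoint (linearDisjoint_of_inf_eq_bot (hinf i))
      (nearAlg_le_nearField (c i)))
    (mem_range_of_mem_near_far c) (exists_factorization_near_far c.injective)
  refine subgroup_eq_top_of_primePow _ fun g l k hl hk => ?_
  let i : ι := ⟨g, l, k, hl, hk⟩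
  refine Subgroup.mem_iSup_of_mem i ?_
  obtain ⟨σ, hσ⟩ := (e i).surjective ⟨g, Subgroup.mem_zpowers g⟩
  exact ⟨σ, congrArg Subtype.val hσ⟩

end Realization

section Roots

open Polynomial

lemma eq_prod_X_sub_C_of_injective {R ι : Type*} [CommRing R] [IsDomain R] [Fintype ι] {p : R[X]}
    (hp : p.Monic) (hd : p.natDegree = Fintype.card ι) {r : ι → R} (hr : Function.Injective r)
    (h : ∀ i, p.eval (r i) = 0) : p = ∏ i, (X - C (r i)) := by
  have hdvd : ∏ i, (X - C (r i)) ∣ p := by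
    have h1 : Multiset.map r Finset.univ.val ≤ p.roots := by
      rw [Multiset.le_iff_subset (Multiset.Nodup.map hr Finset.univ.nodup)]
      intro x hx
      obtain ⟨i, -, rfl⟩ := Multiset.mem_map.1 hx
      exact (mem_roots hp.ne_zero).2 (h i)
    have h2 := (Multiset.prod_X_sub_C_dvd_iff_le_roots hp.ne_zero _).2 h1
    rwa [Multiset.map_map] at h2
  have hm : (∏ i, (X - C (r i))).Monic := monic_prod_of_monic _ _ fun i _ => monic_X_sub_C _
  refine eq_of_monic_of_dvd_of_natDegree_le hm hp hdvd ?_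
  rw [hd, natDegree_prod_of_monic _ _ fun i _ => monic_X_sub_C _]
  simp

lemma exists_mem_eq_of_prod_eq_zero {R ι : Type*} [CommRing R] [IsDomain R] {s : Finset ι}
    {r : ι → R} {x : R} (h : (∏ i ∈ s, (X - C (r i))).eval x = 0) : ∃ i ∈ s, x = r i := by
  rw [eval_prod, Finset.prod_eq_zero_iff] at h
  obtain ⟨i, hi, h⟩ := h
  exact ⟨i, hi, by simpa [sub_eq_zero] using h⟩

variable {R E L : Type*} [CommRing R] [IsDomain R] [IsIntegrallyClosed R] [Field E] [Algebra R E]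
  [IsFractionRing R E] [Field L] [Algebra E L] [FiniteDimensional E L]

/-- An integral primitive element together with the equations describing its conjugates. -/
lemma exists_integral_model [IsGalois E L] [Algebra R L] [IsScalarTower R E L] [Fintype (L ≃ₐ[E] L)] :
    ∃ (θ : L) (f : R[X]) (h : (L ≃ₐ[E] L) → R[X]) (d : (L ≃ₐ[E] L) → R),
      f.Monic ∧ (∀ g, d g ≠ 0) ∧ Function.Injective (fun g : L ≃ₐ[E] L => g θ) ∧
      IntermediateField.adjoin E {θ} = ⊤ ∧ f.map (algebraMap R E) = minpoly E θ ∧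
      f.map (algebraMap R L) = ∏ g : L ≃ₐ[E] L, (X - C (g θ)) ∧
      (∀ g, algebraMap R L (d g) * g θ = (h g).eval₂ (algebraMap R L) θ) ∧
      ∀ (g : L ≃ₐ[E] L) (m : R[X]), m.Monic → m.eval₂ (algebraMap R L) (g θ) = 0 →
        Fintype.card (L ≃ₐ[E] L) ≤ m.natDegree := by
  obtain ⟨θ₀, hθ₀⟩ := Field.exists_primitive_element E L
  obtain ⟨⟨b, hb⟩, hinteg⟩ := IsIntegral.exists_multiple_integral_of_isLocalization
    (nonZeroDivisors R) θ₀ (Algebra.IsIntegral.isIntegral (R := E) θ₀)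
  have hbE : algebraMap R E b ≠ 0 := IsFractionRing.to_map_ne_zero_of_mem_nonZeroDivisors hb
  set θ : L := b • θ₀ with hθdef
  have hθ : θ = algebraMap E L (algebraMap R E b) * θ₀ := by
    rw [hθdef, Algebra.smul_def, IsScalarTower.algebraMap_apply R E L]
  replace hinteg : IsIntegral R θ := hinteg
  clear_value θ
  have htop : IntermediateField.adjoin E {θ} = ⊤ := by
    rw [← hθ₀]
    apply le_antisymm
    · rw [hθ₀]; exact le_top
    · rw [IntermediateField.adjoin_simple_le_iff]
      have : θ₀ = algebraMap E L (algebraMap R E b)⁻¹ * θ := by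
        rw [hθ, ← mul_assoc, ← map_mul, inv_mul_cancel₀ hbE, map_one, one_mul]
      rw [this]
      exact mul_mem (IntermediateField.algebraMap_mem _ _)
        (IntermediateField.mem_adjoin_simple_self E θ)
  have hmin : (minpoly R θ).map (algebraMap R E) = minpoly E θ :=
    (minpoly.isIntegrallyClosed_eq_field_fractions' E hinteg).symm
  have hmon : (minpoly R θ).Monic := minpoly.monic hinteg
  have hinj : Function.Injective (fun g : L ≃ₐ[E] L => g θ) := fun g g' hg => by
    have hle : IntermediateField.adjoin E {θ} ≤
        (AlgHom.equalizer (g : L →ₐ[E] L) (g' : L →ₐ[E] L)).toIntermediateField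
          fun x hx => by
            rw [AlgHom.mem_equalizer] at hx ⊢
            rw [map_inv₀, map_inv₀, hx] :=
      IntermediateField.adjoin_simple_le_iff.2 hg
    ext x
    exact hle (htop ▸ IntermediateField.mem_top : x ∈ IntermediateField.adjoin E {θ})
  have hcard : Fintype.card (L ≃ₐ[E] L) = (minpoly E θ).natDegree := by
    rw [← Nat.card_eq_fintype_card, IsGalois.card_aut_eq_finrank,
      ← IntermediateField.adjoin.finrank (Algebra.IsIntegral.isIntegral θ), htop,
      IntermediateField.finrank_top']
  have hmap : ∀ p : R[X], p.map (algebraMap R L) = (p.map (algebraMap R E)).map (algebraMap E L) :=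
    fun p => by rw [Polynomial.map_map, ← IsScalarTower.algebraMap_eq]
  have hrel : ∀ g : L ≃ₐ[E] L, ∃ (h : R[X]) (d : R), d ≠ 0 ∧
      algebraMap R L d * g θ = h.eval₂ (algebraMap R L) θ := fun g => by
    have : g θ ∈ IntermediateField.adjoin E {θ} := htop ▸ IntermediateField.mem_top
    rw [← IntermediateField.mem_toSubalgebra,
      IntermediateField.adjoin_simple_toSubalgebra_of_isAlgebraic
        (Algebra.IsAlgebraic.isAlgebraic θ), Algebra.adjoin_singleton_eq_range_aeval] at this
    obtain ⟨q, hq⟩ := this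
    obtain ⟨b, hb, hbq⟩ := IsLocalization.integerNormalization_spec (nonZeroDivisors R) q
    refine ⟨IsLocalization.integerNormalization (nonZeroDivisors R) q, b, nonZeroDivisors.ne_zero hb, ?_⟩
    rw [← eval_map, hmap, hbq, eval_map, ← aeval_def]
    rw [← algebraMap_smul E b q, map_smul (aeval θ), Algebra.smul_def,
      ← IsScalarTower.algebraMap_apply R E L]
    exact congrArg _ hq.symm
  choose h d hd hrel using hrel
  refine ⟨θ, minpoly R θ, h, d, hmon, hd, hinj, htop, hmin, ?_, hrel, fun g m hm hm0 => ?_⟩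
  · refine eq_prod_X_sub_C_of_injective (hmon.map _) ?_ hinj fun g => ?_
    · rw [hcard, ← hmin, hmon.natDegree_map, hmon.natDegree_map]
    · rw [hmap, hmin, eval_map, ← aeval_def]
      exact (minpoly.aeval E θ ▸ aeval_algHom_apply (g : L →ₐ[E] L) θ (minpoly E θ)).trans
        (map_zero _)
  · have h1 : minpoly E (g θ) = minpoly E θ := minpoly.algEquiv_eq g θ
    rw [hcard, ← h1, ← hm.natDegree_map (algebraMap R E)]
    refine natDegree_le_natDegree (minpoly.min E (g θ) (hm.map _) ?_)
    rw [aeval_def, eval₂_map, ← IsScalarTower.algebraMap_eq, hm0]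

end Roots

section Descent

open Polynomial IntermediateField

lemma exists_ringHom_of_splits {R E L Ω : Type*} [CommRing R] [IsDomain R] [Field E] [Algebra R E]
    [IsFractionRing R E] [Field L] [Algebra E L] [FiniteDimensional E L] [Algebra R L]
    [IsScalarTower R E L] [Field Ω]
    (i : R →+* Ω) (hi : Function.Injective i) {θ : L} {f : R[X]} (hθ : E⟮θ⟯ = ⊤)
    (hmin : f.map (algebraMap R E) = minpoly E θ) (hs : (f.map i).Splits) :
    ∃ ψ : L →+* Ω, ∀ r, ψ (algebraMap R L r) = i r := by
  let : Algebra E Ω := (IsFractionRing.lift (K := E) hi).toAlgebra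
  have hcomp : ∀ r, algebraMap E Ω (algebraMap R E r) = i r := IsFractionRing.lift_algebraMap hi
  have hs' : ((minpoly E θ).map (algebraMap E Ω)).Splits := by
    rw [← hmin, Polynomial.map_map]
    convert hs using 2
    exact RingHom.ext hcomp
  obtain ⟨ψ⟩ := nonempty_algHom_of_adjoin_splits (F := E) (E := L) (K := Ω) (S := {θ})
    (fun s hsθ => by
      obtain rfl : s = θ := hsθ
      exact ⟨Algebra.IsIntegral.isIntegral _, hs'⟩) hθ
  exact ⟨ψ, fun r => by
    rw [IsScalarTower.algebraMap_apply R E L, RingHom.coe_coe, ψ.commutes, hcomp]⟩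

lemma eq_prod_of_dvd_prod_X_sub_C {Ω ι : Type*} [Field Ω] [Fintype ι] {r : ι → Ω}
    (hr : Function.Injective r) {m : Polynomial Ω} (hm : m.Monic) (h : m ∣ ∏ i, (X - C (r i))) :
    ∃ S : Finset ι, m = ∏ i ∈ S, (X - C (r i)) := by
  classical
  have hs : (∏ i, (X - C (r i))).Splits := Splits.prod fun i _ => Splits.X_sub_C _
  have h0 : ∏ i, (X - C (r i)) ≠ 0 := Finset.prod_ne_zero_iff.2 fun i _ => X_sub_C_ne_zero _
  have hroots : (∏ i, (X - C (r i))).roots = Finset.univ.val.map r := by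
    rw [roots_prod _ _ h0]
    simp
  have hle : m.roots ≤ Finset.univ.val.map r := hroots ▸ roots.le_of_dvd h0 h
  refine ⟨Finset.univ.filter fun i => r i ∈ m.roots, ?_⟩
  have hnd : (Finset.univ.val.map r).Nodup := Finset.univ.nodup.map hr
  have hmr : m.roots = (Finset.univ.filter fun i => r i ∈ m.roots).val.map r := by
    refine (Multiset.Nodup.ext (Multiset.nodup_of_le hle hnd) (Multiset.Nodup.map hr
      (Finset.nodup _))).2 fun x => ⟨fun hx => ?_, fun hx => ?_⟩
    · obtain ⟨i, -, rfl⟩ := Multiset.mem_map.1 (Multiset.mem_of_le hle hx)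
      exact Multiset.mem_map.2 ⟨i, by simpa using hx, rfl⟩
    · obtain ⟨i, hi, rfl⟩ := Multiset.mem_map.1 hx
      exact (Finset.mem_filter.1 hi).2
  conv_lhs => rw [(hs.of_dvd h0 h).eq_prod_roots_of_monic hm, hmr, Multiset.map_map]
  rfl

variable {R E P Ω : Type*} [CommRing R] [IsDomain R] [IsIntegrallyClosed R] [Field E] [Algebra R E]
  [IsFractionRing R E] [CommRing P] [Field Ω] [Algebra E Ω]

/-- A system of roots indexed by a finite group, with compatible relations and no proper partial
product defined over the base, gives a Galois extension with that group. -/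
lemma exists_galois_of_roots {G : Type*} [Group G] [Fintype G] (i : R →+* P) (j : P →+* Ω)
    (hj : Function.Injective j)
    (hij : ∀ r, j (i r) = algebraMap E Ω (algebraMap R E r)) {Θ : G → P}
    (hΘ : Function.Injective Θ) {f : R[X]} (hf : f.map i = ∏ g, (X - C (Θ g)))
    {h : G → R[X]} {d : G → R} (hd : ∀ g, d g ≠ 0)
    (hrel : ∀ g g', i (d g') * Θ (g * g') = (h g').eval₂ i (Θ g))
    (hS : ∀ S : Finset G, S.Nonempty → S ≠ Finset.univ → ∀ m : R[X],
      m.map i ≠ ∏ g ∈ S, (X - C (Θ g))) :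
    ∃ N : IntermediateField E Ω, FiniteDimensional E N ∧ IsGalois E N ∧
      Nonempty ((N ≃ₐ[E] N) ≃* G) := by
  classical
  let : Algebra R Ω := ((algebraMap E Ω).comp (algebraMap R E)).toAlgebra
  have : IsScalarTower R E Ω := IsScalarTower.of_algebraMap_eq fun _ => rfl
  have hji : j.comp i = algebraMap R Ω := RingHom.ext hij
  have hi : Function.Injective i := fun a b hab => by
    have := congrArg j hab
    rw [hij, hij] at this
    exact IsFractionRing.injective R E ((algebraMap E Ω).injective this)
  have : FaithfulSMul R Ω := (faithfulSMul_iff_algebraMap_injective R Ω).2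
    (hji ▸ hj.comp hi)
  have hprod : (∏ g, (X - C (Θ g))).map j = ∏ g, (X - C (j (Θ g))) := by
    simp [Polynomial.map_prod]
  have hfm : f.Monic := by
    refine monic_of_injective hi ?_
    rw [hf]
    exact monic_prod_of_monic _ _ fun g _ => monic_X_sub_C _
  have hfΩ : f.map (algebraMap R Ω) = ∏ g, (X - C (j (Θ g))) := by
    rw [← hji, ← Polynomial.map_map, hf, hprod]
  have hjΘ : Function.Injective fun g => j (Θ g) := hj.comp hΘ
  set θ : Ω := j (Θ 1) with hθ
  have hfθ : ∀ g, f.eval₂ (algebraMap R Ω) (j (Θ g)) = 0 := fun g => by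
    rw [← eval_map, hfΩ, eval_prod]
    exact Finset.prod_eq_zero (Finset.mem_univ g) (by simp)
  have hinteg : IsIntegral R θ := ⟨f, hfm, hfθ 1⟩
  have hintegE : IsIntegral E θ := hinteg.tower_top
  have hmin : minpoly E θ = (minpoly R θ).map (algebraMap R E) :=
    minpoly.isIntegrallyClosed_eq_field_fractions' E hinteg
  have hminΩ : (minpoly E θ).map (algebraMap E Ω) = ∏ g, (X - C (j (Θ g))) := by
    have hmm : (minpoly E θ).map (algebraMap E Ω) = (minpoly R θ).map (algebraMap R Ω) := by
      rw [hmin, Polynomial.map_map, ← IsScalarTower.algebraMap_eq]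
    have hdvd : (minpoly R θ).map (algebraMap R Ω) ∣ ∏ g, (X - C (j (Θ g))) := by
      rw [← hfΩ]
      exact Polynomial.map_dvd _ (minpoly.isIntegrallyClosed_dvd hinteg (hfθ 1))
    obtain ⟨S, hSm⟩ := eq_prod_of_dvd_prod_X_sub_C hjΘ ((minpoly.monic hinteg).map _) hdvd
    have hroot : (∏ g ∈ S, (X - C (j (Θ g)))).eval θ = 0 := by
      rw [← hSm, eval_map, ← aeval_def, minpoly.aeval]
    obtain ⟨g, hg, -⟩ := exists_mem_eq_of_prod_eq_zero hroot
    rw [hmm, hSm]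
    by_cases hu : S = Finset.univ
    · rw [hu]
    · refine absurd (Polynomial.map_injective j hj ?_) (hS S ⟨g, hg⟩ hu (minpoly R θ))
      rw [Polynomial.map_map, hji, hSm]
      simp [Polynomial.map_prod]
  have hdeg : (minpoly E θ).natDegree = Fintype.card G := by
    rw [← natDegree_map (algebraMap E Ω), hminΩ,
      natDegree_prod_of_monic _ _ fun g _ => monic_X_sub_C _]
    simp
  have hfd : FiniteDimensional E E⟮θ⟯ := adjoin.finiteDimensional hintegE
  have hrelΩ : ∀ g g', algebraMap R Ω (d g') * j (Θ (g * g')) =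
      (h g').eval₂ (algebraMap R Ω) (j (Θ g)) := fun g g' => by
    rw [← hji, RingHom.comp_apply, ← map_mul, hrel, hom_eval₂]
  have hdΩ : ∀ g, algebraMap R Ω (d g) ≠ 0 := fun g => by
    rw [← hji]
    exact fun h0 => hd g (hi (hj (by simpa using h0)))
  have hmem : ∀ g, j (Θ g) ∈ E⟮θ⟯ := fun g => by
    have h1 : j (Θ g) = (algebraMap R Ω (d g))⁻¹ * (h g).eval₂ (algebraMap R Ω) θ := by
      rw [eq_inv_mul_iff_mul_eq₀ (hdΩ g), ← hrelΩ 1 g, one_mul]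
    have halg : ∀ r, algebraMap R Ω r ∈ E⟮θ⟯ := fun r => IntermediateField.algebraMap_mem _ (algebraMap R E r)
    rw [h1, eval₂_eq_sum_range]
    exact mul_mem (inv_mem (halg _)) (sum_mem fun k _ => mul_mem (halg _)
      (pow_mem (mem_adjoin_simple_self E θ) k))
  let x : G → E⟮θ⟯ := fun g => ⟨j (Θ g), hmem g⟩
  have hx1 : x 1 = AdjoinSimple.gen E θ := rfl
  have hxroot : ∀ g, aeval (x g) (minpoly E θ) = 0 := fun g => by
    refine (algebraMap E⟮θ⟯ Ω).injective ?_
    rw [← aeval_algebraMap_apply, aeval_def, ← eval_map, hminΩ, eval_prod, map_zero]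
    exact Finset.prod_eq_zero (Finset.mem_univ g) (by simp [x])
  have hext : ∀ τ τ' : E⟮θ⟯ →ₐ[E] E⟮θ⟯, τ (x 1) = τ' (x 1) → τ = τ' := fun τ τ' hτ =>
    algHom_ext_of_eq_adjoin E rfl (fun y hy => by
      obtain rfl : y = θ := hy
      exact hτ)
  have hex : ∀ g, ∃ τ : E⟮θ⟯ →ₐ[E] E⟮θ⟯, τ (x 1) = x g := fun g =>
    ⟨(algHomAdjoinIntegralEquiv E hintegE).symm ⟨x g, (mem_aroots).2
      ⟨minpoly.ne_zero hintegE, hxroot g⟩⟩,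
      algHomAdjoinIntegralEquiv_symm_apply_gen E hintegE _⟩
  choose τ hτ using hex
  have hτx : ∀ g g', τ g (x g') = x (g * g') := fun g g' => by
    have hxrel : ∀ g, algebraMap E E⟮θ⟯ (algebraMap R E (d g')) * x (g * g') =
        aeval (x g) ((h g').map (algebraMap R E)) := fun g => by
      refine (algebraMap E⟮θ⟯ Ω).injective ?_
      rw [← aeval_algebraMap_apply, map_mul, aeval_def, eval₂_map]
      exact hrelΩ g g'
    have h1 := congrArg (τ g) (hxrel 1)
    rw [map_mul, AlgHom.commutes, one_mul, ← aeval_algHom_apply, hτ, ← hxrel g] at h1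
    refine mul_left_cancel₀ (fun h0 => hdΩ g' ?_) h1
    exact congrArg (algebraMap E⟮θ⟯ Ω) h0
  let e : G →* (E⟮θ⟯ ≃ₐ[E] E⟮θ⟯) :=
    { toFun := fun g => AlgEquiv.ofBijective (τ g) (Algebra.IsAlgebraic.algHom_bijective _)
      map_one' := AlgEquiv.coe_toAlgHom_injective (hext _ _ (hτ 1))
      map_mul' := fun g g' => AlgEquiv.coe_toAlgHom_injective (hext _ _ (by
        change τ (g * g') (x 1) = τ g (τ g' (x 1))
        rw [hτ, hτ, hτx])) }
  have hinj : Function.Injective e := fun g g' hgg => by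
    have h1 : τ g (x 1) = τ g' (x 1) := congrArg (fun s : E⟮θ⟯ ≃ₐ[E] E⟮θ⟯ => s (x 1)) hgg
    rw [hτ, hτ] at h1
    exact hjΘ (congrArg Subtype.val h1)
  have hsurj : Function.Surjective e := fun s => by
    have h1 : (∏ g, (X - C (j (Θ g)))).eval (algebraMap E⟮θ⟯ Ω (s (x 1))) = 0 := by
      rw [← hminΩ, eval_map, ← aeval_def, aeval_algebraMap_apply]
      have := aeval_algHom_apply (s : E⟮θ⟯ →ₐ[E] E⟮θ⟯) (x 1) (minpoly E θ)
      rw [hxroot, map_zero] at this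
      exact (congrArg _ this).trans (map_zero _)
    obtain ⟨g, -, hg⟩ := exists_mem_eq_of_prod_eq_zero h1
    refine ⟨g, AlgEquiv.coe_toAlgHom_injective (hext _ _ ?_)⟩
    exact (hτ g).trans (Subtype.ext hg.symm)
  let e' : G ≃* (E⟮θ⟯ ≃ₐ[E] E⟮θ⟯) := MulEquiv.ofBijective e ⟨hinj, hsurj⟩
  refine ⟨E⟮θ⟯, hfd, IsGalois.of_card_aut_eq_finrank _ _ ?_, ⟨e'.symm⟩⟩
  rw [adjoin.finrank hintegE, hdeg, ← Nat.card_eq_fintype_card, Nat.card_congr e'.toEquiv]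

end Descent

section Specialization

open Polynomial

lemma coeff_coeff_swap {R : Type*} [CommRing R] (p : R[X][X]) (m n : ℕ) :
    ((Bivariate.swap p).coeff m).coeff n = (p.coeff n).coeff m := by
  classical
  induction p using Polynomial.induction_on' with
  | add p q hp hq => simp [hp, hq]
  | monomial a q =>
    induction q using Polynomial.induction_on' with
    | add p q hp hq => rw [map_add, map_add]; simp only [coeff_add, hp, hq]
    | monomial b r =>
      rw [Bivariate.swap_monomial_monomial]
      simp only [coeff_monomial]
      split_ifs <;> simp_all [coeff_monomial]

lemma coeff_coeff_eq_zero_of_dvd {R : Type*} [CommRing R] [IsDomain R] {p q : R[X][X]} (hq : q ≠ 0)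
    (h : p ∣ q) {D : ℕ} (hD : ∀ i n, D < n → (q.coeff i).coeff n = 0) (i n : ℕ) (hn : D < n) :
    (p.coeff i).coeff n = 0 := by
  have h1 : (Bivariate.swap q).natDegree ≤ D := natDegree_le_iff_coeff_eq_zero.2 fun n hn => by
    ext i
    rw [coeff_coeff_swap, hD i n hn, coeff_zero]
  have h2 : (Bivariate.swap p).natDegree ≤ (Bivariate.swap q).natDegree :=
    natDegree_le_of_dvd (map_dvd (Bivariate.swap (R := R)).toRingHom h)
      fun h0 => hq ((Bivariate.swap (R := R)).injective (h0.trans (map_zero _).symm))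
  rw [← coeff_coeff_swap, coeff_eq_zero_of_natDegree_lt ((h2.trans h1).trans_lt hn), coeff_zero]

lemma exists_algHom_ne_zero {C A : Type*} [Field C] [IsAlgClosed C] [CommRing A] [IsDomain A]
    [Algebra C A] [Algebra.FiniteType C A] {γ : A} (hγ : γ ≠ 0) : ∃ σ : A →ₐ[C] C, σ γ ≠ 0 := by
  let B := Localization.Away γ
  have : Algebra.FiniteType A B := IsLocalization.finiteType_of_monoid_fg (Submonoid.powers γ) B
  have : Algebra.FiniteType C B := Algebra.FiniteType.trans (S := A) ‹_› ‹_›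
  have : Nontrivial B :=
    (IsLocalization.injective B (powers_le_nonZeroDivisors_of_noZeroDivisors hγ)).nontrivial
  obtain ⟨I, hI⟩ := Ideal.exists_maximal B
  let _ : Field (B ⧸ I) := Ideal.Quotient.field I
  have : Module.Finite C (B ⧸ I) := finite_of_finite_type_of_isJacobsonRing C (B ⧸ I)
  have hb : Function.Bijective (algebraMap C (B ⧸ I)) :=
    IsAlgClosed.algebraMap_bijective_of_isIntegral
  let e : C ≃ₐ[C] (B ⧸ I) := AlgEquiv.ofBijective (Algebra.ofId C _) hb
  let σ : A →ₐ[C] C := (e.symm : (B ⧸ I) →ₐ[C] C).comp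
    ((Ideal.Quotient.mkₐ C I).comp (IsScalarTower.toAlgHom C A B))
  have hu : IsUnit (algebraMap A B γ) := IsLocalization.Away.algebraMap_isUnit γ
  exact ⟨σ, ((hu.map (Ideal.Quotient.mkₐ C I)).map (e.symm : (B ⧸ I) →ₐ[C] C)).ne_zero⟩

/-- The inclusion of polynomials into power series. -/
noncomputable abbrev ofPoly {A : Type*} [CommRing A] : A[X] →+* PowerSeries A :=
  Polynomial.coeToPowerSeries.ringHom

lemma ofPoly_injective (A : Type*) [CommRing A] : Function.Injective (ofPoly (A := A)) := Polynomial.coe_injective A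

lemma powerSeries_map_ofPoly {A B : Type*} [CommRing A] [CommRing B] (σ : A →+* B) (p : A[X]) :
    PowerSeries.map σ (ofPoly p) = ofPoly (p.map σ) := by
  ext n
  simp

lemma exists_coeff_coeff_ne_zero {A : Type*} [CommRing A] {P : Polynomial (PowerSeries A)}
    (hP : ∀ m : A[X][X], m.map ofPoly ≠ P) (D : ℕ) :
    ∃ i n, D < n ∧ PowerSeries.coeff n (P.coeff i) ≠ 0 := by
  by_contra! h
  have : P ∈ lifts (ofPoly : A[X] →+* PowerSeries A) := (lifts_iff_coeff_lifts _).2 fun i => by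
    refine ⟨PowerSeries.trunc (D + 1) (P.coeff i), ?_⟩
    ext n
    rw [coeToPowerSeries.ringHom_apply, Polynomial.coeff_coe, PowerSeries.coeff_trunc]
    split_ifs with hn
    · rfl
    · exact (h i n (by omega)).symm
  obtain ⟨m, hm⟩ := (mem_lifts _).1 this
  exact hP m hm

/-- Specialization of a system of roots over a finitely generated domain to the ground field. -/
lemma exists_galois_of_finiteType {C : Type u} {A G : Type*} [Field C] [IsAlgClosed C] [CommRing A]
    [IsDomain A] [Algebra C A] [Algebra.FiniteType C A] [Group G] [Fintype G]
    {Θ : G → PowerSeries A} (hΘ : Function.Injective Θ) {f : A[X][X]}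
    (hf : f.map ofPoly = ∏ g, (X - Polynomial.C (Θ g)))
    {h : G → A[X][X]} {d : G → A[X]} (hd : ∀ g, d g ≠ 0)
    (hrel : ∀ g g', ofPoly (d g') * Θ (g * g') = (h g').eval₂ ofPoly (Θ g))
    (hS : ∀ S : Finset G, S.Nonempty → S ≠ Finset.univ → ∀ m : A[X][X],
      m.map ofPoly ≠ ∏ g ∈ S, (X - Polynomial.C (Θ g))) :
    ∃ (N : Type u) (_ : Field N) (_ : Algebra (RatFunc C) N), FiniteDimensional (RatFunc C) N ∧
      IsGalois (RatFunc C) N ∧ Nonempty ((N ≃ₐ[RatFunc C] N) ≃* G) := by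
  classical
  have hinj : Function.Injective ((HahnSeries.ofPowerSeries ℤ C).comp ofPoly) :=
    HahnSeries.ofPowerSeries_injective.comp (ofPoly_injective C)
  let : Algebra (RatFunc C) (LaurentSeries C) :=
    (IsFractionRing.lift (A := C[X]) (K := RatFunc C) hinj).toAlgebra
  let D := (Bivariate.swap f).natDegree
  have hD : ∀ i n, D < n → (f.coeff i).coeff n = 0 := fun i n hn => by
    rw [← coeff_coeff_swap, coeff_eq_zero_of_natDegree_lt hn, coeff_zero]
  have hbad : ∀ S : Finset G, ∃ γ : A, γ ≠ 0 ∧ (S.Nonempty → S ≠ Finset.univ → ∃ i n, D < n ∧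
      PowerSeries.coeff n ((∏ g ∈ S, (X - Polynomial.C (Θ g))).coeff i) = γ) := fun S => by
    by_cases hSS : S.Nonempty ∧ S ≠ Finset.univ
    · obtain ⟨i, n, hn, h0⟩ := exists_coeff_coeff_ne_zero (hS S hSS.1 hSS.2) D
      exact ⟨_, h0, fun _ _ => ⟨i, n, hn, rfl⟩⟩
    · exact ⟨1, one_ne_zero, fun h1 h2 => absurd ⟨h1, h2⟩ hSS⟩
  choose γ hγ0 hγ using hbad
  have hdist : ∀ p : G × G, ∃ δ : A, δ ≠ 0 ∧ (p.1 ≠ p.2 → ∃ n,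
      PowerSeries.coeff n (Θ p.1 - Θ p.2) = δ) := fun p => by
    by_cases hp : p.1 = p.2
    · exact ⟨1, one_ne_zero, fun h => absurd hp h⟩
    · have h0 : Θ p.1 - Θ p.2 ≠ 0 := sub_ne_zero.2 fun h => hp (hΘ h)
      obtain ⟨n, hn⟩ := (PowerSeries.exists_coeff_ne_zero_iff_ne_zero).2 h0
      exact ⟨_, hn, fun _ => ⟨n, rfl⟩⟩
  choose δ hδ0 hδ using hdist
  obtain ⟨σ, hσ⟩ := exists_algHom_ne_zero (C := C)
    (γ := (∏ S, γ S) * (∏ p, δ p) * ∏ g, (d g).leadingCoeff)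
    (mul_ne_zero (mul_ne_zero (Finset.prod_ne_zero_iff.2 fun S _ => hγ0 S)
      (Finset.prod_ne_zero_iff.2 fun p _ => hδ0 p))
      (Finset.prod_ne_zero_iff.2 fun g _ => leadingCoeff_ne_zero.2 (hd g)))
  simp only [map_mul, map_prod, mul_ne_zero_iff, Finset.prod_ne_zero_iff, Finset.mem_univ,
    forall_const] at hσ
  obtain ⟨⟨hσγ, hσδ⟩, hσd⟩ := hσ
  let s : A →+* C := σ
  let Θ' : G → PowerSeries C := fun g => PowerSeries.map s (Θ g)
  have hcomp : (PowerSeries.map s).comp ofPoly = ofPoly.comp (mapRingHom s) :=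
    RingHom.ext fun p => powerSeries_map_ofPoly s p
  have hprod : ∀ S : Finset G, (∏ g ∈ S, (X - Polynomial.C (Θ g))).map (PowerSeries.map s) =
      ∏ g ∈ S, (X - Polynomial.C (Θ' g)) := fun S => by simp [Polynomial.map_prod, Θ']
  have hf' : (f.map (mapRingHom s)).map ofPoly = ∏ g, (X - Polynomial.C (Θ' g)) := by
    rw [Polynomial.map_map, ← hcomp, ← Polynomial.map_map, hf, hprod]
  have hmonic : ∀ S : Finset G, (∏ g ∈ S, (X - Polynomial.C (Θ' g))).Monic := fun S =>
    monic_prod_of_monic _ _ fun g _ => monic_X_sub_C _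
  refine Exists.elim (exists_galois_of_roots (R := C[X]) (E := RatFunc C) (Ω := LaurentSeries C) (Θ := Θ')
    (f := f.map (mapRingHom s)) (h := fun g => (h g).map (mapRingHom s))
    (d := fun g => (d g).map s) ofPoly (HahnSeries.ofPowerSeries ℤ C)
    HahnSeries.ofPowerSeries_injective
    (fun r => (IsFractionRing.lift_algebraMap hinj r).symm) ?inj hf' ?ne ?rel ?irr)
    fun N hN => ⟨N, inferInstance, inferInstance, hN⟩
  case inj =>
    intro g g' hgg
    by_contra hne
    obtain ⟨n, hn⟩ := hδ (g, g') hne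
    refine hσδ (g, g') ?_
    rw [← hn]
    change s _ = 0
    rw [← PowerSeries.coeff_map, map_sub]
    exact (congrArg _ (sub_eq_zero.2 hgg)).trans (map_zero _)
  case ne =>
    intro g h0
    refine hσd g ?_
    have := congrArg (fun p => p.coeff (d g).natDegree) h0
    change s _ = 0
    simpa using this
  case rel =>
    intro g g'
    change ofPoly ((d g').map s) * PowerSeries.map s _ = _
    rw [← powerSeries_map_ofPoly, ← map_mul, hrel, hom_eval₂, hcomp, eval₂_map]
  case irr =>
    intro S hS1 hS2 m hm
    obtain ⟨i, n, hn, hin⟩ := hγ S hS1 hS2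
    have hmm : m.Monic := monic_of_injective (ofPoly_injective C) (hm ▸ hmonic S)
    have hdvd : m ∣ f.map (mapRingHom s) := by
      rw [← map_dvd_map ofPoly (ofPoly_injective C) hmm, hm, hf']
      exact Finset.prod_dvd_prod_of_subset _ _ _ (Finset.subset_univ S)
    have hfm : f.map (mapRingHom s) ≠ 0 :=
      (monic_of_injective (ofPoly_injective C) (hf' ▸ hmonic Finset.univ)).ne_zero
    refine hσγ S ?_
    have h0 := coeff_coeff_eq_zero_of_dvd hfm hdvd (D := D) (fun i n hn => by
      rw [Polynomial.coeff_map, coe_mapRingHom, Polynomial.coeff_map, hD i n hn, map_zero]) i n hn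
    rw [← hin]
    change s _ = 0
    rw [← PowerSeries.coeff_map, ← Polynomial.coeff_map, hprod, ← hm, Polynomial.coeff_map,
      coeToPowerSeries.ringHom_apply, Polynomial.coeff_coe, h0]

end Specialization

section SplitPoint

open Polynomial IntermediateField

variable {C : Type u} [Field C] {K : Type*} [Field K] [Algebra C K]

lemma exists_finset_lifts (p : K[X][X]) : ∃ T : Finset K, ∀ A : Subalgebra C K,
    (T : Set K) ⊆ A → ∃ q : A[X][X], q.map (mapRingHom (algebraMap A K)) = p := by
  classical
  refine ⟨p.coeffs.biUnion fun r => r.coeffs, fun A hA => ?_⟩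
  refine (mem_lifts _).1 ((lifts_iff_coeff_lifts _).2 fun i => ?_)
  refine (mem_lifts (f := algebraMap A K) _).1 ((lifts_iff_coeff_lifts _).2 fun n => ?_)
  by_cases h0 : (p.coeff i).coeff n = 0
  · exact ⟨0, by rw [h0, map_zero]⟩
  · have hi : p.coeff i ≠ 0 := fun h => h0 (by rw [h, coeff_zero])
    exact ⟨⟨(p.coeff i).coeff n, hA (Finset.mem_coe.2 (Finset.mem_biUnion.2
      ⟨_, coeff_mem_coeffs hi, coeff_mem_coeffs h0⟩))⟩, rfl⟩

lemma exists_finset_lifts_family {ι : Type*} [Finite ι] (p : ι → K[X][X]) :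
    ∃ T : Finset K, ∀ A : Subalgebra C K, (T : Set K) ⊆ A →
      ∃ q : ι → A[X][X], ∀ i, (q i).map (mapRingHom (algebraMap A K)) = p i := by
  classical
  have := Fintype.ofFinite ι
  choose T hT using fun i => exists_finset_lifts (C := C) (p i)
  refine ⟨Finset.univ.biUnion T, fun A hA => ?_⟩
  choose q hq using fun i => hT i A (fun x hx => hA (Finset.mem_coe.2 (Finset.mem_biUnion.2
    ⟨i, Finset.mem_univ i, hx⟩)))
  exact ⟨q, hq⟩

/-- Lifting of a separated split fibre to power series roots. -/
lemma exists_powerSeries_roots {A ι : Type*} [CommRing A] [IsDomain A] [Fintype ι]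
    {P : Polynomial (PowerSeries A)} (hP : P.Monic) {e : ι → A} (he : Function.Injective e)
    (heu : ∀ i j, i ≠ j → IsUnit (e i - e j))
    (hPe : P.map PowerSeries.constantCoeff = ∏ i, (X - Polynomial.C (e i))) :
    ∃ Θ : ι → PowerSeries A, P = ∏ i, (X - Polynomial.C (Θ i)) := by
  classical
  have h1 : ∀ i, ∃ y, P.eval y = 0 ∧ PowerSeries.constantCoeff y = e i := fun i => by
    refine exists_powerSeries_root hP (e i) ?_ ?_
    · rw [hPe, eval_prod]
      exact Finset.prod_eq_zero (Finset.mem_univ i) (by simp)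
    · have h2 := Lagrange.eval_nodal_derivative_eval_node_eq (s := Finset.univ) (v := e)
        (Finset.mem_univ i)
      rw [Lagrange.nodal] at h2
      rw [hPe, h2, Lagrange.eval_nodal]
      refine IsUnit.prod_iff.2 fun j hj => heu i j (Finset.ne_of_mem_erase hj).symm
  choose Θ hΘ0 hΘ using h1
  refine ⟨Θ, eq_prod_X_sub_C_of_injective hP ?_ (fun i j hij => he ?_) hΘ0⟩
  · rw [← hP.natDegree_map PowerSeries.constantCoeff, hPe,
      natDegree_prod_of_monic _ _ fun g _ => monic_X_sub_C _]
    simp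
  · rw [← hΘ, ← hΘ, hij]

variable {E L : Type*} [Field E] [Algebra K[X] E] [IsFractionRing K[X] E] [Field L] [Algebra E L]
  [FiniteDimensional E L] [Algebra K[X] L] [IsScalarTower K[X] E L] [Fintype (L ≃ₐ[E] L)]

lemma exists_galois_of_split_point [IsAlgClosed C] {θ : L} {f : K[X][X]}
    {h : (L ≃ₐ[E] L) → K[X][X]} {d : (L ≃ₐ[E] L) → K[X]} (hfm : f.Monic) (hd : ∀ g, d g ≠ 0)
    (hinj : Function.Injective (fun g : L ≃ₐ[E] L => g θ)) (hθ : E⟮θ⟯ = ⊤)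
    (hmin : f.map (algebraMap K[X] E) = minpoly E θ)
    (hf : f.map (algebraMap K[X] L) = ∏ g : L ≃ₐ[E] L, (X - Polynomial.C (g θ)))
    (hrel : ∀ g, algebraMap K[X] L (d g) * g θ = (h g).eval₂ (algebraMap K[X] L) θ)
    (hirr : ∀ (g : L ≃ₐ[E] L) (m : K[X][X]), m.Monic → m.eval₂ (algebraMap K[X] L) (g θ) = 0 →
      Fintype.card (L ≃ₐ[E] L) ≤ m.natDegree)
    (a : K) {e : (L ≃ₐ[E] L) → K} (he : Function.Injective e)
    (hfe : f.map (evalRingHom a) = ∏ g, (X - Polynomial.C (e g))) :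
    ∃ (N : Type u) (_ : Field N) (_ : Algebra (RatFunc C) N), FiniteDimensional (RatFunc C) N ∧
      IsGalois (RatFunc C) N ∧ Nonempty ((N ≃ₐ[RatFunc C] N) ≃* (L ≃ₐ[E] L)) := by
  classical
  let T : K[X] →+* K[X] := (taylorEquiv a : K[X] →ₐ[K] K[X])
  let T' : K[X] →+* K[X] := (taylorEquiv (-a) : K[X] →ₐ[K] K[X])
  have hTT' : T.comp T' = RingHom.id _ := RingHom.ext fun p => by
    change taylor a (taylor (-a) p) = p
    rw [taylor_taylor, add_neg_cancel, taylor_zero]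
  obtain ⟨T₁, hT₁⟩ := exists_finset_lifts (C := C) (f.map T)
  obtain ⟨T₂, hT₂⟩ := exists_finset_lifts_family (C := C) fun g => (h g).map T
  obtain ⟨T₃, hT₃⟩ := exists_finset_lifts_family (C := C) fun g => Polynomial.C (T (d g))
  let A : Subalgebra C K := Algebra.adjoin C
    ((T₁ ∪ T₂ ∪ T₃ ∪ Finset.univ.image e ∪
      (Finset.univ : Finset ((L ≃ₐ[E] L) × (L ≃ₐ[E] L))).image fun p => (e p.1 - e p.2)⁻¹ :
        Finset K) : Set K)
  have hsub : ∀ x : K, (x ∈ T₁ ∨ x ∈ T₂ ∨ x ∈ T₃ ∨ (∃ g, e g = x) ∨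
      ∃ g g', (e g - e g')⁻¹ = x) → x ∈ A := fun x hx => Algebra.subset_adjoin (by
    simp only [Finset.coe_union, Finset.coe_image, Set.mem_union, Finset.mem_coe, Set.mem_image,
      Finset.coe_univ, Set.mem_univ, true_and, Prod.exists]
    tauto)
  have : Algebra.FiniteType C A := A.fg_iff_finiteType.1 (Subalgebra.fg_adjoin_finset _)
  obtain ⟨fA, hfA⟩ := hT₁ A fun x hx => hsub x (Or.inl hx)
  obtain ⟨hA, hhA⟩ := hT₂ A fun x hx => hsub x (Or.inr (Or.inl hx))
  obtain ⟨dA', hdA'⟩ := hT₃ A fun x hx => hsub x (Or.inr (Or.inr (Or.inl hx)))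
  let s : A →+* K := algebraMap A K
  have hs : Function.Injective s := Subtype.val_injective
  have hms : Function.Injective (mapRingHom s) := Polynomial.map_injective s hs
  let dA : (L ≃ₐ[E] L) → A[X] := fun g => (dA' g).coeff 0
  have hdA : ∀ g, (dA g).map s = T (d g) := fun g => by
    have := congrArg (fun p => p.coeff 0) (hdA' g)
    simpa [coeff_map] using this
  let eA : (L ≃ₐ[E] L) → A := fun g => ⟨e g, hsub _ (Or.inr (Or.inr (Or.inr (Or.inl ⟨g, rfl⟩))))⟩
  have heA : Function.Injective eA := fun g g' hgg => he (congrArg Subtype.val hgg)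
  have heu : ∀ g g', g ≠ g' → IsUnit (eA g - eA g') := fun g g' hne => by
    refine IsUnit.of_mul_eq_one ⟨(e g - e g')⁻¹, hsub _ (Or.inr (Or.inr (Or.inr (Or.inr
      ⟨g, g', rfl⟩))))⟩ (Subtype.ext ?_)
    exact mul_inv_cancel₀ (sub_ne_zero.2 fun h => hne (he h))
  have hfAm : fA.Monic := monic_of_injective hms (hfA ▸ hfm.map T)
  have hPe : (fA.map ofPoly).map PowerSeries.constantCoeff =
      ∏ g, (X - Polynomial.C (eA g)) := by
    refine Polynomial.map_injective s hs ?_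
    have h1 : (s.comp PowerSeries.constantCoeff).comp ofPoly =
        ((evalRingHom 0).comp (mapRingHom s) : A[X] →+* K) := RingHom.ext fun p => by
      simp [← coeff_zero_eq_eval_zero]
    have h2 : (evalRingHom 0).comp T = evalRingHom a := RingHom.ext fun p => by
      change (taylor a p).eval 0 = p.eval a
      rw [taylor_eval, zero_add]
    rw [Polynomial.map_map, Polynomial.map_map, h1, ← Polynomial.map_map, hfA, Polynomial.map_map,
      h2, hfe, Polynomial.map_prod]
    simp [eA, s]
  obtain ⟨Θ₀, hΘ₀⟩ := exists_powerSeries_roots (hfAm.map ofPoly) heA heu hPe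
  let ι : PowerSeries K →+* LaurentSeries K := HahnSeries.ofPowerSeries ℤ K
  have hι : Function.Injective ι := HahnSeries.ofPowerSeries_injective
  let κ : PowerSeries A →+* LaurentSeries K := ι.comp (PowerSeries.map s)
  have hκ : Function.Injective κ := hι.comp (PowerSeries.map_injective s hs)
  let i : K[X] →+* LaurentSeries K := (ι.comp ofPoly).comp T
  have hi : Function.Injective i := (hι.comp (ofPoly_injective K)).comp (taylorEquiv a).injective
  have hκo : κ.comp ofPoly = (ι.comp ofPoly).comp (mapRingHom s) := RingHom.ext fun p =>
    congrArg ι (powerSeries_map_ofPoly s p)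
  have hlift : ∀ {pA : A[X][X]} {p : K[X][X]}, pA.map (mapRingHom s) = p.map T →
      pA.map (κ.comp ofPoly) = p.map i := fun {pA p} hp => by
    rw [hκo, ← Polynomial.map_map, hp, Polynomial.map_map]
  have hfi : f.map i = ∏ g, (X - Polynomial.C (κ (Θ₀ g))) := by
    rw [← hlift hfA, ← Polynomial.map_map, hΘ₀, Polynomial.map_prod]
    simp
  obtain ⟨ψ, hψ⟩ := exists_ringHom_of_splits i hi hθ hmin
    (hfi ▸ Splits.prod fun g _ => Splits.X_sub_C _)
  have hψc : ψ.comp (algebraMap K[X] L) = i := RingHom.ext hψ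
  have hroot : ∀ g : L ≃ₐ[E] L, ∃ x, κ x = ψ (g θ) ∧ (fA.map ofPoly).eval x = 0 := fun g => by
    have h1 : (f.map i).eval (ψ (g θ)) = 0 := by
      rw [← hψc, ← Polynomial.map_map, eval_map_apply, hf, eval_prod,
        Finset.prod_eq_zero (Finset.mem_univ g) (by simp), map_zero]
    rw [hfi] at h1
    obtain ⟨g', -, hg'⟩ := exists_mem_eq_of_prod_eq_zero h1
    refine ⟨Θ₀ g', hg'.symm, ?_⟩
    rw [hΘ₀, eval_prod]
    exact Finset.prod_eq_zero (Finset.mem_univ g') (by simp)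
  choose Θ hΘ hΘr using hroot
  have hΘinj : Function.Injective Θ := fun g g' hgg => hinj (ψ.injective (by
    rw [← hΘ, ← hΘ, hgg]))
  have hfix : ∀ (g : L ≃ₐ[E] L), (g : L →+* L).comp (algebraMap K[X] L) = algebraMap K[X] L :=
    fun g => RingHom.ext fun r => by
      rw [IsScalarTower.algebraMap_eq K[X] E L]
      exact g.commutes _
  refine exists_galois_of_finiteType (C := C) (A := A) (Θ := Θ) hΘinj (f := fA) (h := hA) (d := dA)
    ?_ (fun g h0 => hd g ?_) (fun g g' => hκ ?_) (fun S hS1 hS2 m hm => ?_)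
  · refine eq_prod_X_sub_C_of_injective (hfAm.map _) ?_ hΘinj hΘr
    rw [hΘ₀, natDegree_prod_of_monic _ _ fun g _ => monic_X_sub_C _]
    simp
  · refine (taylorEquiv a).injective ?_
    have := hdA g
    rw [h0, Polynomial.map_zero] at this
    exact this.symm.trans (map_zero (taylorEquiv a)).symm
  · have h1 : κ (ofPoly (dA g')) = ψ (algebraMap K[X] L (d g')) := by
      rw [hψ, ← RingHom.comp_apply, hκo, RingHom.comp_apply, coe_mapRingHom, hdA]
      rfl
    have h2 := congrArg (fun y => ψ (g y)) (hrel g')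
    have h3 : g (algebraMap K[X] L (d g')) = algebraMap K[X] L (d g') :=
      congrArg (fun q => q (d g')) (hfix g)
    rw [hom_eval₂, hΘ, ← eval_map, hlift (hhA g'), map_mul, h1, hΘ, eval_map]
    simp only [map_mul, h3] at h2
    refine h2.trans ?_
    change ((ψ.comp (g : L →+* L)) (eval₂ (algebraMap K[X] L) θ (h g'))) = _
    rw [hom_eval₂, RingHom.comp_assoc, hfix, hψc]
    rfl
  · obtain ⟨g, hg⟩ := hS1
    have hmm : m.Monic := monic_of_injective (ofPoly_injective A) (hm ▸
      monic_prod_of_monic _ _ fun g _ => monic_X_sub_C _)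
    have hmd : m.natDegree = S.card := by
      rw [← hmm.natDegree_map ofPoly, hm,
        natDegree_prod_of_monic _ _ fun g _ => monic_X_sub_C _]
      simp
    let m' : K[X][X] := (m.map (mapRingHom s)).map T'
    have hm'm : m'.Monic := (hmm.map _).map _
    have hm'T : m.map (mapRingHom s) = m'.map T := by
      rw [Polynomial.map_map, hTT', Polynomial.map_id]
    have h1 : m'.eval₂ (algebraMap K[X] L) (g θ) = 0 := by
      refine ψ.injective ?_
      rw [hom_eval₂, hψc, ← eval_map, ← hlift hm'T, ← hΘ, ← Polynomial.map_map, eval_map_apply, hm,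
        eval_prod, Finset.prod_eq_zero hg (by simp), map_zero, map_zero]
    have h2 := hirr g m' hm'm h1
    rw [(hmm.map _).natDegree_map, hmm.natDegree_map, hmd] at h2
    exact hS2 (Finset.eq_univ_of_card _ (le_antisymm (Finset.card_le_univ S) h2))

end SplitPoint

section RatFunc

open Polynomial IntermediateField

variable {C : Type u} [Field C]

/-- Every finite subset of `good C` has a common point of regularity. -/
lemma exists_forall_mem_coeffIn [Infinite C] {ι : Type*} [Finite ι] (q : ι → good C) :
    ∃ a : C, ∀ i, (q i : LaurentSeries (RatFunc C)) ∈ coeffIn (regAt a) := by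
  obtain ⟨a, ha⟩ := (Set.finite_iUnion fun i => mem_good.1 (q i).2).exists_notMem
  simp only [Set.mem_iUnion, not_exists] at ha
  exact ⟨a, fun i => not_not.1 (ha i)⟩

theorem exists_galois_ratFunc [IsAlgClosed C] (G : Type*) [Group G] [Finite G] :
    ∃ (N : Type u) (_ : Field N) (_ : Algebra (RatFunc C) N), FiniteDimensional (RatFunc C) N ∧
      IsGalois (RatFunc C) N ∧ Nonempty ((N ≃ₐ[RatFunc C] N) ≃* G) := by
  classical
  obtain ⟨L, hfd, hgal, ⟨ε⟩⟩ := exists_galois_good (C := C) G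
  have : Infinite C := IsAlgClosed.instInfinite
  let K := LaurentSeries C
  let : Algebra K[X] L := ((algebraMap (RatFunc K) L).comp (algebraMap K[X] (RatFunc K))).toAlgebra
  have : @IsScalarTower K[X] (RatFunc K) L Algebra.toSMul Algebra.toSMul Algebra.toSMul :=
    IsScalarTower.of_algebraMap_eq fun _ => rfl
  have := Fintype.ofFinite (L ≃ₐ[RatFunc K] L)
  obtain ⟨θ, f, h, d, hfm, hd, hinj, hθ, hmin, hf, hrel, hirr⟩ :=
    exists_integral_model (R := K[X]) (E := RatFunc K) (L := L)
  obtain ⟨a, ha⟩ := exists_forall_mem_coeffIn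
    (Sum.elim (fun g : L ≃ₐ[RatFunc K] L => (g θ : good C))
      fun p : (L ≃ₐ[RatFunc K] L) × (L ≃ₐ[RatFunc K] L) => ((p.1 θ - p.2 θ)⁻¹ : L))
  let O := coeffIn (regAt a)
  let y : (L ≃ₐ[RatFunc K] L) → O := fun g => ⟨_, ha (Sum.inl g)⟩
  let pe : K[X] →+* O := (polyEmb C).codRestrict O (polyEmb_mem_coeffIn_regAt a)
  have hO : Function.Injective O.subtype := Subtype.val_injective
  have hfO : f.map pe = ∏ g, (X - Polynomial.C (y g)) := by
    refine Polynomial.map_injective O.subtype hO ?_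
    let j : L →+* LaurentSeries (RatFunc C) := (good C).subtype.comp (algebraMap L (good C))
    have hj : j.comp (algebraMap K[X] L) = O.subtype.comp pe := RingHom.ext fun p =>
      congrArg Subtype.val (algebraMap_good p)
    rw [Polynomial.map_map, ← hj, ← Polynomial.map_map, hf, Polynomial.map_prod,
      Polynomial.map_prod]
    simp [y, j]
  have hres : (resAt a).comp pe = evalRingHom (HahnSeries.C a : K) :=
    RingHom.ext fun p => resAt_polyEmb a p
  have hfe : f.map (evalRingHom (HahnSeries.C a : K)) =
      ∏ g, (X - Polynomial.C (resAt a (y g))) := by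
    rw [← hres, ← Polynomial.map_map, hfO, Polynomial.map_prod]
    simp
  have he : Function.Injective fun g => resAt a (y g) := fun g g' hgg => by
    by_contra hne
    have h0 : g θ - g' θ ≠ 0 := sub_ne_zero.2 fun h => hne (hinj h)
    have h1 : (y g - y g') * (⟨_, ha (Sum.inr (g, g'))⟩ : O) = 1 := Subtype.ext (by
      change ((((g θ - g' θ) * (g θ - g' θ)⁻¹ : L) : good C) : LaurentSeries (RatFunc C)) = 1
      rw [mul_inv_cancel₀ h0]
      rfl)
    have h2 := congrArg (resAt a) h1
    rw [map_mul, map_sub, map_one, sub_eq_zero.2 hgg, zero_mul] at h2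
    exact zero_ne_one h2
  obtain ⟨N, hN₁, hN₂, hN₃, hN₄, ⟨ε'⟩⟩ := exists_galois_of_split_point (C := C) hfm hd hinj hθ hmin hf
    hrel hirr (HahnSeries.C a : K) he hfe
  exact ⟨N, hN₁, hN₂, hN₃, hN₄, ⟨ε'.trans ε⟩⟩

end RatFunc

section BaseChange

open scoped TensorProduct

variable {Z F N : Type*} [Field Z] [DivisionRing F] [Algebra Z F] [Field N] [Algebra Z N]

/-- The base change of a division ring by a finite field extension is a division ring as soon as
it has no zero divisors. -/
noncomputable abbrev divisionRingTensor [FiniteDimensional Z N] [NoZeroDivisors (F ⊗[Z] N)] :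
    DivisionRing (F ⊗[Z] N) :=
  DivisionRing.ofIsUnitOrEqZero fun m => by
    by_cases hm : m = 0
    · exact Or.inr hm
    left
    have key : ∀ m : F ⊗[Z] N, m ≠ 0 → ∃ m', m' * m = 1 := fun m hm => by
      have hinj : Function.Injective (LinearMap.mulRight F m) := by
        rw [injective_iff_map_eq_zero]
        intro a ha
        exact (mul_eq_zero.1 ha).resolve_right hm
      exact (LinearMap.injective_iff_surjective.1 hinj) 1
    obtain ⟨m', h'⟩ := key m hm
    obtain ⟨m'', h''⟩ := key m' (left_ne_zero_of_mul_eq_one h')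
    have : m'' = m := by
      calc m'' = m'' * (m' * m) := by rw [h', mul_one]
        _ = m := by rw [← mul_assoc, h'', one_mul]
    subst this
    exact ⟨⟨_, m', h'', h'⟩, rfl⟩

/-- An element of `F ⊗ N` fixed by the Galois group of `N` lies in `F`. -/
lemma exists_eq_tmul_one_of_fixed [FiniteDimensional Z N] [IsGalois Z N] (m : F ⊗[Z] N)
    (hm : ∀ g : N ≃ₐ[Z] N, Algebra.TensorProduct.map (AlgHom.id Z F) (g : N →ₐ[Z] N) m = m) :
    ∃ a : F, a ⊗ₜ[Z] (1 : N) = m := by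
  classical
  let b := Module.Basis.ofVectorSpace Z F
  have hcoord : ∀ (g : N ≃ₐ[Z] N) (m : F ⊗[Z] N) i,
      TensorProduct.equivFinsuppOfBasisLeft b
        (Algebra.TensorProduct.map (AlgHom.id Z F) (g : N →ₐ[Z] N) m) i =
      g (TensorProduct.equivFinsuppOfBasisLeft b m i) := by
    intro g m i
    induction m with
    | zero => simp
    | add x y hx hy => simp only [map_add, Finsupp.add_apply, hx, hy]
    | tmul x y =>
      simp
  have hfix : ∀ i, ∃ z : Z, algebraMap Z N z = TensorProduct.equivFinsuppOfBasisLeft b m i := by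
    intro i
    refine IsGalois.mem_range_algebraMap_iff_fixed _ |>.2 fun g => ?_
    rw [← hcoord, hm]
  choose z hz using hfix
  have hm' := (TensorProduct.equivFinsuppOfBasisLeft b (M := F) (N := N)).symm_apply_apply m
  rw [TensorProduct.equivFinsuppOfBasisLeft_symm_apply] at hm'
  refine ⟨(TensorProduct.equivFinsuppOfBasisLeft b m).sum fun i _ => z i • b i, ?_⟩
  conv_rhs => rw [← hm']
  rw [Finsupp.sum, Finsupp.sum, TensorProduct.sum_tmul]
  refine Finset.sum_congr rfl fun i _ => ?_
  rw [← hz, Algebra.algebraMap_eq_smul_one, TensorProduct.smul_tmul]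

/-- An automorphism of a domain `F ⊗ N` fixing `F` comes from the Galois group of `N`. -/
lemma exists_eq_map_of_fixing [FiniteDimensional Z N] [IsGalois Z N] [NoZeroDivisors (F ⊗[Z] N)]
    (σ : F ⊗[Z] N →+* F ⊗[Z] N) (hσ : ∀ a : F, σ (a ⊗ₜ 1) = a ⊗ₜ 1) :
    ∃ g : N ≃ₐ[Z] N, ∀ m,
      σ m = Algebra.TensorProduct.map (AlgHom.id Z F) (g : N →ₐ[Z] N) m := by
  classical
  have := Fintype.ofFinite (N ≃ₐ[Z] N)
  have : IsDomain (F ⊗[Z] N) := NoZeroDivisors.to_isDomain _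
  let inc : N →ₐ[Z] F ⊗[Z] N := Algebra.TensorProduct.includeRight
  have hcomm : ∀ (n : N) (m : F ⊗[Z] N), Commute (inc n) m := by
    intro n m
    induction m with
    | zero => exact Commute.zero_right _
    | add x y hx hy => exact hx.add_right hy
    | tmul x y => simp [inc, Commute, SemiconjBy, mul_comm]
  obtain ⟨θ, f, -, -, -, -, -, hθ, hmin, hprod, -, -⟩ :=
    exists_integral_model (R := Z) (E := Z) (L := N)
  rw [Algebra.algebraMap_self, Polynomial.map_id] at hmin
  rw [hmin] at hprod
  have hσZ : ∀ z : Z, σ (algebraMap Z _ z) = algebraMap Z _ z := by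
    intro z
    rw [Algebra.TensorProduct.algebraMap_apply]
    exact hσ _
  let σ' : F ⊗[Z] N →ₐ[Z] F ⊗[Z] N := { σ with commutes' := hσZ }
  let y := σ' (inc θ)
  let ev : Polynomial N →+* F ⊗[Z] N :=
    Polynomial.eval₂RingHom' inc.toRingHom y fun n => hcomm n y
  have hev : ev ((minpoly Z θ).map (algebraMap Z N)) = 0 := by
    have h1 : ev ((minpoly Z θ).map (algebraMap Z N)) = Polynomial.aeval y (minpoly Z θ) := by
      rw [Polynomial.aeval_def, ← inc.comp_algebraMap, ← Polynomial.eval₂_map]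
      rfl
    rw [h1, Polynomial.aeval_algHom_apply, Polynomial.aeval_algHom_apply, minpoly.aeval, map_zero,
      map_zero]
  have hg : ∃ g : N ≃ₐ[Z] N, y = inc (g θ) := by
    rw [hprod] at hev
    have hp := RingHom.ker_isPrime ev
    obtain ⟨g, -, hg⟩ := (Ideal.IsPrime.prod_mem_iff (p := RingHom.ker ev)).1 (RingHom.mem_ker.2 hev)
    refine ⟨g, ?_⟩
    rw [RingHom.mem_ker] at hg
    simpa [ev, sub_eq_zero] using hg
  obtain ⟨g, hg⟩ := hg
  refine ⟨g, fun m => ?_⟩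
  have hN : σ'.comp inc = inc.comp (g : N →ₐ[Z] N) := by
    have htop : Algebra.adjoin Z {θ} = ⊤ := by
      rw [← IntermediateField.adjoin_simple_toSubalgebra_of_isAlgebraic
        (Algebra.IsAlgebraic.isAlgebraic θ), hθ, IntermediateField.top_toSubalgebra]
    refine AlgHom.ext_of_adjoin_eq_top htop ?_
    rintro _ rfl
    exact hg
  have hF : ∀ n, σ (inc n) = inc (g n) := fun n => DFunLike.congr_fun hN n
  induction m with
  | zero => simp
  | add x y hx hy => simp only [map_add, hx, hy]
  | tmul x y =>
    have : x ⊗ₜ[Z] y = x ⊗ₜ 1 * inc y := by simp [inc]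
    rw [this, map_mul, hσ, hF]
    simp [inc]

end BaseChange

section Galois

open scoped TensorProduct

theorem exists_isGaloisExt_of_noZeroDivisors {Z : Type*} {F N : Type u} [Field Z] [DivisionRing F]
    [Algebra Z F] [Field N] [Algebra Z N] [FiniteDimensional Z N] [IsGalois Z N]
    [NoZeroDivisors (F ⊗[Z] N)] :
    ∃ (M : Type u) (_ : DivisionRing M) (ι : F →+* M), Function.Injective ι ∧ IsGaloisExt ι ∧
      Nonempty (fixingAut ι ≃* (N ≃ₐ[Z] N)) := by
  let inst : DivisionRing (F ⊗[Z] N) := divisionRingTensor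
  let ι : F →+* F ⊗[Z] N := Algebra.TensorProduct.includeLeftRingHom
  let τ : (N ≃ₐ[Z] N) →* RingAut (F ⊗[Z] N) :=
    { toFun := fun g => (Algebra.TensorProduct.congr (AlgEquiv.refl : F ≃ₐ[Z] F) g).toRingEquiv
      map_one' := by
        ext m
        induction m with
        | zero => simp
        | add x y hx hy => simp only [map_add, hx, hy]
        | tmul x y => rfl
      map_mul' := fun g h => by
        ext m
        induction m with
        | zero => simp
        | add x y hx hy => simp only [map_add, hx, hy]
        | tmul x y => rfl }
  have hτ : ∀ g, τ g ∈ fixingAut ι := by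
    intro g a
    change a ⊗ₜ[Z] g 1 = a ⊗ₜ 1
    rw [map_one]
  have hτm : ∀ g m, τ g m = Algebra.TensorProduct.map (AlgHom.id Z F) (g : N →ₐ[Z] N) m :=
    fun _ _ => rfl
  refine ⟨F ⊗[Z] N, inst, ι, ι.injective, fun m hm => ?_, ⟨MulEquiv.symm ?_⟩⟩
  · obtain ⟨a, ha⟩ := exists_eq_tmul_one_of_fixed m fun g => (hτm g m).symm.trans (hm _ (hτ g))
    exact ⟨a, ha⟩
  · refine MulEquiv.ofBijective (τ.codRestrict (fixingAut ι) hτ) ⟨fun g h hgh => ?_, fun σ => ?_⟩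
    · ext n
      have h1 : τ g = τ h := congrArg Subtype.val hgh
      have h2 : τ g (1 ⊗ₜ n) = τ h (1 ⊗ₜ n) := by rw [h1]
      exact (Algebra.TensorProduct.includeRight : N →ₐ[Z] F ⊗[Z] N).toRingHom.injective h2
    · obtain ⟨g, hg⟩ := exists_eq_map_of_fixing (σ : RingAut (F ⊗[Z] N)).toRingHom σ.2
      exact ⟨g, Subtype.ext (RingEquiv.ext fun m => (hg m).symm)⟩

end Galois

section Lines

open Polynomial

variable {H : Type*} [DivisionRing H]

/-- The constant functions as a ring homomorphism into the ring of polynomial functions. -/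
def constPolyFun (H : Type*) [DivisionRing H] : H →+* polyFunRing H :=
  (Pi.constRingHom H H).codRestrict _ fun c =>
    Subring.subset_closure (Or.inl ⟨c, rfl⟩)

@[simp] lemma constPolyFun_apply (c h : H) : (constPolyFun H c : H → H) h = c := rfl

lemma eval_mul_of_mem_center {t : H} (ht : t ∈ Subring.center H) (p q : H[X]) :
    (p * q).eval t = p.eval t * q.eval t :=
  map_mul (eval₂RingHom' (RingHom.id H) t fun c => Subring.mem_center_iff.1 ht c) p q

/-- A polynomial function restricts to a polynomial in the central parameter of a line. -/
lemma exists_polynomial_on_line (a b : H) (r : polyFunRing H) :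
    ∃ p : H[X], ∀ t ∈ Subring.center H, (r : H → H) (a + t * b) = p.eval t := by
  obtain ⟨r, hr⟩ := r
  induction hr using Subring.closure_induction with
  | mem x hx =>
    obtain ⟨c, rfl⟩ | rfl := hx
    · exact ⟨C c, fun t _ => by simp⟩
    · exact ⟨C a + C b * X, fun t ht => by simp [(Subring.mem_center_iff.1 ht b)]⟩
  | zero => exact ⟨0, fun t _ => by simp⟩
  | one => exact ⟨1, fun t _ => by simp⟩
  | add x y _ _ hx hy =>
    obtain ⟨p, hp⟩ := hx
    obtain ⟨q, hq⟩ := hy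
    exact ⟨p + q, fun t ht => by simpa using congrArg₂ (· + ·) (hp t ht) (hq t ht)⟩
  | neg x _ hx =>
    obtain ⟨p, hp⟩ := hx
    exact ⟨-p, fun t ht => by simpa using congrArg (- ·) (hp t ht)⟩
  | mul x y _ _ hx hy =>
    obtain ⟨p, hp⟩ := hx
    obtain ⟨q, hq⟩ := hy
    exact ⟨p * q, fun t ht => by
      rw [eval_mul_of_mem_center ht]; simpa using congrArg₂ (· * ·) (hp t ht) (hq t ht)⟩

variable {C : Type*} [Field C] [Algebra C H]

lemma algebraMap_mem_center (c : C) : algebraMap C H c ∈ Subring.center H :=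
  Subring.mem_center_iff.2 fun g => (Algebra.commutes c g).symm

/-- Apply a linear functional to the coefficients of a polynomial. -/
noncomputable def mapFunctional (l : H →ₗ[C] C) (p : H[X]) : C[X] :=
  ∑ i ∈ Finset.range (p.natDegree + 1), monomial i (l (p.coeff i))

lemma coeff_mapFunctional (l : H →ₗ[C] C) (p : H[X]) (i : ℕ) :
    (mapFunctional l p).coeff i = l (p.coeff i) := by
  simp only [mapFunctional, finsetSum_coeff, coeff_monomial, Finset.sum_ite_eq',
    Finset.mem_range]
  split_ifs with h
  · rfl
  · rw [coeff_eq_zero_of_natDegree_lt (by lia), map_zero]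

lemma eval_mapFunctional (l : H →ₗ[C] C) (p : H[X]) (c : C) :
    (mapFunctional l p).eval c = l (p.eval (algebraMap C H c)) := by
  rw [mapFunctional, eval_finsetSum, eval_eq_sum_range, map_sum]
  refine Finset.sum_congr rfl fun i _ => ?_
  rw [← map_pow, ← Algebra.commutes, ← Algebra.smul_def, map_smul, eval_monomial, smul_eq_mul,
    mul_comm]

/-- A polynomial over `H` with infinitely many roots in a central subfield vanishes. -/
lemma eq_zero_of_infinite_central_roots {p : H[X]} {S : Set C} (hS : S.Infinite)
    (h : ∀ c ∈ S, p.eval (algebraMap C H c) = 0) : p = 0 := by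
  ext i
  rw [coeff_zero, ← Module.forall_dual_apply_eq_zero_iff C]
  intro l
  have : mapFunctional l p = 0 :=
    eq_zero_of_infinite_isRoot _ (hS.mono fun c hc => by
      rw [Set.mem_ofPred_eq, IsRoot, eval_mapFunctional, h c hc, map_zero])
  rw [← coeff_mapFunctional, this, coeff_zero]

/-- On an affine subspace over an infinite central subfield, the polynomial functions form a
domain. -/
lemma forall_eq_zero_or_of_mul_eq_zero [Infinite C] {T : Set H}
    (hT : ∀ a ∈ T, ∀ b ∈ T, ∀ c : C, a + algebraMap C H c * (b - a) ∈ T) {r s : polyFunRing H}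
    (h : ∀ a ∈ T, (r : H → H) a * (s : H → H) a = 0) :
    (∀ a ∈ T, (r : H → H) a = 0) ∨ ∀ a ∈ T, (s : H → H) a = 0 := by
  by_contra! hcon
  obtain ⟨⟨a, ha, hra⟩, ⟨b, hb, hsb⟩⟩ := hcon
  obtain ⟨p, hp⟩ := exists_polynomial_on_line a (b - a) r
  obtain ⟨q, hq⟩ := exists_polynomial_on_line a (b - a) s
  have hp0 : p ≠ 0 := by
    rintro rfl
    have := hp 0 (Subring.zero_mem _)
    simp_all
  have hq0 : q ≠ 0 := by
    rintro rfl
    have := hq 1 (Subring.one_mem _)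
    simp_all
  refine mul_ne_zero hp0 hq0 (eq_zero_of_infinite_central_roots (C := C) Set.infinite_univ
    fun c _ => ?_)
  rw [eval_mul_of_mem_center (algebraMap_mem_center c),
    ← hp _ (algebraMap_mem_center c), ← hq _ (algebraMap_mem_center c)]
  exact h _ (hT a ha b hb c)

end Lines

section Curve

open Polynomial

variable {C : Type*} [Field C]

/-- A polynomial of smaller degree has only finitely many common zeros with an irreducible plane
curve. -/
lemma eq_zero_of_infinite_common_zeros {f W : C[X][X]}
    (hf : Irreducible (f.map (algebraMap C[X] (RatFunc C))))
    (hW : W.degree < f.degree) {S : Set C} (hS : S.Infinite) (y : C → C)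
    (hfy : ∀ c ∈ S, (f.eval (Polynomial.C (y c))).eval c = 0)
    (hWy : ∀ c ∈ S, (W.eval (Polynomial.C (y c))).eval c = 0) : W = 0 := by
  by_contra hW0
  have hinj : Function.Injective (algebraMap C[X] (RatFunc C)) := IsFractionRing.injective _ _
  have hcop : IsCoprime (f.map (algebraMap C[X] (RatFunc C))) (W.map (algebraMap _ (RatFunc C))) := by
    rw [hf.coprime_iff_not_dvd]
    intro hdvd
    have := degree_le_of_dvd hdvd ((Polynomial.map_ne_zero_iff hinj).2 hW0)
    rw [degree_map_eq_of_injective hinj, degree_map_eq_of_injective hinj] at this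
    exact absurd hW this.not_gt
  obtain ⟨a, b, hab⟩ := hcop
  obtain ⟨d, hd, hd'⟩ := IsLocalization.integerNormalization_spec (nonZeroDivisors C[X]) a
  obtain ⟨e, he, he'⟩ := IsLocalization.integerNormalization_spec (nonZeroDivisors C[X]) b
  set a' := IsLocalization.integerNormalization (nonZeroDivisors C[X]) a
  set b' := IsLocalization.integerNormalization (nonZeroDivisors C[X]) b
  have hrel : Polynomial.C e * a' * f + Polynomial.C d * b' * W = Polynomial.C (d * e) := by
    apply Polynomial.map_injective _ hinj
    simp only [Polynomial.map_add, Polynomial.map_mul, map_C, hd', he', map_mul, Algebra.smul_def,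
      IsScalarTower.algebraMap_apply C[X] (RatFunc C) (RatFunc C)[X], Polynomial.algebraMap_eq]
    linear_combination (Polynomial.C (algebraMap C[X] (RatFunc C) d) *
      Polynomial.C (algebraMap C[X] (RatFunc C) e)) * hab
  have hde : d * e ≠ 0 := mul_ne_zero (nonZeroDivisors.ne_zero hd) (nonZeroDivisors.ne_zero he)
  refine hde (eq_zero_of_infinite_isRoot _ (hS.mono fun c hc => ?_))
  have := congrArg (fun p : C[X][X] => (p.eval (Polynomial.C (y c))).eval c) hrel
  simp only [eval_add, eval_mul, hfy c hc, hWy c hc, mul_zero, add_zero, eval_C] at this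
  rw [Set.mem_ofPred_eq, IsRoot, eval_mul, ← this]

end Curve

section Specialize

open Polynomial

variable {H : Type*} [DivisionRing H] {C : Type*} [Field C] [Algebra C H]

/-- Specialize the variable at a constant from the central subfield. -/
noncomputable def specialize (H : Type*) [DivisionRing H] [Algebra C H] (y : C) :
    (polyFunRing H)[X] →+* polyFunRing H :=
  eval₂RingHom' (RingHom.id _) (constPolyFun H (algebraMap C H y)) fun r =>
    Subtype.ext (funext fun h => (Algebra.commutes y ((r : H → H) h)).symm)

@[simp] lemma specialize_C (y : C) (r : polyFunRing H) : specialize H y (Polynomial.C r) = r :=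
  eval₂_C _ _

@[simp] lemma specialize_X (y : C) :
    specialize H y X = constPolyFun H (algebraMap C H y) :=
  eval₂_X _ _

lemma specialize_apply (y : C) (U : (polyFunRing H)[X]) (h : H) :
    (specialize H y U : H → H) h =
      ∑ i ∈ Finset.range (U.natDegree + 1), algebraMap C H (y ^ i) * (U.coeff i : H → H) h := by
  have h1 : specialize H y U = U.eval (constPolyFun H (algebraMap C H y)) := rfl
  rw [h1, eval_eq_sum_range, AddSubmonoidClass.coe_finsetSum, Finset.sum_apply]
  refine Finset.sum_congr rfl fun i _ => ?_
  rw [Algebra.commutes, map_pow]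
  rfl

/-- Substitute a central polynomial function into a polynomial. -/
noncomputable def substCentral (C : Type*) [Field C] [Algebra C H] (z : polyFunRing H) :
    C[X] →+* polyFunRing H :=
  eval₂RingHom' ((constPolyFun H).comp (algebraMap C H)) z fun c =>
    Subtype.ext (funext fun h => Algebra.commutes c ((z : H → H) h))

@[simp] lemma substCentral_C (z : polyFunRing H) (c : C) :
    substCentral C z (Polynomial.C c) = constPolyFun H (algebraMap C H c) :=
  eval₂_C _ _

@[simp] lemma substCentral_X (z : polyFunRing H) : substCentral C z X = z :=
  eval₂_X _ _

lemma substCentral_apply {z : polyFunRing H}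
    (p : C[X]) {h : H} {c : C} (hc : (z : H → H) h = algebraMap C H c) :
    (substCentral C z p : H → H) h = algebraMap C H (p.eval c) := by
  have : ((Pi.evalRingHom (fun _ => H) h).comp (polyFunRing H).subtype).comp
      (substCentral C z) = (algebraMap C H).comp (evalRingHom c) := by
    refine Polynomial.ringHom_ext (fun a => ?_) ?_
    · simp
    · simp [hc]
  exact DFunLike.congr_fun this p

lemma specialize_map_substCentral_apply {z : polyFunRing H}
    (f : C[X][X]) (y : C) {h : H} {c : C}
    (hc : (z : H → H) h = algebraMap C H c) :
    (specialize H y (f.map (substCentral C z)) : H → H) h =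
      algebraMap C H ((f.eval (Polynomial.C y)).eval c) := by
  have : ((Pi.evalRingHom (fun _ => H) h).comp (polyFunRing H).subtype).comp
      ((specialize H y).comp (mapRingHom (substCentral C z))) =
      (algebraMap C H).comp ((evalRingHom c).comp (evalRingHom (Polynomial.C y))) := by
    refine Polynomial.ringHom_ext (fun a => ?_) ?_
    · simp [substCentral_apply a hc]
    · simp
  exact DFunLike.congr_fun this f

lemma eq_zero_of_infinite_specialize {z : polyFunRing H}
    (hz : ∀ h, (z : H → H) h ∈ Subring.center H)
    (hza : ∀ a b, (z : H → H) (a + b) = (z : H → H) a + (z : H → H) b)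
    (hzs : ∀ t ∈ Subring.center H, ∀ a, (z : H → H) (t * a) = t * (z : H → H) a)
    {e : H} (he : (z : H → H) e = 1) {f : C[X][X]}
    (hf : Irreducible (f.map (algebraMap C[X] (RatFunc C)))) {U : (polyFunRing H)[X]}
    (hU : U.degree < f.degree) {S : Set C} (hS : S.Infinite) (y : C → C)
    (hfy : ∀ c ∈ S, (f.eval (Polynomial.C (y c))).eval c = 0)
    (hUy : ∀ c ∈ S, ∀ h, (z : H → H) h = algebraMap C H c →
      (specialize H (y c) U : H → H) h = 0) : U = 0 := by
  by_contra hU0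
  obtain ⟨i, hi⟩ : ∃ i, U.coeff i ≠ 0 := by
    by_contra! h
    exact hU0 (ext fun i => by rw [h i, coeff_zero])
  obtain ⟨h₀, hh₀⟩ : ∃ h, (U.coeff i : H → H) h ≠ 0 := by
    by_contra! h
    exact hi (Subtype.ext (funext h))
  set s := (z : H → H) h₀
  have hs : s ∈ Subring.center H := hz h₀
  choose p hp using exists_polynomial_on_line (h₀ - s * e) e
  have hp0 : p (U.coeff i) ≠ 0 := by
    intro h0
    have := hp (U.coeff i) s hs
    rw [h0, sub_add_cancel, eval_zero] at this
    exact hh₀ this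
  obtain ⟨j, hj⟩ : ∃ j, (p (U.coeff i)).coeff j ≠ 0 := by
    by_contra! h
    exact hp0 (ext fun i => by rw [h i, coeff_zero])
  obtain ⟨l, hl⟩ : ∃ l : Module.Dual C H, l ((p (U.coeff i)).coeff j) ≠ 0 := by
    by_contra! h
    exact hj ((Module.forall_dual_apply_eq_zero_iff C _).1 h)
  let W : C[X][X] := ∑ i ∈ Finset.range (U.natDegree + 1),
    monomial i (mapFunctional l (p (U.coeff i)))
  have hWc : ∀ i, W.coeff i =
      if i < U.natDegree + 1 then mapFunctional l (p (U.coeff i)) else 0 := by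
    intro i
    simp only [W, finsetSum_coeff, coeff_monomial, Finset.sum_ite_eq', Finset.mem_range]
  have hWd : W.degree < f.degree := by
    refine lt_of_le_of_lt (degree_le_iff_coeff_zero _ _ |>.2 fun i hi => ?_) hU
    rw [hWc, if_neg]
    rw [degree_eq_natDegree hU0, Nat.cast_lt] at hi
    lia
  have hW0 : W ≠ 0 := by
    intro h0
    have h1 := hWc i
    rw [if_pos (Nat.lt_succ_of_le (le_natDegree_of_ne_zero hi)), h0, coeff_zero] at h1
    apply hl
    rw [← coeff_mapFunctional, ← h1, coeff_zero]
  refine hW0 (eq_zero_of_infinite_common_zeros hf hWd hS y hfy fun c hc => ?_)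
  have hzc : (z : H → H) (h₀ - s * e + algebraMap C H c * e) = algebraMap C H c := by
    have h1 : (z : H → H) (h₀ - s * e) + (z : H → H) (s * e) = (z : H → H) h₀ := by
      rw [← hza, sub_add_cancel]
    rw [hzs s hs, he, mul_one, add_eq_right] at h1
    rw [hza, h1, hzs _ (algebraMap_mem_center c), he, mul_one, zero_add]
  have h2 := congrArg l (hUy c hc _ hzc)
  rw [specialize_apply, map_zero, map_sum] at h2
  rw [← h2, eval_finsetSum, eval_finsetSum]
  refine Finset.sum_congr rfl fun i _ => ?_
  rw [hp _ _ (algebraMap_mem_center c), ← Algebra.smul_def, map_smul, eval_monomial, eval_mul,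
    eval_mapFunctional, ← Polynomial.C_pow, eval_C, smul_eq_mul, mul_comm]

/-- Modulo an irreducible plane curve, the polynomials over the ring of polynomial functions form
a domain. -/
lemma eq_zero_or_of_mul_eq_curve_mul [IsAlgClosed C] {z : polyFunRing H}
    (hz : ∀ h, (z : H → H) h ∈ Subring.center H)
    (hza : ∀ a b, (z : H → H) (a + b) = (z : H → H) a + (z : H → H) b)
    (hzs : ∀ t ∈ Subring.center H, ∀ a, (z : H → H) (t * a) = t * (z : H → H) a)
    {e : H} (he : (z : H → H) e = 1) {f : C[X][X]} (hfm : f.Monic)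
    (hf : Irreducible (f.map (algebraMap C[X] (RatFunc C)))) {U V Q : (polyFunRing H)[X]}
    (hU : U.degree < f.degree) (hV : V.degree < f.degree)
    (hUV : U * V = f.map (substCentral C z) * Q) : U = 0 ∨ V = 0 := by
  have : Infinite C := IsAlgClosed.instInfinite
  have hroot : ∀ c : C, ∃ y, (f.eval (Polynomial.C y)).eval c = 0 := by
    intro c
    have hd : (f.map (evalRingHom c)).degree ≠ 0 := by
      rw [hfm.degree_map]
      have := hf.degree_pos
      rw [hfm.degree_map] at this
      exact this.ne'
    obtain ⟨y, hy⟩ := IsAlgClosed.exists_root _ hd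
    refine ⟨y, ?_⟩
    rw [IsRoot, eval_map] at hy
    rw [← hy, ← coe_evalRingHom, eval, hom_eval₂]
    simp
  choose y hy using hroot
  have hor : ∀ c : C, (∀ h ∈ {h | (z : H → H) h = algebraMap C H c},
        (specialize H (y c) U : H → H) h = 0) ∨
      (∀ h ∈ {h | (z : H → H) h = algebraMap C H c}, (specialize H (y c) V : H → H) h = 0) := by
    intro c
    refine forall_eq_zero_or_of_mul_eq_zero (C := C) (fun a ha b hb d => ?_) fun h hh => ?_
    · have h1 : (z : H → H) (b - a) + (z : H → H) a = (z : H → H) b := by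
        rw [← hza, sub_add_cancel]
      rw [Set.mem_ofPred_eq] at ha hb ⊢
      rw [ha, hb, add_eq_right] at h1
      rw [hza, hzs _ (algebraMap_mem_center d), h1, ha, mul_zero, add_zero]
    · have h1 := congrArg (fun P => (specialize H (y c) P : H → H) h) hUV
      simp only [map_mul] at h1
      change (_ : H) * _ = (_ : H) * _ at h1
      rwa [specialize_map_substCentral_apply f (y c) hh, hy, map_zero, zero_mul] at h1
  have hunion : ({c | ∀ h ∈ {h | (z : H → H) h = algebraMap C H c},
        (specialize H (y c) U : H → H) h = 0} ∪
      {c | ∀ h ∈ {h | (z : H → H) h = algebraMap C H c},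
        (specialize H (y c) V : H → H) h = 0} : Set C).Infinite := by
    convert Set.infinite_univ (α := C)
    exact Set.eq_univ_of_forall hor
  obtain hS | hS := Set.infinite_union.1 hunion
  · exact Or.inl (eq_zero_of_infinite_specialize hz hza hzs he hf hU hS y (fun c _ => hy c)
      fun c hc => hc)
  · exact Or.inr (eq_zero_of_infinite_specialize hz hza hzs he hf hV hS y (fun c _ => hy c)
      fun c hc => hc)

end Specialize

section TensorEval

open Polynomial
open scoped TensorProduct

variable {Z F N : Type*} [Field Z] [DivisionRing F] [Algebra Z F] [Field N] [Algebra Z N]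

/-- Evaluation of polynomials over `F` at an element of the second factor of `F ⊗ N`. -/
noncomputable def evalTensor (Z F : Type*) [Field Z] [DivisionRing F] [Algebra Z F] {N : Type*}
    [Field N] [Algebra Z N] (θ : N) : F[X] →+* F ⊗[Z] N :=
  eval₂RingHom' Algebra.TensorProduct.includeLeftRingHom (1 ⊗ₜ θ) fun a => by
    simp [Commute, SemiconjBy]

@[simp] lemma evalTensor_C (θ : N) (a : F) : evalTensor Z F θ (C a) = a ⊗ₜ 1 :=
  eval₂_C _ _

@[simp] lemma evalTensor_X (θ : N) : evalTensor Z F θ X = 1 ⊗ₜ θ :=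
  eval₂_X _ _

lemma evalTensor_map (θ : N) (m : Z[X]) :
    evalTensor Z F θ (m.map (algebraMap Z F)) = 1 ⊗ₜ aeval θ m := by
  have : (evalTensor Z F θ).comp (mapRingHom (algebraMap Z F)) =
      (Algebra.TensorProduct.includeRight : N →ₐ[Z] F ⊗[Z] N).toRingHom.comp
        (aeval θ : Z[X] →ₐ[Z] N).toRingHom := by
    refine Polynomial.ringHom_ext (fun a => ?_) ?_
    · simp [Algebra.algebraMap_eq_smul_one, TensorProduct.smul_tmul]
    · simp
  exact DFunLike.congr_fun this m

lemma evalTensor_eq_sum (pb : PowerBasis Z N) {P : F[X]} (hP : P.degree < pb.dim) :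
    evalTensor Z F pb.gen P =
      ∑ i : Fin pb.dim, P.coeff i • Algebra.TensorProduct.basis F pb.basis i := by
  conv_lhs => rw [P.as_sum_range' pb.dim (by
    by_cases h : P = 0
    · have := pb.dim_pos
      simpa [h]
    · rwa [natDegree_lt_iff_degree_lt h])]
  rw [map_sum, Finset.sum_range]
  refine Finset.sum_congr rfl fun i _ => ?_
  rw [Algebra.TensorProduct.basis_repr_symm_apply', pb.basis_eq_pow, ← C_mul_X_pow_eq_monomial,
    map_mul, map_pow, evalTensor_C, evalTensor_X]
  simp

lemma eq_zero_of_evalTensor_eq_zero (pb : PowerBasis Z N) {P : F[X]} (hP : P.degree < pb.dim)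
    (h : evalTensor Z F pb.gen P = 0) : P = 0 := by
  rw [evalTensor_eq_sum pb hP] at h
  have h0 := Fintype.linearIndependent_iff.1
    (Algebra.TensorProduct.basis F pb.basis).linearIndependent _ h
  ext i
  by_cases hi : i < pb.dim
  · exact h0 ⟨i, hi⟩
  · exact coeff_eq_zero_of_degree_lt (hP.trans_le (Nat.cast_le.2 (not_lt.1 hi)))

lemma exists_evalTensor_eq (pb : PowerBasis Z N) (u : F ⊗[Z] N) :
    ∃ P : F[X], P.degree < pb.dim ∧ evalTensor Z F pb.gen P = u := by
  let b := Algebra.TensorProduct.basis F pb.basis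
  let P : F[X] := ∑ i : Fin pb.dim, C (b.repr u i) * X ^ (i : ℕ)
  have hP : P.degree < pb.dim := degree_sum_fin_lt _
  refine ⟨P, hP, ?_⟩
  rw [map_sum]
  conv_rhs => rw [← b.sum_repr u]
  refine Finset.sum_congr rfl fun i _ => ?_
  rw [Algebra.TensorProduct.basis_repr_symm_apply', pb.basis_eq_pow,
    map_mul, map_pow, evalTensor_C, evalTensor_X]
  simp

end TensorEval

section Denominators

open Polynomial
open scoped TensorProduct

variable {R F : Type*} [Ring R] [DivisionRing F] {φ : R →+* F}

/-- Finitely many elements of a classical right quotient ring have a common denominator. -/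
lemma exists_common_denominator (hφ : IsClassicalRightQuotient φ) (x : ℕ → F) (n : ℕ) :
    ∃ b : R, φ b ≠ 0 ∧ ∀ i < n, ∃ r, φ r = x i * φ b := by
  induction n with
  | zero => exact ⟨1, by simp, by simp⟩
  | succ n ih =>
    obtain ⟨b, hb, h⟩ := ih
    obtain ⟨a', b', hb', h'⟩ := hφ.2 (x n * φ b)
    have hb'' : φ b' ≠ 0 := (map_ne_zero_iff φ hφ.1).2 hb'
    refine ⟨b * b', by rw [map_mul]; exact mul_ne_zero hb hb'', fun i hi => ?_⟩
    rw [map_mul, ← mul_assoc]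
    obtain hi | rfl := Nat.lt_succ_iff_lt_or_eq.1 hi
    · obtain ⟨r, hr⟩ := h i hi
      exact ⟨r * b', by rw [map_mul, hr]⟩
    · exact ⟨a', by rw [h', mul_assoc, inv_mul_cancel₀ hb'', mul_one]⟩

lemma exists_map_eq_mul_C (hφ : IsClassicalRightQuotient φ) (P : F[X]) :
    ∃ (U : R[X]) (b : F), b ≠ 0 ∧ U.map φ = P * C b ∧ U.degree = P.degree := by
  obtain ⟨b, hb, h⟩ := exists_common_denominator hφ P.coeff (P.natDegree + 1)
  choose! r hr using h
  have hU : (∑ i ∈ Finset.range (P.natDegree + 1), monomial i (r i)).map φ = P * C (φ b) := by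
    rw [Polynomial.map_sum]
    conv_rhs => rw [P.as_sum_range, Finset.sum_mul]
    refine Finset.sum_congr rfl fun i hi => ?_
    rw [map_monomial, hr i (Finset.mem_range.1 hi), monomial_mul_C]
  refine ⟨_, φ b, hb, hU, ?_⟩
  rw [← degree_map_eq_of_injective hφ.1, hU, degree_mul, degree_C hb, add_zero]

end Denominators

section Domain

open Polynomial
open scoped TensorProduct

variable {H : Type*} [DivisionRing H] {C : Type*} [Field C] [IsAlgClosed C] [Algebra C H]
  {F : Type*} [DivisionRing F] [Algebra (RatFunc C) F] {N : Type*} [Field N]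
  [Algebra (RatFunc C) N] [FiniteDimensional (RatFunc C) N] [IsGalois (RatFunc C) N]

/-- The base change of the division ring of fractions of the ring of polynomial functions along a
finite Galois extension of a central rational function field generated by a linear form is a
domain. -/
theorem noZeroDivisors_tensor {φ : polyFunRing H →+* F} (hφ : IsClassicalRightQuotient φ)
    {z : polyFunRing H} (hz : ∀ h, (z : H → H) h ∈ Subring.center H)
    (hza : ∀ a b, (z : H → H) (a + b) = (z : H → H) a + (z : H → H) b)
    (hzs : ∀ t ∈ Subring.center H, ∀ a, (z : H → H) (t * a) = t * (z : H → H) a)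
    {e : H} (he : (z : H → H) e = 1)
    (hF : ∀ p : C[X], algebraMap (RatFunc C) F (algebraMap C[X] (RatFunc C) p) =
      φ (substCentral C z p)) : NoZeroDivisors (F ⊗[RatFunc C] N) := by
  have := Fintype.ofFinite (N ≃ₐ[RatFunc C] N)
  let : Algebra C[X] N := ((algebraMap (RatFunc C) N).comp (algebraMap C[X] (RatFunc C))).toAlgebra
  have : @IsScalarTower C[X] (RatFunc C) N Algebra.toSMul Algebra.toSMul Algebra.toSMul :=
    IsScalarTower.of_algebraMap_eq fun _ => rfl
  obtain ⟨θ, f, -, -, hfm, -, -, hθ, hmin, -, -, -⟩ :=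
    exists_integral_model (R := C[X]) (E := RatFunc C) (L := N)
  have hinteg : IsIntegral (RatFunc C) θ := Algebra.IsIntegral.isIntegral θ
  have htop : Algebra.adjoin (RatFunc C) {θ} = ⊤ := by
    rw [← IntermediateField.adjoin_simple_toSubalgebra_of_isAlgebraic
      (Algebra.IsAlgebraic.isAlgebraic θ), hθ, IntermediateField.top_toSubalgebra]
  obtain ⟨pb, hgen, hdim⟩ : ∃ pb : PowerBasis (RatFunc C) N, pb.gen = θ ∧
      pb.dim = (minpoly (RatFunc C) θ).natDegree :=
    ⟨PowerBasis.ofAdjoinEqTop' hinteg htop, PowerBasis.ofAdjoinEqTop'_gen hinteg htop, rfl⟩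
  subst hgen
  have hfirr : Irreducible (f.map (algebraMap C[X] (RatFunc C))) := by
    rw [hmin]
    exact minpoly.irreducible hinteg
  have hfdeg : f.degree = pb.dim := by
    rw [hdim, ← hmin, hfm.natDegree_map, degree_eq_natDegree hfm.ne_zero]
  have hEf : evalTensor (RatFunc C) F pb.gen ((f.map (substCentral C z)).map φ) = 0 := by
    have : (f.map (substCentral C z)).map φ =
        (minpoly (RatFunc C) pb.gen).map (algebraMap (RatFunc C) F) := by
      rw [← hmin, Polynomial.map_map, Polynomial.map_map]
      congr 1
      exact RingHom.ext fun p => (hF p).symm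
    rw [this, evalTensor_map, minpoly.aeval, TensorProduct.tmul_zero]
  refine ⟨fun {u v} huv => ?_⟩
  obtain ⟨P, hPd, rfl⟩ := exists_evalTensor_eq pb u
  obtain ⟨U, b, hb, hU, hUd⟩ := exists_map_eq_mul_C hφ P
  obtain ⟨P', hPd', hP'⟩ :=
    exists_evalTensor_eq pb (evalTensor (RatFunc C) F pb.gen (Polynomial.C b⁻¹) * v)
  obtain ⟨V, b', hb', hV, hVd⟩ := exists_map_eq_mul_C hφ P'
  have hbb : evalTensor (RatFunc C) F pb.gen (Polynomial.C b) *
      evalTensor (RatFunc C) F pb.gen (Polynomial.C b⁻¹) = 1 := by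
    rw [← map_mul, ← Polynomial.C_mul, mul_inv_cancel₀ hb, Polynomial.C_1, map_one]
  have hEUV : evalTensor (RatFunc C) F pb.gen ((U * V).map φ) = 0 := by
    rw [Polynomial.map_mul, hU, hV, map_mul, map_mul, map_mul, hP']
    calc _ = evalTensor (RatFunc C) F pb.gen P *
          (evalTensor (RatFunc C) F pb.gen (Polynomial.C b) *
            evalTensor (RatFunc C) F pb.gen (Polynomial.C b⁻¹)) * v *
          evalTensor (RatFunc C) F pb.gen (Polynomial.C b') := by simp only [mul_assoc]
      _ = 0 := by rw [hbb, mul_one, huv, zero_mul]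
  have hmonic : (f.map (substCentral C z)).Monic := hfm.map _
  have hUV : U * V = f.map (substCentral C z) * (U * V /ₘ f.map (substCentral C z)) := by
    conv_lhs => rw [← modByMonic_add_div (U * V) (f.map (substCentral C z))]
    rw [add_eq_right]
    have hdeg : (U * V %ₘ f.map (substCentral C z)).degree < pb.dim := by
      rw [← hfdeg, ← hfm.degree_map (substCentral C z)]
      exact degree_modByMonic_lt _ hmonic
    have h0 : (U * V %ₘ f.map (substCentral C z)).map φ = 0 := by
      refine eq_zero_of_evalTensor_eq_zero pb (degree_map_le.trans_lt hdeg) ?_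
      have h1 := congrArg (fun Q => evalTensor (RatFunc C) F pb.gen (Q.map φ))
        (modByMonic_add_div (U * V) (f.map (substCentral C z)))
      simp only [Polynomial.map_add, map_add, hEUV] at h1
      rwa [Polynomial.map_mul, map_mul, hEf, zero_mul, add_zero] at h1
    exact (Polynomial.map_eq_zero_iff hφ.1).1 h0
  obtain h | h := eq_zero_or_of_mul_eq_curve_mul hz hza hzs he hfm hfirr
    (by rw [hUd, hfdeg]; exact hPd) (by rw [hVd, hfdeg]; exact hPd') hUV
  · left
    rw [h, degree_zero, eq_comm, degree_eq_bot] at hUd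
    rw [hUd, map_zero]
  · right
    rw [h, degree_zero, eq_comm, degree_eq_bot] at hVd
    rw [hVd, map_zero] at hP'
    calc v = evalTensor (RatFunc C) F pb.gen (Polynomial.C b) *
          (evalTensor (RatFunc C) F pb.gen (Polynomial.C b⁻¹) * v) := by
            rw [← mul_assoc, hbb, one_mul]
      _ = 0 := by rw [← hP', mul_zero]

end Domain

section LinearForm

variable {H : Type*} [DivisionRing H]

/-- The algebra of operators on a division ring generated by left and right multiplications. -/
noncomputable def multiplicationAlgebra (H : Type*) [DivisionRing H] :
    Subalgebra (Subring.center H) (Module.End (Subring.center H) H) :=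
  Algebra.adjoin (Subring.center H)
    (Set.range (LinearMap.mulLeft (Subring.center H)) ∪
      Set.range (LinearMap.mulRight (Subring.center H)))

lemma mulLeft_mem_multiplicationAlgebra (a : H) :
    LinearMap.mulLeft (Subring.center H) a ∈ multiplicationAlgebra H :=
  Algebra.subset_adjoin (Or.inl ⟨a, rfl⟩)

lemma mulRight_mem_multiplicationAlgebra (a : H) :
    LinearMap.mulRight (Subring.center H) a ∈ multiplicationAlgebra H :=
  Algebra.subset_adjoin (Or.inr ⟨a, rfl⟩)

instance : IsSimpleModule (multiplicationAlgebra H) H :=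
  isSimpleModule_iff_toSpanSingleton_surjective.2 ⟨inferInstance, fun m hm n =>
    ⟨⟨_, mulLeft_mem_multiplicationAlgebra (n * m⁻¹)⟩, by
      change n * m⁻¹ * m = n
      rw [mul_assoc, inv_mul_cancel₀ hm, mul_one]⟩⟩

/-- Every operator linear over the center is generated by multiplications. -/
lemma mem_multiplicationAlgebra [FiniteDimensional (Subring.center H) H]
    (f : Module.End (Subring.center H) H) : f ∈ multiplicationAlgebra H := by
  classical
  have hcomm : ∀ (g : Module.End (multiplicationAlgebra H) H) (x : H), f (g x) = g (f x) := by
    intro g x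
    have hl : ∀ y, g y = y * g 1 := fun y => by
      have := g.map_smul ⟨_, mulLeft_mem_multiplicationAlgebra y⟩ 1
      change g (y * 1) = y * g 1 at this
      rwa [mul_one] at this
    have hr : ∀ y, g y = g 1 * y := fun y => by
      have := g.map_smul ⟨_, mulRight_mem_multiplicationAlgebra y⟩ 1
      change g (1 * y) = g 1 * y at this
      rwa [one_mul] at this
    have hc : g 1 ∈ Subring.center H := Subring.mem_center_iff.2 fun y => (hl y).symm.trans (hr y)
    rw [hr x, hr (f x)]
    exact f.map_smul ⟨g 1, hc⟩ x
  let f' : Module.End (Module.End (multiplicationAlgebra H) H) H :=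
    { toFun := f, map_add' := f.map_add, map_smul' := hcomm }
  let b := Module.finBasis (Subring.center H) H
  obtain ⟨⟨r, hr⟩, h⟩ := jacobson_density (R := multiplicationAlgebra H) (M := H) f' (Finset.univ.image b)
  have : f = r := b.ext fun i => h _ (Finset.mem_image_of_mem _ (Finset.mem_univ i))
  rwa [this]

/-- Every operator linear over the center is a polynomial function. -/
lemma mem_polyFunRing_of_linear [FiniteDimensional (Subring.center H) H]
    (f : Module.End (Subring.center H) H) : (f : H → H) ∈ polyFunRing H := by
  have hconst : ∀ c : H, Function.const H c ∈ polyFunRing H :=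
    fun c => Subring.subset_closure (Or.inl ⟨c, rfl⟩)
  have hgen : ∀ g ∈ Set.range (LinearMap.mulLeft (Subring.center H) : H → _) ∪
      Set.range (LinearMap.mulRight (Subring.center H)), ∀ r ∈ polyFunRing H,
      (g ∘ r : H → H) ∈ polyFunRing H := by
    rintro _ (⟨a, rfl⟩ | ⟨a, rfl⟩) r hr
    · exact mul_mem (hconst a) hr
    · exact mul_mem hr (hconst a)
  have key : ∀ r ∈ polyFunRing H, (f ∘ r : H → H) ∈ polyFunRing H := by
    have hf := mem_multiplicationAlgebra f
    induction hf using Algebra.adjoin_induction with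
    | mem g hg => exact hgen g hg
    | algebraMap t => exact fun r hr => mul_mem (hconst t) hr
    | add g g' _ _ hg hg' => exact fun r hr => add_mem (hg r hr) (hg' r hr)
    | mul g g' _ _ hg hg' => exact fun r hr => hg _ (hg' r hr)
  exact key id (Subring.subset_closure (Or.inr rfl))

lemma exists_linearForm_polyFun [FiniteDimensional (Subring.center H) H] :
    ∃ z : polyFunRing H, (∀ h, (z : H → H) h ∈ Subring.center H) ∧
      (∀ a b, (z : H → H) (a + b) = (z : H → H) a + (z : H → H) b) ∧
      (∀ t ∈ Subring.center H, ∀ a, (z : H → H) (t * a) = t * (z : H → H) a) ∧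
      ∃ e : H, (z : H → H) e = 1 := by
  obtain ⟨l, hl⟩ : ∃ l : Module.Dual (Subring.center H) H, l 1 ≠ 0 := by
    by_contra! h
    exact one_ne_zero ((Module.forall_dual_apply_eq_zero_iff (Subring.center H) (1 : H)).1 h)
  let f : Module.End (Subring.center H) H := (Algebra.linearMap (Subring.center H) H).comp l
  refine ⟨⟨f, mem_polyFunRing_of_linear f⟩, fun h => (l h).2, f.map_add,
    fun t ht a => f.map_smul ⟨t, ht⟩ a, ((l 1)⁻¹ • 1 : H), ?_⟩
  change ((l ((l 1)⁻¹ • 1) : Subring.center H) : H) = 1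
  rw [map_smul, smul_eq_mul, inv_mul_cancel₀ hl]
  rfl

end LinearForm

section Main

open Polynomial
open scoped TensorProduct

section

variable {H : Type*} [DivisionRing H] {C : Type*} [Field C] [Algebra C H]

lemma substCentral_mul_comm {z : polyFunRing H} (hz : ∀ h, (z : H → H) h ∈ Subring.center H)
    (p : C[X]) (r : polyFunRing H) : substCentral C z p * r = r * substCentral C z p := by
  induction p using Polynomial.induction_on' with
  | add p q hp hq => rw [map_add, add_mul, mul_add, hp, hq]
  | monomial n c =>
    have h1 : Commute (constPolyFun H (algebraMap C H c)) r :=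
      Subtype.ext (funext fun h => Algebra.commutes c ((r : H → H) h))
    have h2 : Commute z r :=
      Subtype.ext (funext fun h => (Subring.mem_center_iff.1 (hz h) _).symm)
    rw [← C_mul_X_pow_eq_monomial, map_mul, map_pow, substCentral_C, substCentral_X]
    exact h1.mul_left (h2.pow_left n)

lemma substCentral_injective [Infinite C] {z : polyFunRing H}
    (hzs : ∀ t ∈ Subring.center H, ∀ a, (z : H → H) (t * a) = t * (z : H → H) a)
    {e : H} (he : (z : H → H) e = 1) : Function.Injective (substCentral C z) := by
  rw [injective_iff_map_eq_zero]
  intro p hp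
  refine Polynomial.funext fun c => ?_
  have hc : (z : H → H) (algebraMap C H c * e) = algebraMap C H c := by
    rw [hzs _ (algebraMap_mem_center c), he, mul_one]
  have h := substCentral_apply p hc
  rw [hp] at h
  rw [eval_zero]
  exact (map_eq_zero (algebraMap C H)).1 h.symm

lemma map_mem_center_of_isClassicalRightQuotient {R F : Type*} [Ring R] [DivisionRing F]
    {φ : R →+* F} (hφ : IsClassicalRightQuotient φ) {s : R} (hs : ∀ r, s * r = r * s) :
    φ s ∈ Subring.center F := by
  have h : ∀ r, Commute (φ s) (φ r) := fun r => by
    rw [Commute, SemiconjBy, ← map_mul, ← map_mul, hs]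
  refine Subring.mem_center_iff.2 fun x => ?_
  obtain ⟨a, b, -, rfl⟩ := hφ.2 x
  exact ((h a).mul_right (h b).inv_right₀).eq.symm

end

lemma isAlgClosed_of_ringEquiv {K L : Type*} [Field K] [Field L] [IsAlgClosed K] (ε : L ≃+* K) :
    IsAlgClosed L := by
  refine IsAlgClosed.of_exists_root L fun p _ hp => ?_
  obtain ⟨x, hx⟩ := IsAlgClosed.exists_root (p.map ε.toRingHom) (by
    rw [degree_map]
    exact hp.degree_pos.ne')
  refine ⟨ε.symm x, ε.injective ?_⟩
  have : (p.map ε.toRingHom).eval (ε (ε.symm x)) = ε (p.eval (ε.symm x)) :=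
    eval_map_apply (f := ε.toRingHom) _
  rw [← this, ε.apply_symm_apply, map_zero]
  exact hx

/-- The inverse Galois problem over the fractions of the ring of polynomial functions, for a
central algebraically closed subfield living in the right universe. -/
theorem exists_isGaloisExt_of_algebra {H : Type*} [DivisionRing H]
    [FiniteDimensional (Subring.center H) H] {F : Type u} [DivisionRing F] (C : Type u) [Field C]
    [IsAlgClosed C] [Algebra C H] {φ : polyFunRing H →+* F} (hφ : IsClassicalRightQuotient φ)
    (G : Type*) [Group G] [Finite G] :
    ∃ (M : Type u) (_ : DivisionRing M) (ι : F →+* M), Function.Injective ι ∧ IsGaloisExt ι ∧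
      Nonempty (fixingAut ι ≃* G) := by
  have : Infinite C := IsAlgClosed.instInfinite
  obtain ⟨z, hz, hza, hzs, e, he⟩ := exists_linearForm_polyFun (H := H)
  let ψ : C[X] →+* Subring.center F := (φ.comp (substCentral C z)).codRestrict _ fun p =>
    map_mem_center_of_isClassicalRightQuotient hφ (substCentral_mul_comm hz p)
  have hψ : Function.Injective ψ := fun p q h =>
    substCentral_injective hzs he (hφ.1 (congrArg Subtype.val h))
  let : Algebra (RatFunc C) F :=
    ((Subring.center F).subtype.comp (IsFractionRing.lift (K := RatFunc C) hψ)).toAlgebra'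
      fun c x => (Subring.mem_center_iff.1 (IsFractionRing.lift hψ c).2 x).symm
  have hF : ∀ p : C[X], algebraMap (RatFunc C) F (algebraMap C[X] (RatFunc C) p) =
      φ (substCentral C z p) := fun p =>
    congrArg Subtype.val (IsFractionRing.lift_algebraMap hψ p)
  obtain ⟨N, _, _, _, _, ⟨ε⟩⟩ := exists_galois_ratFunc (C := C) G
  have : NoZeroDivisors (F ⊗[RatFunc C] N) := noZeroDivisors_tensor hφ hz hza hzs he hF
  obtain ⟨M, inst, ι, hι, hgal, ⟨ε'⟩⟩ :=
    exists_isGaloisExt_of_noZeroDivisors (Z := RatFunc C) (F := F) (N := N)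
  exact ⟨M, inst, ι, hι, hgal, ⟨ε'.trans ε⟩⟩

end Main

end Patching

theorem inverse_galois_over_polyFun_fractions_of_algClosed_subfield
    {H : Type v} [DivisionRing H] [FiniteDimensional (Subring.center H) H]
    (A : Type w) [Field A] [IsAlgClosed A] (emb : A →+* Subring.center H)
    {F : Type u} [DivisionRing F]
    (φ : polyFunRing H →+* F) (hφ : IsClassicalRightQuotient φ)
    (G : Type x) [Group G] [Finite G] :
    ∃ (M : Type u) (instM : DivisionRing M),
      letI := instM
      ∃ ι : F →+* M, Function.Injective ι ∧ IsGaloisExt ι ∧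
        Nonempty (fixingAut ι ≃* G) := by
  have : Small.{u} A := small_of_injective
    (φ.comp ((Patching.constPolyFun H).comp ((Subring.center H).subtype.comp emb))).injective
  let ε : Shrink.{u} A ≃+* A := Shrink.ringEquiv A
  have : IsAlgClosed (Shrink.{u} A) := Patching.isAlgClosed_of_ringEquiv ε
  let : Algebra (Shrink.{u} A) H :=
    ((Subring.center H).subtype.comp (emb.comp ε.toRingHom)).toAlgebra'
      fun c h => (Subring.mem_center_iff.1 (emb (ε c)).2 h).symm
  exact Patching.exists_isGaloisExt_of_algebra (Shrink.{u} A) hφ G
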